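/- Let s and s′ be distinct rational numbers in I_1(r;n) ∪ I_2(r;n). Then in the even Heckoid group Heck(r;n) = ⟨a, b | u_r^n⟩, the element u_s is conjugate neither to u_{s′} nor to u_{s′}^{−1}; that is, the simple loops α_s with s ∈ I_1(r;n) ∪ I_2(r;n) represent mutually distinct (unoriented) conjugacy classes in Heck(r;n). -/

import Mathlib

/- Formalization of statements from "Homotopically equivalent simple loops on
2-bridge spheres in Heckoid orbifolds for 2-bridge links (II)" by Lee-Sakuma.

We work in the free group `F` on two generators `a = gen 0`, `b = gen 1`.
For a rational `s` (in lowest terms `q/p`, with `0 ≤ s ≤ 1`), `uWord s` is the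
word `u_s = a b^{ε₁} a^{ε₂} ⋯ b^{ε_{2p-1}}` with `ε_i = (-1)^⌊i·s⌋`.
`CS s` is (a linear representative of) the cyclic sequence of lengths of
maximal constant-sign runs of exponents of `u_s`; since `u_s` begins with a
positive letter and (for `0 < s ≤ 1`) ends with a negative letter, the linear
run-length sequence represents the cyclic one.  `CyclicContains L T` says the
cyclic sequence represented by `L` contains `T` as a block of consecutive
terms.  `cfQ [m₁,…,m_k]` is the continued fraction `1/(m₁+1/(m₂+⋯+1/m_k))`.
`memI1 M n s` / `memI2 M n s` express `s ∈ I₁(r;n)` / `s ∈ I₂(r;n)` where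
`r = cfQ M`, and `memI1hat` / `memI2hat` express `s ∈ I₁(r)` / `s ∈ I₂(r)`.
The Heckoid group `Heck(r;n) = ⟨a,b | u_r^n⟩` is the quotient of `F` by the
normal closure `heckN r n` of `u_r^n`, with quotient map `heckQ r n`. -/

namespace Heckoid

abbrev F : Type := FreeGroup (Fin 2)

/-- The generators: `gen 0 = a`, `gen 1 = b` (and `gen i` depends on parity). -/
def gen (i : ℕ) : F := FreeGroup.of ⟨i % 2, Nat.mod_lt _ (by norm_num)⟩

/-- The word `u_s = a b^{ε₁} a^{ε₂} b^{ε₃} ⋯ a^{ε_{2p-2}} b^{ε_{2p-1}}`,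
where `s = q/p` in lowest terms and `ε_i = (-1)^⌊iq/p⌋`. -/
def uWord (s : ℚ) : F :=
  ((List.range (2 * s.den)).map
    (fun i => gen i ^ ((-1 : ℤ) ^ (⌊(i : ℚ) * s⌋.toNat)))).prod

/-- The sequence of exponent signs `ε₀, ε₁, …, ε_{2p-1}` of `u_s`. -/
def signList (s : ℚ) : List ℤ :=
  (List.range (2 * s.den)).map (fun i => (-1 : ℤ) ^ (⌊(i : ℚ) * s⌋.toNat))

/-- Lengths of the maximal runs of equal consecutive entries. -/
def runLengths {α : Type} [BEq α] (l : List α) : List ℕ :=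
  (l.splitBy (· == ·)).map List.length

/-- `CS s = CS(u_s)`: the cyclic sequence of lengths of maximal constant-sign
runs of `u_s`, represented by a list. -/
def CS (s : ℚ) : List ℕ := runLengths (signList s)

/-- The cyclic sequence represented by `L` contains `T` as a block of
consecutive terms. -/
def CyclicContains (L T : List ℕ) : Prop := ∃ k, T <+: L.rotate k

/-- The continued fraction `[m₁, m₂, …, m_k] = 1/(m₁+1/(m₂+⋯+1/m_k))`. -/
def cfQ : List ℕ → ℚ
  | [] => 0
  | a :: l => 1 / ((a : ℚ) + cfQ l)

/-- `d⟨T, T'⟩`: `d` consecutive repetitions of the concatenation of `T` and `T'`. -/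
def rep2 (d : ℕ) (T T' : List ℕ) : List ℕ := (List.replicate d (T ++ T')).flatten

/-- `s ∈ I₁(r;n)` where `r = cfQ M`:  `[0, [m₁,…,m_{k-1},m_k-1,2]]` for `k` even,
`[0, [m₁,…,m_k,2n-2])` for `k` odd. -/
def memI1 (M : List ℕ) (n : ℕ) (s : ℚ) : Prop :=
  if Even M.length then 0 ≤ s ∧ s ≤ cfQ (M.dropLast ++ [M.getLast! - 1, 2])
  else 0 ≤ s ∧ s < cfQ (M ++ [2 * n - 2])

/-- `s ∈ I₂(r;n)` where `r = cfQ M`: `([m₁,…,m_k,2n-2], 1]` for `k` even,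
`[[m₁,…,m_{k-1},m_k-1,2], 1]` for `k` odd. -/
def memI2 (M : List ℕ) (n : ℕ) (s : ℚ) : Prop :=
  if Even M.length then cfQ (M ++ [2 * n - 2]) < s ∧ s ≤ 1
  else cfQ (M.dropLast ++ [M.getLast! - 1, 2]) ≤ s ∧ s ≤ 1

/-- `s ∈ I₁(r)` where `r = cfQ M`. -/
def memI1hat (M : List ℕ) (s : ℚ) : Prop :=
  if Even M.length then 0 ≤ s ∧ s ≤ cfQ (M.dropLast ++ [M.getLast! - 1])
  else 0 ≤ s ∧ s ≤ cfQ M.dropLast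

/-- `s ∈ I₂(r)` where `r = cfQ M`. -/
def memI2hat (M : List ℕ) (s : ℚ) : Prop :=
  if Even M.length then cfQ M.dropLast ≤ s ∧ s ≤ 1
  else cfQ (M.dropLast ++ [M.getLast! - 1]) ≤ s ∧ s ≤ 1

/-- The normal closure of `u_r^n`, so that `Heck(r;n) = F ⧸ heckN r n`. -/
abbrev heckN (r : ℚ) (n : ℕ) : Subgroup F := Subgroup.normalClosure {uWord r ^ n}

/-- The quotient map `F → Heck(r;n) = ⟨a, b | u_r^n⟩`. -/
def heckQ (r : ℚ) (n : ℕ) : F →* F ⧸ heckN r n := QuotientGroup.mk' (heckN r n)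

/-- A reduced spherical diagram with relator faces (`kd = none`) and two special faces
(`kd = some i`), recorded through its darts. -/
structure Diagram (ι : Type) [Fintype ι] [DecidableEq ι] where
  n : ℤ
  p : ℤ
  μ : ℤ
  q : ℤ
  ps : Bool → ℤ
  qs : Bool → ℤ
  φ : Equiv.Perm ι
  α : Equiv.Perm ι
  kd : ι → Option Bool
  c : ι → ℤ
  x : ι → ℤ
  N : ℤ
  hn : 2 ≤ n
  hp : 2 ≤ p
  hμ0 : 0 < μ
  hμp : μ < p
  hq0 : 0 < q
  hqp : q < p
  hμq : p ∣ μ * q + 1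
  hps : ∀ i, 0 < ps i
  α_α : ∀ d, α (α d) = d
  kd_φ : ∀ d, kd (φ d) = kd d
  c01 : ∀ d, c d = 0 ∨ c d = 1
  c_two : ∀ d, φ (α (φ d)) = α d → c (α d) = c (φ d)
  c_four : ∀ e, α (φ⁻¹ (α (φ⁻¹ (α (φ⁻¹ (α (φ⁻¹ e))))))) = e →
    2 ∣ c e + c (α (φ⁻¹ e)) + c (α (φ⁻¹ (α (φ⁻¹ e)))) + c (α (φ⁻¹ (α (φ⁻¹ (α (φ⁻¹ e))))))
  x_nonneg : ∀ d, 0 ≤ x d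
  x_lt_r : ∀ d, kd d = none → x d < p
  x_lt_s : ∀ d i, kd d = some i → x d < ps i
  x_r : ∀ d, kd d = none → x (φ d) = x d + q - p * c (φ d)
  x_s : ∀ d i, kd d = some i → x (φ d) = x d + qs i - ps i * c (φ d)
  reduced : ∀ d, kd d = none → kd (α d) = none → x d + x (α d) ≠ p - 1
  period_r : ∀ d, kd d = none → (φ ^ (2 * n * p)) d = d
  card_r : ((Finset.univ.filter (fun d => kd d = none)).card : ℤ) = 2 * n * p * N
  card_s : ∀ i, ((Finset.univ.filter (fun d => kd d = some i)).card : ℤ) = 2 * ps i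
  trans_s : ∀ d e i, kd d = some i → kd e = some i → ∃ k : ℕ, (φ ^ k) d = e
  euler : ∀ Z : Finset ι, Z.Nonempty → (∀ d ∈ Z, φ d ∈ Z) → (∀ d ∈ Z, α d ∈ Z) →
    2 * n * p * ((Z.filter (fun d => φ (α (φ d)) ≠ α d)).card + 8
      - (if ∃ d ∈ Z, kd d = some false then 4 else 0)
      - (if ∃ d ∈ Z, kd d = some true then 4 else 0) +
      (if ∃ d ∈ Z, φ (α (φ d)) ≠ α d ∧
        α (φ⁻¹ (α (φ⁻¹ (α (φ⁻¹ (α d)))))) ≠ φ d then 1 else 0))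
      ≤ 4 * ((Z.filter (fun d => kd d = none)).card : ℤ)
  b_ne : ∀ i, p * qs i - q * ps i ≠ 0
  slopes : ps false * qs true ≠ ps true * qs false
  far_pos : ∀ i, 0 < p * qs i - q * ps i →
    ps i < ((2 * n - 2) * p + μ) * (p * qs i - q * ps i)
  far_neg : ∀ i, p * qs i - q * ps i < 0 →
    ps i < ((2 * n - 2) * p + (p - μ)) * (q * ps i - p * qs i)
  far_opp : (p * qs false - q * ps false) + (p * qs true - q * ps true) = 0 →
    ps false + ps true < 2 * n * p * |p * qs false - q * ps false|

namespace Diagram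

variable {ι : Type} [Fintype ι] [DecidableEq ι] (D : Diagram ι)

/-- The reflected diagram, exchanging `0` and `1` among the corner bits. -/
def mirror : Diagram ι where
  n := D.n
  p := D.p
  μ := D.p - D.μ
  q := D.p - D.q
  ps := D.ps
  qs := fun i => D.ps i - D.qs i
  φ := D.φ
  α := D.α
  kd := D.kd
  c := fun d => 1 - D.c d
  x := fun d => (match D.kd d with | none => D.p | some i => D.ps i) - 1 - D.x d
  N := D.N
  hn := D.hn
  hp := D.hp
  hμ0 := by linarith [D.hμp]
  hμp := by linarith [D.hμ0]
  hq0 := by linarith [D.hqp]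
  hqp := by linarith [D.hq0]
  hμq := by
    obtain ⟨k, hk⟩ := D.hμq
    exact ⟨D.p - D.μ - D.q + k, by linear_combination hk⟩
  hps := D.hps
  α_α := D.α_α
  kd_φ := D.kd_φ
  c01 d := by rcases D.c01 d with h | h <;> simp [h]
  c_two d h := by rw [D.c_two d h]
  c_four e h := by
    obtain ⟨k, hk⟩ := D.c_four e h
    exact ⟨2 - k, by linear_combination -hk⟩
  x_nonneg d := by
    rcases h : D.kd d with _ | i
    · simp only; linarith [D.x_lt_r d h]
    · simp only; linarith [D.x_lt_s d i h]
  x_lt_r d h := by simp only [h]; linarith [D.x_nonneg d]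
  x_lt_s d i h := by simp only [h]; linarith [D.x_nonneg d]
  x_r d h := by simp only [D.kd_φ, h]; linear_combination - D.x_r d h
  x_s d i h := by simp only [D.kd_φ, h]; linear_combination - D.x_s d i h
  reduced d h h' := by
    have := D.reduced d h h'
    simp only [h, h']
    intro h2; apply this; linarith
  period_r := D.period_r
  card_r := D.card_r
  card_s := D.card_s
  trans_s := D.trans_s
  euler := D.euler
  b_ne i := by
    have := D.b_ne i
    intro h; apply this; linear_combination -h
  slopes := by
    have := D.slopes
    intro h; apply this; linear_combination -h
  far_pos i h := by
    have := D.far_neg i (by nlinarith)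
    nlinarith
  far_neg i h := by
    have := D.far_pos i (by nlinarith)
    nlinarith
  far_opp h := by
    have := D.far_opp (by linear_combination -h)
    rw [show D.p * (D.ps false - D.qs false) - (D.p - D.q) * D.ps false
      = -(D.p * D.qs false - D.q * D.ps false) by ring, abs_neg]
    exact this

/-- There is a break after the dart `d`. -/
def br (d : ι) : Prop := D.φ (D.α (D.φ d)) ≠ D.α d

instance (d : ι) : Decidable (D.br d) := by unfold br; infer_instance

/-- The dart `k` steps after `d` on its face. -/
def it (k : ℤ) (d : ι) : ι := (D.φ ^ k) d

/-- The signed determinant of the slope of the special face `i` with that of the relator. -/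
def b (i : Bool) : ℤ := D.p * D.qs i - D.q * D.ps i

@[simp] lemma it_zero (d : ι) : D.it 0 d = d := by simp [it]

lemma it_it (j k : ℤ) (d : ι) : D.it j (D.it k d) = D.it (j + k) d := by
  simp [it, zpow_add]

lemma it_succ (k : ℤ) (d : ι) : D.it (k + 1) d = D.φ (D.it k d) := by
  rw [add_comm]; simp [it, zpow_add]

lemma φ_it (k : ℤ) (d : ι) : D.φ (D.it k d) = D.it (k + 1) d := (D.it_succ k d).symm

lemma φinv_it (k : ℤ) (d : ι) : D.φ⁻¹ (D.it k d) = D.it (k - 1) d := by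
  rw [Equiv.Perm.inv_eq_iff_eq, φ_it]; simp

lemma φ_eq (d : ι) : D.φ d = D.it 1 d := by simp [it]

lemma φinv_eq (d : ι) : D.φ⁻¹ d = D.it (-1) d := by simp [it]

@[simp] lemma kd_it (k : ℤ) (d : ι) : D.kd (D.it k d) = D.kd d := by
  induction k using Int.induction_on with
  | zero => simp
  | succ k ih => rw [it_succ, D.kd_φ, ih]
  | pred k ih => rw [← ih, ← D.kd_φ (D.it (-k - 1) d), φ_it]; simp

lemma α_α' (d : ι) : D.α (D.α d) = d := D.α_α d

/-- The two ways of reading a degenerate corner agree. -/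
lemma br_α (e : ι) : D.br (D.α e) ↔ D.br (D.it (-1) e) := by
  unfold br
  rw [D.α_α, φ_it]
  simp only [neg_add_cancel, it_zero]
  rw [not_iff_not, ← D.φinv_eq]
  constructor
  · intro h
    rw [← D.α_α (D.φ (D.α e)), Equiv.apply_eq_iff_eq, Equiv.Perm.eq_inv_iff_eq, h]
  · intro h
    rw [h, D.α_α]; simp

lemma α_succ {d : ι} (h : ¬ D.br d) : D.α (D.it 1 d) = D.it (-1) (D.α d) := by
  rw [br, not_not] at h
  rw [← h, φ_eq, φ_eq, it_it]; simp

lemma α_run {d : ι} {k : ℕ} (h : ∀ j : ℕ, j < k → ¬ D.br (D.it j d)) :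
    D.α (D.it k d) = D.it (-k) (D.α d) := by
  induction k with
  | zero => simp
  | succ k ih =>
    have h1 := D.α_succ (h k (by omega))
    rw [it_it, add_comm] at h1
    push_cast
    rw [h1, ih (fun j hj => h j (by omega)), it_it]
    congr 1; ring

/-- Mates along a stretch without breaks. -/
lemma α_run' {d : ι} {i j : ℤ} (hij : i ≤ j) (h : ∀ k, i ≤ k → k < j → ¬ D.br (D.it k d)) :
    D.α (D.it j d) = D.it (i - j) (D.α (D.it i d)) := by
  obtain ⟨k, rfl⟩ : ∃ k : ℕ, j = i + k := ⟨(j - i).toNat, by omega⟩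
  have := D.α_run (d := D.it i d) (k := k) (fun l hl => by
    rw [it_it]; exact h _ (by omega) (by omega))
  rw [it_it] at this
  rw [show i + (k:ℤ) = k + i by ring, this]; congr 1; ring

lemma kd_run {d : ι} {i j : ℤ} (hij : i ≤ j) (h : ∀ k, i ≤ k → k < j → ¬ D.br (D.it k d)) :
    D.kd (D.α (D.it j d)) = D.kd (D.α (D.it i d)) := by
  rw [D.α_run' hij h, kd_it]

lemma c_succ {d : ι} (h : ¬ D.br d) : D.c (D.α d) = D.c (D.it 1 d) := by
  rw [← φ_eq]; exact D.c_two d (by simpa [br] using h)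

lemma x_r' {d : ι} (h : D.kd d = none) : D.x (D.it 1 d) = D.x d + D.q - D.p * D.c (D.it 1 d) := by
  rw [← φ_eq]; exact D.x_r d h

lemma x_s' {d : ι} {i : Bool} (h : D.kd d = some i) :
    D.x (D.it 1 d) = D.x d + D.qs i - D.ps i * D.c (D.it 1 d) := by
  rw [← φ_eq]; exact D.x_s d i h

lemma x_r_pred {d : ι} (h : D.kd d = none) : D.x (D.it (-1) d) = D.x d - D.q + D.p * D.c d := by
  have := D.x_r' (d := D.it (-1) d) (by simpa using h)
  rw [it_it] at this; simp at this; linarith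

lemma x_s_pred {d : ι} {i : Bool} (h : D.kd d = some i) :
    D.x (D.it (-1) d) = D.x d - D.qs i + D.ps i * D.c d := by
  have := D.x_s' (d := D.it (-1) d) (i := i) (by simpa using h)
  rw [it_it] at this; simp at this; linarith

lemma x_it_r {d : ι} (h : D.kd d = none) (k : ℤ) :
    D.x (D.it k d) = (D.x d + k * D.q) % D.p := by
  have key : D.p ∣ D.x (D.it k d) - (D.x d + k * D.q) := by
    induction k using Int.induction_on with
    | zero => simp
    | succ k ih =>
      obtain ⟨m, hm⟩ := ih
      refine ⟨m - D.c (D.φ (D.it k d)), ?_⟩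
      rw [it_succ, D.x_r _ (by simpa using h)]; linear_combination hm
    | pred k ih =>
      obtain ⟨m, hm⟩ := ih
      have h1 := D.x_r (D.it (-k - 1) d) (by simpa using h)
      rw [φ_it, sub_add_cancel] at h1
      exact ⟨m + D.c (D.it (-k) d), by linear_combination hm - h1⟩
  have h1 := D.x_nonneg (D.it k d)
  have h2 := D.x_lt_r (D.it k d) (by simpa using h)
  have := Int.emod_eq_emod_iff_emod_sub_eq_zero.2 (Int.emod_eq_zero_of_dvd key)
  rwa [Int.emod_eq_of_lt h1 h2] at this

/-- The number of letters of a relator face. -/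
def len : ℤ := 2 * D.n * D.p

lemma len_ge : 4 * D.p ≤ D.len := by unfold len; nlinarith [D.hn, D.hp]

lemma it_len {d : ι} (h : D.kd d = none) : D.it D.len d = d := D.period_r d h

lemma it_add_len {d : ι} (h : D.kd d = none) (k : ℤ) : D.it (k + D.len) d = D.it k d := by
  rw [← it_it, D.it_len h]

lemma eq_of_dvd_of_range {a b p : ℤ} (ha : 0 ≤ a) (ha' : a < p) (hb : 0 ≤ b) (hb' : b < p)
    (h : p ∣ a - b) : a = b := by
  have := Int.emod_eq_emod_iff_emod_sub_eq_zero.2 (Int.emod_eq_zero_of_dvd h)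
  rwa [Int.emod_eq_of_lt ha ha', Int.emod_eq_of_lt hb hb'] at this

lemma x_dvd {d : ι} (h : D.kd d = none) (j k : ℤ) :
    D.p ∣ D.x (D.it k d) - D.x (D.it j d) - (k - j) * D.q := by
  rw [D.x_it_r h, D.x_it_r h]
  have h1 := Int.emod_add_mul_ediv (D.x d + k * D.q) D.p
  have h2 := Int.emod_add_mul_ediv (D.x d + j * D.q) D.p
  exact ⟨(D.x d + j * D.q) / D.p - (D.x d + k * D.q) / D.p, by linear_combination h1 - h2⟩

lemma dvd_of_dvd_q {k : ℤ} (h : D.p ∣ k * D.q) : D.p ∣ k := by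
  obtain ⟨m, hm⟩ := D.hμq
  obtain ⟨l, hl⟩ := h
  exact ⟨k * m - D.μ * l, by linear_combination k * hm - D.μ * hl⟩

/-- The position of `0` modulo `p` determines all positions. -/
lemma x_eq_of_dvd {d : ι} (h : D.kd d = none) {j k : ℤ} (hd : D.p ∣ k - j) :
    D.x (D.it k d) = D.x (D.it j d) := by
  refine eq_of_dvd_of_range (D.x_nonneg _) (D.x_lt_r _ (by simpa)) (D.x_nonneg _)
    (D.x_lt_r _ (by simpa)) ?_
  have h1 := D.x_dvd h j k
  obtain ⟨m, hm⟩ := h1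
  obtain ⟨l, hl⟩ := hd
  exact ⟨m + l * D.q, by linear_combination hm + D.q * hl⟩

lemma dvd_of_x_eq {d : ι} (h : D.kd d = none) {j k : ℤ}
    (hx : D.x (D.it k d) = D.x (D.it j d)) : D.p ∣ k - j := by
  obtain ⟨m, hm⟩ := D.x_dvd h j k
  exact D.dvd_of_dvd_q ⟨-m, by rw [hx] at hm; linear_combination -hm⟩

/-- `k` is the position, relative to `d`, of a dart with value `0`. -/
def zero (d : ι) (k : ℤ) : Prop := D.x (D.it k d) = 0

/-- `k` is the position, relative to `d`, of a dart with value `p - 1`. -/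
def top (d : ι) (k : ℤ) : Prop := D.x (D.it k d) = D.p - 1

lemma top_of_zero {d : ι} (h : D.kd d = none) {k j : ℤ} (hz : D.zero d k)
    (hj : D.p ∣ j - k - D.μ) : D.top d j := by
  unfold zero at hz; unfold top
  refine eq_of_dvd_of_range (D.x_nonneg _) (D.x_lt_r _ (by simpa)) (by linarith [D.hp])
    (by linarith) ?_
  obtain ⟨m, hm⟩ := D.x_dvd h k j
  obtain ⟨l, hl⟩ := D.hμq
  obtain ⟨t, ht⟩ := hj
  exact ⟨m + l + t * D.q - 1, by rw [hz] at hm; linear_combination hm + hl + D.q * ht⟩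

lemma zero_of_zero {d : ι} (h : D.kd d = none) {k j : ℤ} (hz : D.zero d k)
    (hj : D.p ∣ j - k) : D.zero d j := by
  unfold zero at *; rw [← hz]; exact D.x_eq_of_dvd h hj

lemma dvd_zero_zero {d : ι} (h : D.kd d = none) {k j : ℤ} (hz : D.zero d k)
    (hj : D.zero d j) : D.p ∣ j - k :=
  D.dvd_of_x_eq h (by unfold zero at *; rw [hz, hj])

lemma dvd_zero_top {d : ι} (h : D.kd d = none) {k j : ℤ} (hz : D.zero d k)
    (hj : D.top d j) : D.p ∣ j - k - D.μ := by
  have h1 := D.top_of_zero h hz (j := k + D.μ) (by simp)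
  have h2 := D.dvd_of_x_eq h (j := k + D.μ) (k := j) (by unfold top at *; rw [h1, hj])
  rwa [← sub_sub] at h2

lemma exists_zero {d : ι} (h : D.kd d = none) (l : ℤ) :
    ∃ z, l ≤ z ∧ z < l + D.p ∧ D.zero d z := by
  have hp := D.hp
  refine ⟨l + (D.μ * D.x d - l) % D.p, ?_, ?_, ?_⟩
  · linarith [Int.emod_nonneg (D.μ * D.x d - l) (show D.p ≠ 0 by linarith)]
  · linarith [Int.emod_lt_of_pos (D.μ * D.x d - l) (show 0 < D.p by linarith)]
  · unfold zero
    refine eq_of_dvd_of_range (D.x_nonneg _) (D.x_lt_r _ (by simpa)) le_rfl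
      (by linarith [D.hp]) ?_
    obtain ⟨m, hm⟩ := D.x_dvd h 0 (l + (D.μ * D.x d - l) % D.p)
    obtain ⟨t, ht⟩ := D.hμq
    have h1 := Int.emod_add_mul_ediv (D.μ * D.x d - l) D.p
    set e := (D.μ * D.x d - l) % D.p
    set f := (D.μ * D.x d - l) / D.p
    simp only [it_zero] at hm
    exact ⟨m + t * D.x d - f * D.q, by linear_combination hm + D.x d * ht + D.q * h1⟩

/-- On a stretch glued to relators, the marks `0` and `p - 1` do not both occur. -/
lemma run_rr {d : ι} (h : D.kd d = none) {i j : ℤ} (hij : i ≤ j)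
    (hb : ∀ k, i ≤ k → k < j → ¬ D.br (D.it k d)) (hk : D.kd (D.α (D.it i d)) = none) :
    D.x (D.it j d) + D.x (D.α (D.it j d)) = D.x (D.it i d) + D.x (D.α (D.it i d)) := by
  obtain ⟨k, rfl⟩ : ∃ k : ℕ, j = i + k := ⟨(j - i).toNat, by omega⟩
  clear hij
  induction k with
  | zero => simp
  | succ k ih =>
    have hb' : ∀ l, i ≤ l → l < i + k → ¬ D.br (D.it l d) :=
      fun l h1 h2 => hb l h1 (by push_cast; omega)
    have hbk := hb (i + k) (by omega) (by push_cast; omega)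
    have hkk : D.kd (D.α (D.it (i + k) d)) = none := by rw [D.kd_run (by omega) hb', hk]
    rw [← ih hb']
    have e1 := D.x_r' (d := D.it (i + k) d) (by simpa)
    have e2 := D.x_r_pred hkk
    have e3 := D.c_succ hbk
    rw [← D.α_succ hbk] at e2
    rw [it_it, show 1 + (i + (k : ℤ)) = i + ((k + 1 : ℕ) : ℤ) by push_cast; ring] at e1 e2 e3
    rw [e3] at e2
    linarith

lemma run_rs {d : ι} {s : Bool} (h : D.kd d = none) {i j : ℤ} (hij : i ≤ j)
    (hb : ∀ k, i ≤ k → k < j → ¬ D.br (D.it k d)) (hk : D.kd (D.α (D.it i d)) = some s) :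
    D.ps s * D.x (D.it j d) + D.p * D.x (D.α (D.it j d)) =
      D.ps s * D.x (D.it i d) + D.p * D.x (D.α (D.it i d)) - (j - i) * D.b s := by
  obtain ⟨k, rfl⟩ : ∃ k : ℕ, j = i + k := ⟨(j - i).toNat, by omega⟩
  clear hij
  induction k with
  | zero => simp
  | succ k ih =>
    have hb' : ∀ l, i ≤ l → l < i + k → ¬ D.br (D.it l d) :=
      fun l h1 h2 => hb l h1 (by push_cast; omega)
    have hbk := hb (i + k) (by omega) (by push_cast; omega)
    have hkk : D.kd (D.α (D.it (i + k) d)) = some s := by rw [D.kd_run (by omega) hb', hk]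
    have ih := ih hb'
    have e1 := D.x_r' (d := D.it (i + k) d) (by simpa)
    have e2 := D.x_s_pred hkk
    have e3 := D.c_succ hbk
    rw [← D.α_succ hbk] at e2
    rw [it_it, show 1 + (i + (k : ℤ)) = i + ((k + 1 : ℕ) : ℤ) by push_cast; ring] at e1 e2 e3
    rw [e3] at e2
    rw [e1, e2]; push_cast at ih ⊢; unfold b at *
    linear_combination ih

lemma no_zero_top_rr {d : ι} (h : D.kd d = none) {i j : ℤ} (hij : i ≤ j)
    (hb : ∀ k, i ≤ k → k < j → ¬ D.br (D.it k d)) (hk : D.kd (D.α (D.it i d)) = none) :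
    ¬ (D.zero d i ∧ D.top d j) ∧ ¬ (D.top d i ∧ D.zero d j) := by
  have h1 := D.run_rr h hij hb hk
  have hkj : D.kd (D.α (D.it j d)) = none := by rw [D.kd_run hij hb, hk]
  have r1 := D.reduced (D.it i d) (by simpa) hk
  have n1 := D.x_nonneg (D.α (D.it i d))
  have n2 := D.x_lt_r _ hk
  have n3 := D.x_nonneg (D.α (D.it j d))
  have n4 := D.x_lt_r _ hkj
  unfold zero top
  constructor <;> rintro ⟨h2, h3⟩ <;> rw [h2, h3] at h1 <;> rw [h2] at r1 <;> omega

/-- A stretch glued to a special face and joining marks `0` and `p - 1` (in either order). -/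
lemma run_zero_top {d : ι} {s : Bool} (h : D.kd d = none) {i j k l : ℤ} (hki : k ≤ i) (hkj : k ≤ j)
    (hil : i ≤ l) (hjl : j ≤ l) (hb : ∀ t, k ≤ t → t < l → ¬ D.br (D.it t d))
    (hk : D.kd (D.α (D.it k d)) = some s) (hi : D.zero d i) (hj : D.top d j) :
    (j - i) * D.b s ≤ D.ps s - D.p := by
  have e1 := D.run_rs h hki (fun t h1 h2 => hb t h1 (by omega)) hk
  have e2 := D.run_rs h hkj (fun t h1 h2 => hb t h1 (by omega)) hk
  have k1 : D.kd (D.α (D.it i d)) = some s := by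
    rw [D.kd_run hki (fun t h1 h2 => hb t h1 (by omega)), hk]
  have n2 := D.x_lt_s _ _ k1
  have n3 := D.x_nonneg (D.α (D.it j d))
  unfold zero at hi; unfold top at hj
  rw [hi] at e1; rw [hj] at e2
  have hp := D.hp
  nlinarith

lemma b_far {s : Bool} (h : 0 < D.b s) : D.ps s < ((2 * D.n - 2) * D.p + D.μ) * D.b s :=
  D.far_pos s h

lemma mirror_b (s : Bool) : D.mirror.b s = - D.b s := by
  simp only [b, mirror]; ring

lemma mirror_α (d : ι) : D.mirror.α d = D.α d := rfl
lemma mirror_it (k : ℤ) (d : ι) : D.mirror.it k d = D.it k d := rfl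
lemma mirror_p : D.mirror.p = D.p := rfl

lemma mirror_x_r {d : ι} (h : D.kd d = none) : D.mirror.x d = D.p - 1 - D.x d := by
  simp [mirror, h]

lemma mirror_zero {d : ι} (h : D.kd d = none) (k : ℤ) : D.mirror.zero d k ↔ D.top d k := by
  unfold zero top
  rw [mirror_it, D.mirror_x_r (by simpa)]; constructor <;> intro h <;> linarith

lemma mirror_top {d : ι} (h : D.kd d = none) (k : ℤ) : D.mirror.top d k ↔ D.zero d k := by
  unfold zero top
  rw [mirror_it, D.mirror_x_r (by simpa), mirror_p]; constructor <;> intro h <;> linarith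

/-- The positions `K, …, len - 1` (relative to `d`) form a stretch glued to the special face `s`. -/
def Tail (d : ι) (K : ℤ) (s : Bool) : Prop :=
  D.kd d = none ∧ 0 ≤ K ∧ K < D.len ∧ D.kd (D.α (D.it K d)) = some s ∧
    ∀ k, K ≤ k → k < D.len - 1 → ¬ D.br (D.it k d)

lemma Tail.mirror {D : Diagram ι} {d : ι} {K : ℤ} {s : Bool} (h : D.Tail d K s) :
    D.mirror.Tail d K s := h

lemma Tail.no_far {D : Diagram ι} {d : ι} {K : ℤ} {s : Bool} (h : D.Tail d K s) (hb : 0 < D.b s)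
    {i j : ℤ} (hi : K ≤ i) (hj : K ≤ j) (hi' : i < D.len) (hj' : j < D.len) (hz : D.zero d i)
    (ht : D.top d j) : j - i < (2 * D.n - 2) * D.p + D.μ := by
  obtain ⟨h1, h2, h3, h4, h5⟩ := h
  have := D.run_zero_top (l := D.len - 1) h1 hi hj (by omega) (by omega) h5 h4 hz ht
  have := D.b_far hb
  have := D.hp
  by_contra! hc
  nlinarith

lemma Tail.near_of_pos {D : Diagram ι} {d : ι} {K : ℤ} {s : Bool} (h : D.Tail d K s)
    (hb : 0 < D.b s) :
    (∃ z, 0 ≤ z ∧ z < K ∧ z < D.p ∧ D.zero d z) ∧ (∃ z, 0 ≤ z ∧ z < K ∧ z < D.p ∧ D.top d z) ∧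
    (∃ z, 0 ≤ z ∧ z < K ∧ K - D.p ≤ z ∧ D.zero d z) ∧
    (∃ z, 0 ≤ z ∧ z < K ∧ K - D.p ≤ z ∧ D.top d z) := by
  have hr := h.1
  have hK0 := h.2.1
  have hμ0 := D.hμ0
  have hμp := D.hμp
  have hlen : D.len = (2 * D.n - 2) * D.p + 2 * D.p := by unfold len; ring
  have hn : 2 * D.p ≤ (2 * D.n - 2) * D.p := by nlinarith [D.hn, D.hp]
  set M := (2 * D.n - 2) * D.p with hM
  have dvdM : D.p ∣ M := ⟨2 * D.n - 2, by rw [hM]; ring⟩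
  have key : ∀ i, K ≤ i → i + M + D.μ < D.len → ¬ D.zero d i := fun i h1 h2 hz => by
    have := h.no_far hb h1 (j := i + M + D.μ) (by omega) (by omega) h2 hz
      (D.top_of_zero hr hz (by ring_nf; exact dvdM))
    rw [← hM] at this; omega
  obtain ⟨z, hz0, hzp, hz⟩ := D.exists_zero hr 0
  obtain ⟨y, hy0, hyp, hy⟩ := D.exists_zero hr (K - D.p)
  rw [zero_add] at hzp
  have hzK : z < K := by
    by_contra! hc
    exact key z hc (by omega) hz
  have hzt : ∀ m, D.top d (z + D.μ + m * D.p) := fun m =>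
    D.top_of_zero hr hz ⟨m, by ring⟩
  have hyt : ∀ m, D.top d (y + D.μ + m * D.p) := fun m =>
    D.top_of_zero hr hy ⟨m, by ring⟩
  have hzz : ∀ m, D.zero d (z + m * D.p) := fun m => D.zero_of_zero hr hz ⟨m, by ring⟩
  have hyy : ∀ m, D.zero d (y + m * D.p) := fun m => D.zero_of_zero hr hy ⟨m, by ring⟩
  have hy0' : 0 ≤ y := by
    by_contra! hc
    exact key (y + 1 * D.p) (by omega) (by omega) (hyy 1)
  refine ⟨⟨z, hz0, hzK, hzp, hz⟩, ?_, ⟨y, hy0', by omega, by omega, hy⟩, ?_⟩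
  · by_cases h1 : z + D.μ < D.p
    · refine ⟨z + D.μ, by omega, ?_, h1, by simpa using hzt 0⟩
      by_contra! hc
      by_cases h2 : K ≤ z + D.p
      · exact key (z + 1 * D.p) (by omega) (by omega) (hzz 1)
      · omega
    · exact ⟨z + D.μ + (-1) * D.p, by omega, by omega, by omega, hzt _⟩
  · by_cases h1 : y + D.μ < K
    · exact ⟨y + D.μ, by omega, h1, by omega, by simpa using hyt 0⟩
    · refine ⟨y + D.μ + (-1) * D.p, ?_, by omega, by omega, hyt _⟩
      by_contra! hc
      have := key (y + 1 * D.p) (by omega) (by omega)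
      exact this (hyy 1)

lemma Tail.near {D : Diagram ι} {d : ι} {K : ℤ} {s : Bool} (h : D.Tail d K s) :
    (∃ z, 0 ≤ z ∧ z < K ∧ z < D.p ∧ D.zero d z) ∧ (∃ z, 0 ≤ z ∧ z < K ∧ z < D.p ∧ D.top d z) ∧
    (∃ z, 0 ≤ z ∧ z < K ∧ K - D.p ≤ z ∧ D.zero d z) ∧
    (∃ z, 0 ≤ z ∧ z < K ∧ K - D.p ≤ z ∧ D.top d z) := by
  rcases lt_or_gt_of_ne (D.b_ne s) with hb | hb
  · have := h.mirror.near_of_pos (by rw [mirror_b]; unfold b; linarith)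
    simp only [D.mirror_zero h.1, D.mirror_top h.1, mirror_p] at this
    obtain ⟨h1, h2, h3, h4⟩ := this
    exact ⟨h2, h1, h4, h3⟩
  · exact h.near_of_pos hb

lemma len_pos : 0 < D.len := by linarith [D.len_ge, D.hp]

lemma it_emod {d : ι} (h : D.kd d = none) (k : ℤ) : D.it (k % D.len) d = D.it k d := by
  have key : ∀ m : ℤ, D.it (D.len * m) d = d := by
    intro m
    unfold it
    rw [zpow_mul]
    exact (Function.IsFixedPt.perm_zpow (D.period_r d h) m)
  conv_rhs => rw [← Int.emod_add_mul_ediv k D.len]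
  rw [← it_it, key]

/-- How many of the `len` darts of a relator face satisfy `P`. -/
noncomputable def cnt (P : ι → Prop) [DecidablePred P] (d : ι) : ℕ :=
  ((Finset.Ico 0 D.len).filter (fun k => P (D.it k d))).card

lemma cnt_it (P : ι → Prop) [DecidablePred P] {d : ι} (h : D.kd d = none) (j : ℤ) :
    D.cnt P (D.it j d) = D.cnt P d := by
  have hl := D.len_pos
  refine Finset.card_nbij' (fun k => (k + j) % D.len) (fun k => (k - j) % D.len) ?_ ?_ ?_ ?_
  · intro k hk
    simp only [Finset.coe_filter, Finset.mem_Ico, Set.mem_ofPred_eq] at hk ⊢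
    refine ⟨⟨Int.emod_nonneg _ hl.ne', Int.emod_lt_of_pos _ hl⟩, ?_⟩
    rw [D.it_emod h, ← it_it]; exact hk.2
  · intro k hk
    simp only [Finset.coe_filter, Finset.mem_Ico, Set.mem_ofPred_eq] at hk ⊢
    refine ⟨⟨Int.emod_nonneg _ hl.ne', Int.emod_lt_of_pos _ hl⟩, ?_⟩
    rw [D.it_emod (by simpa), it_it, sub_add_cancel]; exact hk.2
  · intro k hk
    simp only [Finset.coe_filter, Finset.mem_Ico, Set.mem_ofPred_eq] at hk ⊢
    rw [Int.emod_sub_emod, add_sub_cancel_right, Int.emod_eq_of_lt hk.1.1 hk.1.2]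
  · intro k hk
    simp only [Finset.coe_filter, Finset.mem_Ico, Set.mem_ofPred_eq] at hk ⊢
    rw [Int.emod_add_emod, sub_add_cancel, Int.emod_eq_of_lt hk.1.1 hk.1.2]

lemma le_cnt {P : ι → Prop} [DecidablePred P] {d : ι} (s : Finset ℤ)
    (hs : ∀ k ∈ s, 0 ≤ k ∧ k < D.len ∧ P (D.it k d)) : s.card ≤ D.cnt P d :=
  Finset.card_le_card (fun k hk => by
    obtain ⟨h1, h2, h3⟩ := hs k hk
    simp [h1, h2, h3])

lemma cnt_zero {P : ι → Prop} [DecidablePred P] {d : ι} (h : D.kd d = none)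
    (h0 : D.cnt P d = 0) (k : ℤ) : ¬ P (D.it k d) := by
  intro hP
  have := D.le_cnt (P := P) (d := d) {k % D.len} (by
    intro l hl
    rw [Finset.mem_singleton.1 hl, D.it_emod h]
    exact ⟨Int.emod_nonneg _ D.len_pos.ne', Int.emod_lt_of_pos _ D.len_pos, hP⟩)
  simp [h0] at this

/-- A relator dart followed by a break and glued to a special face. -/
def PA (d : ι) : Prop := D.br d ∧ D.kd (D.α d) ≠ none

/-- A relator dart followed by a break and glued to a relator face. -/
def PI (d : ι) : Prop := D.br d ∧ D.kd (D.α d) = none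

instance : DecidablePred D.PA := fun d => by unfold PA; infer_instance
instance : DecidablePred D.PI := fun d => by unfold PI; infer_instance

lemma persist {d : ι} {i j : ℤ} (h : ∀ k, i ≤ k → k < j → ¬ D.PA (D.it k d))
    (hk : D.kd (D.α (D.it i d)) ≠ none) :
    ∀ k, i ≤ k → k < j → ¬ D.br (D.it k d) := by
  by_contra! hc
  obtain ⟨k, h1, h2, h3⟩ := hc
  obtain ⟨l, ⟨hl, hl1, hl2⟩, hmin⟩ := Int.exists_least_of_bdd
    (P := fun k => D.br (D.it k d) ∧ i ≤ k ∧ k < j)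
    ⟨i, fun z hz => hz.2.1⟩ ⟨k, h3, h1, h2⟩
  refine h l hl1 hl2 ⟨hl, ?_⟩
  rw [D.kd_run hl1 (fun t ht1 ht2 hb => ?_)]
  · exact hk
  · have := hmin t ⟨hb, ht1, by omega⟩
    omega

lemma exists_tail {d : ι} {s : Bool} (h : D.kd d = none)
    (hs : D.kd (D.α (D.it (D.len - 1) d)) = some s) :
    ∃ K, 0 < K ∧ K < D.len ∧ D.br (D.it (K - 1) d) ∧ D.Tail d K s := by
  have hl := D.len_pos
  obtain ⟨K, ⟨h1, h2, h3⟩, hmin⟩ := Int.exists_least_of_bdd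
    (P := fun K => 0 ≤ K ∧ K < D.len ∧ ∀ k, K ≤ k → k < D.len - 1 → ¬ D.br (D.it k d))
    ⟨0, fun z hz => hz.1⟩ ⟨D.len - 1, by omega, by omega, fun k _ _ => by omega⟩
  have hT : D.Tail d K s :=
    ⟨h, h1, h2, by rw [← D.kd_run (by omega) h3, hs], h3⟩
  obtain ⟨⟨z, hz0, hzK, -⟩, -⟩ := hT.near
  refine ⟨K, by omega, h2, ?_, hT⟩
  by_contra hb
  have := hmin (K - 1) ⟨by omega, by omega, fun k hk1 hk2 => by
    rcases eq_or_lt_of_le hk1 with rfl | hlt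
    · exact hb
    · exact h3 k (by omega) hk2⟩
  omega

lemma exists_break {d : ι} (h : D.kd d = none) {i j : ℤ} (hij : i ≤ j)
    (hI : ∀ k, i ≤ k → k < j → D.kd (D.α (D.it k d)) = none)
    (hlt : i < j)
    (hm : (D.zero d i ∧ D.top d j) ∨ (D.top d i ∧ D.zero d j)) :
    ∃ k, i ≤ k ∧ k < j ∧ D.PI (D.it k d) := by
  by_contra! hc
  have := D.no_zero_top_rr h hij (fun k h1 h2 hb => hc k h1 h2 ⟨hb, hI k h1 h2⟩)
    (hI i le_rfl hlt)
  tauto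

lemma not_zero_top {d : ι} {k : ℤ} (h1 : D.zero d k) (h2 : D.top d k) : False := by
  unfold zero at h1; unfold top at h2; linarith [D.hp]

/-- Positions before the tail on a relator face with a single break towards the special faces. -/
lemma before_tail {d : ι} {K : ℤ} {s : Bool} (h : D.Tail d K s) (hK : 0 < K)
    (hbr : D.br (D.it (K - 1) d)) (hA : ∀ k, 0 ≤ k → k < D.len - 1 → ¬ D.PA (D.it k d)) :
    ∀ k, 0 ≤ k → k < K → D.kd (D.α (D.it k d)) = none := by
  have h2 := h.2.2.1
  have hK1 : D.kd (D.α (D.it (K - 1) d)) = none := by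
    by_contra hc
    exact hA (K - 1) (by omega) (by omega) ⟨hbr, hc⟩
  intro k h0 hk
  by_contra hc
  have := D.persist (i := k) (j := K - 1) (fun l h1 h2 => hA l (by omega) (by omega)) hc
  rw [D.kd_run (show k ≤ K - 1 by omega) this] at hK1
  exact hc hK1

lemma cnt_I_of_cnt_A_zero {d : ι} (h : D.kd d = none) (hA : D.cnt D.PA d = 0) :
    5 ≤ D.cnt D.PI d := by
  have hA' := D.cnt_zero h hA
  have hT : ∀ k, D.kd (D.α (D.it k d)) = none := by
    intro k
    by_contra hc
    obtain ⟨s, hs⟩ := Option.ne_none_iff_exists'.1 hc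
    have hb := fun j => D.persist (d := d) (i := k) (j := j)
    have : D.Tail (D.it k d) 0 s := by
      refine ⟨by simpa, le_rfl, D.len_pos, by simpa, fun l h1 h2 => ?_⟩
      rw [it_it]
      exact hb (l + k + 1) (fun m _ _ => hA' m) hc _ (by omega) (by omega)
    obtain ⟨⟨z, hz0, hzK, -⟩, -⟩ := this.near
    omega
  obtain ⟨z, hz0, hzp, hz⟩ := D.exists_zero h 0
  have hμ0 := D.hμ0
  have hμp := D.hμp
  have hl := D.len_ge
  have hz' : ∀ m, D.zero d (z + m * D.p) := fun m => D.zero_of_zero h hz ⟨m, by ring⟩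
  have ht' : ∀ m, D.top d (z + D.μ + m * D.p) := fun m => D.top_of_zero h hz ⟨m, by ring⟩
  have hz1 := hz' 1
  have hz2 := hz' 2
  have ht0 := ht' 0
  have ht1 := ht' 1
  have ht2 := ht' 2
  obtain ⟨k1, a1, b1, c1⟩ := D.exists_break h (by omega) (fun k _ _ => hT k) (by omega)
    (Or.inl ⟨hz, ht0⟩)
  obtain ⟨k2, a2, b2, c2⟩ := D.exists_break h (by omega) (fun k _ _ => hT k) (by omega)
    (Or.inr ⟨ht0, hz1⟩)
  obtain ⟨k3, a3, b3, c3⟩ := D.exists_break h (by omega) (fun k _ _ => hT k) (by omega)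
    (Or.inl ⟨hz1, ht1⟩)
  obtain ⟨k4, a4, b4, c4⟩ := D.exists_break h (by omega) (fun k _ _ => hT k) (by omega)
    (Or.inr ⟨ht1, hz2⟩)
  obtain ⟨k5, a5, b5, c5⟩ := D.exists_break h (by omega) (fun k _ _ => hT k) (by omega)
    (Or.inl ⟨hz2, ht2⟩)
  refine le_trans (le_of_eq ?_) (D.le_cnt {k1, k2, k3, k4, k5} ?_)
  · symm; rw [Finset.card_eq_succ]
    refine ⟨k1, {k2, k3, k4, k5}, by simp; omega, rfl, ?_⟩
    rw [Finset.card_eq_succ]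
    refine ⟨k2, {k3, k4, k5}, by simp; omega, rfl, ?_⟩
    rw [Finset.card_eq_three]
    exact ⟨k3, k4, k5, by omega, by omega, by omega, rfl⟩
  · intro k hk
    simp only [Finset.mem_insert, Finset.mem_singleton] at hk
    rcases hk with rfl | rfl | rfl | rfl | rfl <;>
    exact ⟨by omega, by omega, by assumption⟩

/-- Rotate a relator face so that a given break closes up the window. -/
lemma exists_rotate {P : ι → Prop} [DecidablePred P] {d : ι} (h : D.kd d = none)
    (hP : 0 < D.cnt P d) : ∃ j, P (D.it (D.len - 1) (D.it j d)) := by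
  obtain ⟨k, hk⟩ := Finset.card_pos.1 hP
  refine ⟨k + 1, ?_⟩
  rw [it_it, show D.len - 1 + (k + 1) = k + D.len by ring, D.it_add_len h]
  exact (Finset.mem_filter.1 hk).2

lemma cnt_one_unique {P : ι → Prop} [DecidablePred P] {d : ι} (h1 : D.cnt P d = 1)
    (hP : P (D.it (D.len - 1) d)) : ∀ k, 0 ≤ k → k < D.len - 1 → ¬ P (D.it k d) := by
  intro k h0 hk hc
  have := D.le_cnt (P := P) (d := d) {k, D.len - 1} (by
    intro l hl
    simp only [Finset.mem_insert, Finset.mem_singleton] at hl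
    rcases hl with rfl | rfl
    · exact ⟨h0, by omega, hc⟩
    · exact ⟨by omega, by omega, hP⟩)
  rw [Finset.card_pair (by omega)] at this
  omega

lemma cnt_I_of_cnt_A_one {d : ι} (h : D.kd d = none) (hA : D.cnt D.PA d = 1) :
    2 ≤ D.cnt D.PI d := by
  obtain ⟨j, hj⟩ := D.exists_rotate h (P := D.PA) (by omega)
  rw [← D.cnt_it _ h j] at hA ⊢
  have hd : D.kd (D.it j d) = none := by simpa
  generalize D.it j d = e at *
  have hA' := D.cnt_one_unique hA hj
  obtain ⟨s, hs⟩ := Option.ne_none_iff_exists'.1 hj.2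
  obtain ⟨K, hK0, hKl, hbr, hT⟩ := D.exists_tail hd hs
  have hI := D.before_tail hT hK0 hbr hA'
  obtain ⟨⟨z, hz0, hzK, -, hz⟩, ⟨y, hy0, hyK, -, hy⟩, -⟩ := hT.near
  obtain ⟨k, hk0, hk1, hk⟩ : ∃ k, 0 ≤ k ∧ k < K - 1 ∧ D.PI (D.it k e) := by
    rcases lt_trichotomy z y with hlt | rfl | hlt
    · obtain ⟨k, a, b, c⟩ := D.exists_break hd hlt.le (fun k _ _ => hI k (by omega) (by omega)) hlt
        (Or.inl ⟨hz, hy⟩)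
      exact ⟨k, by omega, by omega, c⟩
    · exact (D.not_zero_top hz hy).elim
    · obtain ⟨k, a, b, c⟩ := D.exists_break hd hlt.le (fun k _ _ => hI k (by omega) (by omega)) hlt
        (Or.inr ⟨hy, hz⟩)
      exact ⟨k, by omega, by omega, c⟩
  have := D.le_cnt (P := D.PI) (d := e) {k, K - 1} (by
    intro l hl
    simp only [Finset.mem_insert, Finset.mem_singleton] at hl
    rcases hl with rfl | rfl
    · exact ⟨by omega, by omega, hk⟩
    · exact ⟨by omega, by omega, hbr, hI _ (by omega) (by omega)⟩)
  rwa [Finset.card_pair (by omega)] at this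

lemma four_le_cnt {d : ι} (h : D.kd d = none) : 4 ≤ 2 * D.cnt D.PA d + D.cnt D.PI d := by
  have h0 := D.cnt_I_of_cnt_A_zero h
  have h1 := D.cnt_I_of_cnt_A_one h
  omega

lemma cnt_cases {d : ι} (h : D.kd d = none) (h4 : 2 * D.cnt D.PA d + D.cnt D.PI d = 4) :
    (D.cnt D.PA d = 2 ∧ D.cnt D.PI d = 0) ∨ (D.cnt D.PA d = 1 ∧ D.cnt D.PI d = 2) := by
  have h0 := D.cnt_I_of_cnt_A_zero h
  omega

lemma it_mem {Z : Finset ι} (hZ : ∀ d ∈ Z, D.φ d ∈ Z) (k : ℤ) : ∀ d ∈ Z, D.it k d ∈ Z := by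
  have himg : Z.image D.φ = Z := Finset.eq_of_subset_of_card_le
    (fun d hd => by
      obtain ⟨e, he, rfl⟩ := Finset.mem_image.1 hd
      exact hZ e he) (by rw [Finset.card_image_of_injective _ D.φ.injective])
  induction k using Int.induction_on with
  | zero => simp
  | succ k ih => intro d hd; rw [it_succ]; exact hZ _ (ih d hd)
  | pred k ih =>
    intro d hd
    have := ih d hd
    rw [← himg] at this
    obtain ⟨e, he, hee⟩ := Finset.mem_image.1 this
    rw [← D.φinv_it, ← hee]; simpa

lemma sum_cnt (P : ι → Prop) [DecidablePred P] {Z : Finset ι} (hZ : ∀ d ∈ Z, D.φ d ∈ Z) :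
    ((∑ d ∈ Z.filter (fun d => D.kd d = none), D.cnt P d : ℕ) : ℤ) =
      D.len * (Z.filter (fun d => D.kd d = none ∧ P d)).card := by
  have key : ∀ k : ℤ, (Z.filter (fun d => D.kd d = none ∧ P (D.it k d))).card
      = (Z.filter (fun d => D.kd d = none ∧ P d)).card := by
    intro k
    refine Finset.card_nbij' (D.it k) (D.it (-k)) ?_ ?_ ?_ ?_
    · intro d hd
      simp only [Finset.coe_filter, Set.mem_ofPred_eq] at hd ⊢
      exact ⟨D.it_mem hZ k d hd.1, by simpa using hd.2.1, hd.2.2⟩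
    · intro d hd
      simp only [Finset.coe_filter, Set.mem_ofPred_eq] at hd ⊢
      exact ⟨D.it_mem hZ _ d hd.1, by simpa using hd.2.1, by simpa [it_it] using hd.2.2⟩
    · intro d _; simp [it_it]
    · intro d _; simp [it_it]
  have h1 : ∑ d ∈ Z.filter (fun d => D.kd d = none), D.cnt P d =
      ∑ k ∈ Finset.Ico 0 D.len, (Z.filter (fun d => D.kd d = none ∧ P (D.it k d))).card := by
    simp only [cnt, Finset.card_eq_sum_ones, Finset.sum_filter]
    rw [← Finset.sum_filter, Finset.sum_comm]
    refine Finset.sum_congr rfl fun k _ => ?_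
    rw [Finset.sum_filter]
    refine Finset.sum_congr rfl fun d _ => ?_
    by_cases h1 : D.kd d = none <;> by_cases h2 : P (D.it k d) <;> simp [h1, h2]
  rw [h1, Finset.sum_congr rfl (fun k _ => key k)]
  simp [D.len_pos.le]

/-- Consequences of the Euler inequality for a closed set of darts. -/
lemma closed_set {Z : Finset ι} (hne : Z.Nonempty) (hφ : ∀ d ∈ Z, D.φ d ∈ Z)
    (hα : ∀ d ∈ Z, D.α d ∈ Z) :
    (∀ i, ∃ d ∈ Z, D.kd d = some i) ∧
    (∀ d ∈ Z, D.br d → D.α (D.φ⁻¹ (D.α (D.φ⁻¹ (D.α (D.φ⁻¹ (D.α d)))))) = D.φ d) ∧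
    (∀ d ∈ Z, D.kd d ≠ none → D.br d → D.kd (D.α (D.φ d)) = none) ∧
    (∀ d ∈ Z, D.kd d = none → 2 * D.cnt D.PA d + D.cnt D.PI d = 4) := by
  have hl := D.len_pos
  have hE := D.euler Z hne hφ hα
  rw [show 2 * D.n * D.p = D.len from rfl] at hE
  set R := Z.filter (fun d => D.kd d = none) with hR
  have sA := D.sum_cnt D.PA hφ
  have sI := D.sum_cnt D.PI hφ
  have hle : ∀ d ∈ R, 4 ≤ 2 * D.cnt D.PA d + D.cnt D.PI d := fun d hd =>
    D.four_le_cnt (Finset.mem_filter.1 hd).2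
  have hsum := Finset.sum_le_sum hle
  rw [Finset.sum_add_distrib, ← Finset.mul_sum] at hsum
  simp only [Finset.sum_const, smul_eq_mul] at hsum
  set A := Z.filter (fun d => D.kd d = none ∧ D.PA d) with hAdef
  set I := Z.filter (fun d => D.kd d = none ∧ D.PI d) with hIdef
  set B := Z.filter (fun d => D.kd d ≠ none ∧ D.br d) with hBdef
  have hmap : ∀ d ∈ A, D.φ⁻¹ (D.α d) ∈ B := by
    intro d hd
    simp only [hAdef, hBdef, Finset.mem_filter] at hd ⊢
    obtain ⟨h1, h2, h3, h4⟩ := hd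
    rw [φinv_eq]
    refine ⟨D.it_mem hφ _ _ (hα d h1), by simpa, ?_⟩
    rw [← D.br_α, D.α_α]; exact h3
  have hinj : Set.InjOn (fun d => D.φ⁻¹ (D.α d)) A := by
    intro d _ e _ h
    simpa using h
  have hAB : A.card ≤ B.card := Finset.card_le_card_of_injOn _ hmap hinj
  have hbr : (Z.filter (fun d => D.φ (D.α (D.φ d)) ≠ D.α d)).card = A.card + I.card + B.card := by
    rw [← Finset.card_union_of_disjoint, ← Finset.card_union_of_disjoint]
    · congr 1
      ext d
      simp only [hAdef, hIdef, hBdef, Finset.mem_union, Finset.mem_filter]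
      simp only [PA, PI, br]
      tauto
    · rw [Finset.disjoint_left]; intro d hd
      simp only [hAdef, hIdef, hBdef, Finset.mem_union, Finset.mem_filter] at hd ⊢; tauto
    · rw [Finset.disjoint_left]; intro d hd
      simp only [hAdef, hIdef, Finset.mem_filter] at hd ⊢
      simp only [PA, PI] at hd ⊢; tauto
  rw [hbr] at hE
  have hsum' : (4 * (R.card : ℤ)) ≤ D.len * (2 * A.card + I.card) := by
    zify at sA sI hsum ⊢; rw [mul_add, ← sI, mul_left_comm, ← sA]; linarith
  set i1 : ℤ := if ∃ d ∈ Z, D.kd d = some false then 4 else 0 with hi1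
  set i2 : ℤ := if ∃ d ∈ Z, D.kd d = some true then 4 else 0 with hi2
  set i3 : ℤ := if ∃ d ∈ Z, D.φ (D.α (D.φ d)) ≠ D.α d ∧
        D.α (D.φ⁻¹ (D.α (D.φ⁻¹ (D.α (D.φ⁻¹ (D.α d)))))) ≠ D.φ d then 1 else 0 with hi3
  have hi1' : i1 ≤ 4 := by rw [hi1]; split_ifs <;> norm_num
  have hi2' : i2 ≤ 4 := by rw [hi2]; split_ifs <;> norm_num
  have hi3' : 0 ≤ i3 := by rw [hi3]; split_ifs <;> norm_num
  have hfin := le_of_mul_le_mul_left (hE.trans hsum') hl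
  push_cast at hfin
  have e1 : i1 = 4 := by omega
  have e2 : i2 = 4 := by omega
  have e3 : i3 = 0 := by omega
  have e4 : A.card = B.card := by omega
  refine ⟨?_, ?_, ?_, ?_⟩
  · rintro (_ | _)
    · by_contra hc; rw [hi1, if_neg hc] at e1; norm_num at e1
    · by_contra hc; rw [hi2, if_neg hc] at e2; norm_num at e2
  · intro d hd hb
    by_contra hc
    rw [hi3, if_pos ⟨d, hd, hb, hc⟩] at e3; norm_num at e3
  · intro d hd hk hb
    obtain ⟨a, ha, rfl⟩ := Finset.surj_on_of_inj_on_of_card_le (fun d _ => D.φ⁻¹ (D.α d)) hmap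
      (fun d e hd he h => hinj hd he h) e4.ge d (by simp [hBdef, hd, hk, hb])
    rw [Equiv.Perm.inv_def, Equiv.apply_symm_apply, D.α_α]
    exact (Finset.mem_filter.1 ha).2.1
  · intro d hd hk
    have hEq : (∑ d ∈ R, 4) = ∑ d ∈ R, (2 * D.cnt D.PA d + D.cnt D.PI d) := by
      rw [Finset.sum_add_distrib, ← Finset.mul_sum]
      refine le_antisymm (by simpa using hsum) ?_
      simp only [Finset.sum_const, smul_eq_mul]
      zify at sA sI ⊢
      rw [sA, sI]
      rw [e1, e2, e3] at hE
      have : (A.card : ℤ) = B.card := by exact_mod_cast e4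
      push_cast at hE
      rw [← this] at hE
      linarith
    exact ((Finset.sum_eq_sum_iff_of_le hle).1 hEq d (by simp [hR, hd, hk])).symm

/-- A function on a finite type cannot drift along a sequence. -/
lemma no_drift {κ : Type} [Finite κ] (G : κ → ℤ) (f : ℕ → κ) (δ : ℤ)
    (h : ∀ k, G (f (k + 1)) = G (f k) + δ) : δ = 0 := by
  by_contra hδ
  have h1 : ∀ k : ℕ, G (f k) = G (f 0) + k * δ := by
    intro k
    induction k with
    | zero => simp
    | succ k ih => rw [h, ih]; push_cast; ring
  have : Function.Injective f := by
    intro a b hab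
    have h2 := h1 a
    rw [hab, h1 b] at h2
    have : ((b : ℤ) - a) * δ = 0 := by linear_combination h2
    rcases mul_eq_zero.1 this with h3 | h3
    · omega
    · exact absurd h3 hδ
  exact not_injective_infinite_finite f this

lemma exists_special (i : Bool) : ∃ d, D.kd d = some i := by
  have h1 := D.card_s i
  have h2 := D.hps i
  have : (Finset.univ.filter (fun d => D.kd d = some i)).Nonempty := by
    rw [← Finset.card_pos]; omega
  obtain ⟨d, hd⟩ := this
  exact ⟨d, (Finset.mem_filter.1 hd).2⟩

lemma univ_nonempty (D : Diagram ι) : (Finset.univ : Finset ι).Nonempty := by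
  obtain ⟨d, -⟩ := D.exists_special true
  exact ⟨d, Finset.mem_univ d⟩

lemma quad {d : ι} (h : D.br d) :
    D.α (D.φ⁻¹ (D.α (D.φ⁻¹ (D.α (D.φ⁻¹ (D.α d)))))) = D.φ d :=
  (D.closed_set D.univ_nonempty (by simp) (by simp)).2.1 d (Finset.mem_univ d) h

lemma mate_of_special_br {d : ι} (h : D.kd d ≠ none) (hb : D.br d) : D.kd (D.α (D.φ d)) = none :=
  (D.closed_set D.univ_nonempty (by simp) (by simp)).2.2.1 d (Finset.mem_univ d) h hb

lemma cnt_eq_four {d : ι} (h : D.kd d = none) : 2 * D.cnt D.PA d + D.cnt D.PI d = 4 :=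
  (D.closed_set D.univ_nonempty (by simp) (by simp)).2.2.2 d (Finset.mem_univ d) h

/-- The darts of the special faces are glued to relator faces. -/
lemma special_mate {d : ι} {i : Bool} (h : D.kd d = some i) : D.kd (D.α d) = none := by
  by_contra hc
  obtain ⟨j, hj⟩ := Option.ne_none_iff_exists'.1 hc
  have hk : ∀ k : ℕ, D.kd (D.α (D.it (-k) d)) = some j ∧ ¬ D.br (D.it (-k - 1) d) := by
    have hbr : ∀ k : ℤ, D.kd (D.α (D.it k d)) = some j → ¬ D.br (D.it (k - 1) d) := by
      intro k hk hb
      have := D.mate_of_special_br (by simp [h]) hb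
      rw [φ_it, sub_add_cancel, hk] at this
      cases this
    intro k
    induction k with
    | zero => simpa [hj] using hbr 0 (by simpa using hj)
    | succ k ih =>
      have h1 : D.kd (D.α (D.it (-k - 1) d)) = some j := by
        have := D.α_succ ih.2
        rw [it_it] at this
        rw [← ih.1, show (-k : ℤ) = 1 + (-k - 1) by ring, this]; simp
      have h2 := hbr _ h1
      push_cast
      rw [neg_add]
      exact ⟨h1, h2⟩
  rcases eq_or_ne i j with rfl | hij
  · obtain ⟨e, he, hek⟩ := (D.closed_set (Z := Finset.univ.filter (fun d => D.kd d = some i))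
      ⟨d, by simp [h]⟩ (by simp [D.kd_φ]) (by
        intro e he
        rw [Finset.mem_filter] at he ⊢
        refine ⟨Finset.mem_univ _, ?_⟩
        obtain ⟨k, hk'⟩ := D.trans_s e d i he.2 h
        have : e = D.it (-k) d := by
          rw [← hk']; simp [it]
        rw [this]; exact (hk k).1)).1 (!i)
    rw [Finset.mem_filter, hek] at he
    simp at he
  · have := no_drift (fun e => D.ps j * D.x e + D.ps i * D.x (D.α e)) (fun k => D.it (-k) d)
      (D.ps i * D.qs j - D.ps j * D.qs i) (by
        intro k
        obtain ⟨h1, h2⟩ := hk k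
        have h3 := (hk (k + 1)).1
        push_cast at h3 ⊢
        rw [neg_add, ← sub_eq_add_neg] at h3 ⊢
        have e1 := D.x_s' (d := D.it (-k - 1) d) (i := i) (by simpa)
        have e2 := D.x_s_pred h3
        have e3 := D.c_succ h2
        have e4 := D.α_succ h2
        rw [it_it, show (1 : ℤ) + (-k - 1) = -k by ring] at e1 e3 e4
        rw [← e4, e3] at e2
        rw [e1, e2]; ring)
    have hs := D.slopes
    revert this hs hij
    cases i <;> cases j <;> intro hij this hs
    · exact hij rfl
    · exact hs (by linear_combination this)
    · exact hs (by linear_combination -this)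
    · exact hij rfl

/-- The corner at `e` is a branch point. -/
def dg (e : ι) : Prop := D.br (D.it (-1) e)

lemma dg_iff (e : ι) : D.dg e ↔ D.br (D.α e) := (D.br_α e).symm

/-- Reading of the mate of a dart on a special face. -/
def v (e : ι) : ℤ := D.p - 1 - D.x (D.α e)

/-- The jump at a corner. -/
def jump (e : ι) : ℤ := D.v e - D.v (D.it (-1) e) - D.q + D.p * D.c e

/-- The potential along a special face. -/
def pot (s : Bool) (e : ι) : ℤ := D.ps s * D.v e - D.p * D.x e

lemma jump_zero {e : ι} (h : ¬ D.dg e) (hr : D.kd (D.α e) = none) : D.jump e = 0 := by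
  have h1 := D.α_succ h
  have h2 := D.c_succ h
  rw [it_it] at h1 h2
  simp only [add_neg_cancel, it_zero] at h1 h2
  have h3 : D.kd (D.α (D.it (-1) e)) = none := by rw [h1] at hr; simpa using hr
  have h4 := D.x_r_pred h3
  unfold jump v
  rw [h1, h4, h2]; ring

lemma pot_succ {e : ι} {s : Bool} (h : D.kd e = some s) :
    D.pot s e = D.pot s (D.it (-1) e) - D.b s + D.ps s * D.jump e := by
  have := D.x_s_pred h
  unfold pot jump b
  rw [this]; ring

lemma pot_run {e : ι} {s : Bool} (h : D.kd e = some s) {i j : ℤ} (hij : i ≤ j)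
    (hd : ∀ k, i < k → k ≤ j → ¬ D.dg (D.it k e)) :
    D.pot s (D.it j e) = D.pot s (D.it i e) - (j - i) * D.b s := by
  obtain ⟨k, rfl⟩ : ∃ k : ℕ, j = i + k := ⟨(j - i).toNat, by omega⟩
  clear hij
  induction k with
  | zero => simp
  | succ k ih =>
    have h1 := D.pot_succ (e := D.it (i + (k + 1 : ℕ)) e) (s := s) (by simpa)
    rw [D.jump_zero (hd _ (by push_cast; omega) le_rfl) (D.special_mate (i := s) (by simpa)), it_it,
      show (-1 : ℤ) + (i + (k + 1 : ℕ)) = i + k by push_cast; ring,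
      ih (fun l h1 h2 => hd l h1 (by push_cast; omega))] at h1
    rw [h1]; push_cast; ring

lemma pot_cross {e : ι} {s : Bool} (h : D.kd e = some s) {i j : ℤ} (hi : i < 0) (hj : 0 ≤ j)
    (hd : ∀ k, i < k → k ≤ j → k ≠ 0 → ¬ D.dg (D.it k e)) :
    D.pot s (D.it j e) = D.pot s (D.it i e) - (j - i) * D.b s + D.ps s * D.jump e := by
  have h1 := D.pot_run h (i := i) (j := -1) (by omega)
    (fun k h1 h2 => hd k h1 (by omega) (by omega))
  have h2 := D.pot_run h (i := 0) (j := j) hj (fun k h1 h2 => hd k (by omega) h2 (by omega))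
  have h3 := D.pot_succ h
  rw [it_zero] at h2
  rw [h2, h3, h1]; ring

lemma pot_le {e : ι} {s : Bool} (h : D.kd e = some s) (hv : D.v e = 0) :
    D.p - D.p * D.ps s ≤ D.pot s e ∧ D.pot s e ≤ 0 := by
  have h1 := D.x_nonneg e
  have h2 := D.x_lt_s e s h
  have hp := D.hp
  unfold pot; rw [hv]
  constructor <;> nlinarith

lemma pot_ge {e : ι} {s : Bool} (h : D.kd e = some s) (hv : D.v e = D.p - 1) :
    D.p - D.ps s ≤ D.pot s e ∧ D.pot s e ≤ D.ps s * (D.p - 1) := by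
  have h1 := D.x_nonneg e
  have h2 := D.x_lt_s e s h
  have hp := D.hp
  unfold pot; rw [hv]
  constructor <;> nlinarith

lemma cross_zero_top {e : ι} {s : Bool} (h : D.kd e = some s) {i j : ℤ} (hi : i < 0) (hj : 0 ≤ j)
    (hd : ∀ k, i < k → k ≤ j → k ≠ 0 → ¬ D.dg (D.it k e))
    (h0 : D.v (D.it i e) = 0) (h1 : D.v (D.it j e) = D.p - 1) :
    (j - i) * D.b s ≤ D.ps s * (D.jump e + 1) - D.p := by
  have := D.pot_cross h hi hj hd
  have a := D.pot_le (s := s) (by simpa) h0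
  have b := D.pot_ge (s := s) (by simpa) h1
  linarith

lemma cross_top_zero {e : ι} {s : Bool} (h : D.kd e = some s) {i j : ℤ} (hi : i < 0) (hj : 0 ≤ j)
    (hd : ∀ k, i < k → k ≤ j → k ≠ 0 → ¬ D.dg (D.it k e))
    (h0 : D.v (D.it i e) = D.p - 1) (h1 : D.v (D.it j e) = 0) :
    D.ps s * (D.jump e - 1) + D.p ≤ (j - i) * D.b s := by
  have := D.pot_cross h hi hj hd
  have a := D.pot_le (s := s) (by simpa) h1
  have b := D.pot_ge (s := s) (by simpa) h0
  linarith

/-- The stretch of the special face `s` starting at `e`, glued to the tail of the relator face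
read from `d`. -/
structure Arc (d e : ι) (K : ℤ) (s : Bool) : Prop where
  tail : D.Tail d K s
  pos : 0 < K
  br_start : D.br (D.it (K - 1) d)
  br_end : D.br (D.it (D.len - 1) d)
  mate : e = D.α (D.it (D.len - 1) d)

variable {D}

lemma Arc.kd_r {d e : ι} {K : ℤ} {s : Bool} (h : D.Arc d e K s) : D.kd d = none := h.tail.1

lemma Arc.K_lt {d e : ι} {K : ℤ} {s : Bool} (h : D.Arc d e K s) : K < D.len := h.tail.2.2.1

lemma Arc.run {d e : ι} {K : ℤ} {s : Bool} (h : D.Arc d e K s) {t : ℤ} (h0 : 0 ≤ t)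
    (ht : t < D.len - K) : D.it t e = D.α (D.it (D.len - 1 - t) d) := by
  have hl := h.K_lt
  have := D.α_run' (d := d) (i := D.len - 1 - t) (j := D.len - 1) (by omega)
    (fun k h1 h2 => h.tail.2.2.2.2 k (by omega) h2)
  rw [h.mate, this, it_it]
  rw [show t + (D.len - 1 - t - (D.len - 1)) = 0 by ring, it_zero]

lemma Arc.kd_s {d e : ι} {K : ℤ} {s : Bool} (h : D.Arc d e K s) : D.kd e = some s := by
  have hl := h.K_lt
  rw [h.mate, D.kd_run (i := K) (by omega) (fun k h1 h2 => h.tail.2.2.2.2 k (by omega) h2)]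
  exact h.tail.2.2.2.1

lemma Arc.not_dg {d e : ι} {K : ℤ} {s : Bool} (h : D.Arc d e K s) {t : ℤ} (h0 : 0 < t)
    (ht : t < D.len - K) : ¬ D.dg (D.it t e) := by
  rw [dg_iff, h.run h0.le ht, α_α']
  exact h.tail.2.2.2.2 _ (by omega) (by omega)

lemma Arc.dg_start {d e : ι} {K : ℤ} {s : Bool} (h : D.Arc d e K s) : D.dg e := by
  rw [dg_iff, h.mate, α_α']; exact h.br_end

lemma Arc.dg_end {d e : ι} {K : ℤ} {s : Bool} (h : D.Arc d e K s) :
    D.dg (D.it (D.len - K) e) := by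
  have hl := h.K_lt
  have h1 := h.run (t := D.len - K - 1) (by omega) (by omega)
  rw [dg, it_it, show -1 + (D.len - K) = D.len - K - 1 by ring, h1,
    show D.len - 1 - (D.len - K - 1) = K by ring, br_α, it_it, neg_add_eq_sub]
  exact h.br_start

lemma Arc.v_top {d e : ι} {K : ℤ} {s : Bool} (h : D.Arc d e K s) {t : ℤ} (h0 : 0 ≤ t)
    (ht : t < D.len - K) : D.v (D.it t e) = D.p - 1 ↔ D.zero d (D.len - 1 - t) := by
  rw [v, h.run h0 ht, α_α']; unfold zero
  constructor <;> intro h <;> linarith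

lemma Arc.v_zero {d e : ι} {K : ℤ} {s : Bool} (h : D.Arc d e K s) {t : ℤ} (h0 : 0 ≤ t)
    (ht : t < D.len - K) : D.v (D.it t e) = 0 ↔ D.top d (D.len - 1 - t) := by
  rw [v, h.run h0 ht, α_α']; unfold top
  constructor <;> intro h <;> linarith

variable (D)

lemma exists_arc {e : ι} {s : Bool} (h : D.kd e = some s) (hd : D.dg e) :
    ∃ K, D.Arc (D.it 1 (D.α e)) e K s := by
  have hr := D.special_mate h
  have hr' : D.kd (D.it 1 (D.α e)) = none := by simpa
  have h1 : D.it (D.len - 1) (D.it 1 (D.α e)) = D.α e := by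
    rw [it_it, sub_add_cancel, D.it_len hr]
  obtain ⟨K, h2, -, h4, h5⟩ := D.exists_tail (s := s) hr' (by rw [h1, α_α', h])
  exact ⟨K, h5, h2, h4, by rw [h1, ← dg_iff]; exact hd, by rw [h1, α_α']⟩

lemma exists_prev_arc {e : ι} {s : Bool} (h : D.kd e = some s) (hd : D.dg e) :
    ∃ d' e' K, D.Arc d' e' K s ∧ D.it (D.len - K) e' = e := by
  obtain ⟨l, ⟨hl0, hl⟩, hmin⟩ := Int.exists_least_of_bdd
    (P := fun l => 0 < l ∧ D.dg (D.it (-l) e)) ⟨0, fun z hz => hz.1.le⟩ (by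
      refine ⟨orderOf D.φ, by exact_mod_cast orderOf_pos D.φ, ?_⟩
      simpa [it, pow_orderOf_eq_one] using hd)
  obtain ⟨K, hK⟩ := D.exists_arc (e := D.it (-l) e) (s := s) (by simpa) hl
  refine ⟨_, _, K, hK, ?_⟩
  have hKl := hK.K_lt
  rw [it_it]
  rcases lt_trichotomy (D.len - K) l with hlt | heq | hgt
  · have h1 := hK.dg_end
    rw [it_it] at h1
    have := hmin (l - (D.len - K)) ⟨by omega, by rw [neg_sub]; exact h1⟩
    omega
  · rw [heq]; simp
  · have h1 := hK.not_dg (t := l) hl0 hgt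
    rw [it_it] at h1; simp at h1
    exact absurd hd h1

/-- The four darts around a branch point on a special face. -/
lemma vertex {e : ι} (h : D.dg e) :
    D.α (D.it (-1) (D.α (D.it (-1) (D.α (D.it (-1) e))))) = D.it 1 (D.α e) := by
  have h1 := D.quad h
  simp only [φinv_eq, φ_eq, it_it] at h1
  simp only [add_neg_cancel, it_zero] at h1
  have h2 := congrArg (fun t => D.it 1 (D.α t)) h1
  simp only [α_α', it_it, add_neg_cancel, it_zero] at h2
  exact h2

variable {D}

lemma Arc.prev_it {e d' e' : ι} {K' : ℤ} {s : Bool} (h' : D.Arc d' e' K' s)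
    (he : D.it (D.len - K') e' = e) {t : ℤ} (h0 : -(D.len - K') ≤ t) (ht : t < 0) :
    D.it t e = D.α (D.it (K' - 1 - t) d') := by
  have := h'.run (t := t + (D.len - K')) (by omega) (by omega)
  rw [← he, it_it, this]; congr 2; ring

lemma Arc.prev_v_top {e d' e' : ι} {K' : ℤ} {s : Bool} (h' : D.Arc d' e' K' s)
    (he : D.it (D.len - K') e' = e) {t : ℤ} (h0 : -(D.len - K') ≤ t) (ht : t < 0) :
    D.v (D.it t e) = D.p - 1 ↔ D.zero d' (K' - 1 - t) := by
  have := h'.v_top (t := t + (D.len - K')) (by omega) (by omega)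
  rw [← he, it_it, this]; ring_nf

lemma Arc.prev_v_zero {e d' e' : ι} {K' : ℤ} {s : Bool} (h' : D.Arc d' e' K' s)
    (he : D.it (D.len - K') e' = e) {t : ℤ} (h0 : -(D.len - K') ≤ t) (ht : t < 0) :
    D.v (D.it t e) = 0 ↔ D.top d' (K' - 1 - t) := by
  have := h'.v_zero (t := t + (D.len - K')) (by omega) (by omega)
  rw [← he, it_it, this]; ring_nf

lemma Arc.not_dg_cross {d e d' e' : ι} {K K' : ℤ} {s : Bool} (h : D.Arc d e K s)
    (h' : D.Arc d' e' K' s) (he : D.it (D.len - K') e' = e) {i j : ℤ} (hi : -(D.len - K') ≤ i)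
    (hj : j < D.len - K) : ∀ k, i < k → k ≤ j → k ≠ 0 → ¬ D.dg (D.it k e) := by
  intro k h1 h2 h3
  rcases lt_or_gt_of_ne h3 with h4 | h4
  · have := h'.not_dg (t := k + (D.len - K')) (by omega) (by omega)
    rwa [← it_it, he] at this
  · exact h.not_dg h4 (by omega)

variable (D)

lemma v_run {e : ι} {s : Bool} (h : D.kd e = some s) {i j : ℤ} (hij : i ≤ j)
    (hd : ∀ k, i < k → k ≤ j → ¬ D.dg (D.it k e)) :
    D.p ∣ D.v (D.it j e) - D.v (D.it i e) - (j - i) * D.q := by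
  obtain ⟨k, rfl⟩ : ∃ k : ℕ, j = i + k := ⟨(j - i).toNat, by omega⟩
  clear hij
  induction k with
  | zero => simp
  | succ k ih =>
    obtain ⟨m, hm⟩ := ih (fun l h1 h2 => hd l h1 (by push_cast; omega))
    have h1 := D.jump_zero (hd _ (by push_cast; omega) le_rfl) (D.special_mate (i := s) (by simpa))
    unfold jump at h1
    rw [it_it, show (-1 : ℤ) + (i + (k + 1 : ℕ)) = i + k by push_cast; ring] at h1
    exact ⟨m - D.c (D.it (i + (k + 1 : ℕ)) e), by push_cast at h1 ⊢; linear_combination hm + h1⟩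

lemma v_cross {e : ι} {s : Bool} (h : D.kd e = some s) {i j : ℤ} (hi : i < 0) (hj : 0 ≤ j)
    (hd : ∀ k, i < k → k ≤ j → k ≠ 0 → ¬ D.dg (D.it k e)) :
    D.p ∣ D.v (D.it j e) - D.v (D.it i e) - (j - i) * D.q - D.jump e := by
  obtain ⟨m, hm⟩ := D.v_run h (i := i) (j := -1) (by omega)
    (fun k h1 h2 => hd k h1 (by omega) (by omega))
  obtain ⟨l, hl⟩ := D.v_run h (i := 0) (j := j) hj
    (fun k h1 h2 => hd k (by omega) h2 (by omega))
  rw [it_zero] at hl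
  refine ⟨m + l - D.c e, ?_⟩
  unfold jump
  linear_combination hm + hl

lemma dvd_of_cross {T κ : ℤ} (h : D.p ∣ (D.p - 1) - 0 - T * D.q - κ) :
    D.p ∣ T - (κ + 1) * D.μ := by
  obtain ⟨m, hm⟩ := h
  obtain ⟨l, hl⟩ := D.hμq
  exact ⟨D.μ * m - D.μ + T * l, by linear_combination D.μ * hm + T * hl⟩

variable {D}

lemma jump_eq_one {p μ M P β κ T : ℤ} (hμ0 : 0 < μ) (hμp : μ < p) (hb : 0 < β) (hP : 0 < P)
    (hM2 : 2 * p ≤ M)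
    (hfar : P < (M + μ) * β) (c1 : (2 * M + T) * β ≤ P * (κ + 1) - p)
    (c2 : P * (κ - 1) + p ≤ (T + 2 * p - 2 * μ) * β) (c3 : p ∣ T - (κ + 1) * μ)
    (hT1 : 1 ≤ T) (hT2 : T ≤ 2 * μ - 1) :
    κ = 1 ∧ T = 2 * μ - p := by
  have c6 : (p + μ) * β < P := by nlinarith
  obtain ⟨k, hk⟩ := c3
  have hκ1 : 1 ≤ κ := by
    by_contra! hc
    have : P * (κ + 1) ≤ P := by nlinarith
    have : (M + μ) * β ≤ (2 * M + T) * β := by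
      apply mul_le_mul_of_nonneg_right _ hb.le; omega
    linarith
  have hκ2 : κ ≤ 2 := by
    by_contra! hc
    have h1 : P * 2 ≤ P * (κ - 1) := by apply mul_le_mul_of_nonneg_left _ hP.le; omega
    have h2 : (T + 2 * p - 2 * μ) * β ≤ (2 * (p + μ)) * β := by
      apply mul_le_mul_of_nonneg_right _ hb.le; omega
    linarith
  have hκ3 : κ ≠ 2 := by
    intro hc
    rw [hc] at hk c2
    have h2 : p + μ < T + 2 * p - 2 * μ := by
      by_contra! hc
      have := mul_le_mul_of_nonneg_right hc hb.le
      linarith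
    have : -1 < k := by
      by_contra! hc
      have : p * k ≤ -p := by nlinarith
      omega
    have : 0 ≤ p * k := by nlinarith
    omega
  have hκ4 : κ = 1 := by omega
  rw [hκ4] at hk
  have hk1 : k = -1 := by
    have : k < 0 := by
      by_contra! hc
      have : 0 ≤ p * k := by nlinarith
      omega
    have : -2 < k := by
      by_contra! hc
      have : p * k ≤ -(2 * p) := by nlinarith
      omega
    omega
  rw [hk1] at hk
  exact ⟨hκ4, by linarith⟩

lemma Arc.mixed_marks {d e : ι} {K : ℤ} {s : Bool} (h : D.Arc d e K s) (hI : D.cnt D.PI d ≠ 0)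
    (hb : 0 < D.b s) : ∃ z, D.zero d z ∧ z < K ∧ K ≤ z + D.μ ∧ D.p - D.μ ≤ z ∧ z < D.p := by
  have hr := h.kd_r
  have hK := h.pos
  have hKl := h.K_lt
  have hl := D.len_ge
  have hμ0 := D.hμ0
  have hμp := D.hμp
  obtain ⟨hA1, hI2⟩ : D.cnt D.PA d = 1 ∧ D.cnt D.PI d = 2 := by
    rcases D.cnt_cases hr (D.cnt_eq_four hr) with h | h
    · exact absurd h.2 hI
    · exact h
  have hA := D.cnt_one_unique hA1 ⟨h.br_end, by
    rw [← h.mate, h.kd_s]; simp⟩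
  have hT := D.before_tail h.tail hK h.br_start hA
  have htwo : ∀ k l, 0 ≤ k → k < l → l < K - 1 → D.PI (D.it k d) → D.PI (D.it l d) → False := by
    intro k l h0 h1 h2 hk hll
    have := D.le_cnt (P := D.PI) (d := d) {k, l, K - 1} (by
      intro m hm
      simp only [Finset.mem_insert, Finset.mem_singleton] at hm
      rcases hm with rfl | rfl | rfl
      · exact ⟨by omega, by omega, hk⟩
      · exact ⟨by omega, by omega, hll⟩
      · exact ⟨by omega, by omega, h.br_start, hT _ (by omega) (by omega)⟩)
    rw [Finset.card_eq_three.2 ⟨k, l, K - 1, by omega, by omega, by omega, rfl⟩] at this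
    omega
  have hbk : ∀ i j, 0 ≤ i → i < j → j < K →
      (D.zero d i ∧ D.top d j) ∨ (D.top d i ∧ D.zero d j) →
      ∃ k, i ≤ k ∧ k < j ∧ D.PI (D.it k d) := fun i j h0 h1 h2 hm =>
    D.exists_break hr h1.le (fun k _ _ => hT k (by omega) (by omega)) h1 hm
  obtain ⟨⟨z, hz0, hzK, hzp, hz⟩, ⟨y, hy0, hyK, hyp, hy⟩, -⟩ := h.tail.near
  have hzz : ∀ m, D.zero d (z + m * D.p) := fun m => D.zero_of_zero hr hz ⟨m, by ring⟩
  have hzt : ∀ m, D.top d (z + D.μ + m * D.p) := fun m => D.top_of_zero hr hz ⟨m, by ring⟩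
  have ht0 := hzt 0
  have ht1 := hzt (-1)
  have hz1 := hzz 1
  have hzμ : K ≤ z + D.μ := by
    by_contra! hc
    obtain ⟨k, k1, k2, k3⟩ := hbk z _ hz0 (by omega) (by omega) (Or.inl ⟨hz, ht0⟩)
    have a1 : z + D.μ - D.p < 0 := by
      by_contra! hc'
      obtain ⟨l, l1, l2, l3⟩ := hbk _ z (by omega) (by omega) (by omega) (Or.inr ⟨ht1, hz⟩)
      exact htwo l k (by omega) (by omega) (by omega) l3 k3
    have a2 : K ≤ z + D.p := by
      by_contra! hc'
      obtain ⟨l, l1, l2, l3⟩ := hbk _ _ (by omega) (by omega) (by omega) (Or.inr ⟨ht0, hz1⟩)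
      exact htwo k l (by omega) (by omega) (by omega) k3 l3
    have hlen : D.len = (2 * D.n - 2) * D.p + 2 * D.p := by unfold len; ring
    have := h.tail.no_far hb (i := z + 1 * D.p) (j := z + D.μ + (-1) * D.p + D.len) (by omega)
      (by omega) (by omega) (by omega) hz1 (by
        unfold top at ht1 ⊢
        rw [D.it_add_len hr]; exact ht1)
    omega
  refine ⟨z, hz, hzK, hzμ, ?_, hzp⟩
  obtain ⟨m, hm⟩ := D.dvd_zero_top hr hz hy
  have : m < 0 := by
    by_contra! hc; nlinarith
  have : D.p * m ≤ -D.p := by nlinarith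
  omega

lemma Arc.mixed_prev {d e d' e' : ι} {K K' : ℤ} {s : Bool} (h : D.Arc d e K s)
    (h' : D.Arc d' e' K' s) (he : D.it (D.len - K') e' = e) (hI : D.cnt D.PI d ≠ 0) :
    D.cnt D.PI d' ≠ 0 := by
  have hr := h.kd_r
  have hK := h.pos
  obtain ⟨hA1, hI2⟩ : D.cnt D.PA d = 1 ∧ D.cnt D.PI d = 2 := by
    rcases D.cnt_cases hr (D.cnt_eq_four hr) with h | h
    · exact absurd h.2 hI
    · exact h
  have hA := D.cnt_one_unique hA1 ⟨h.br_end, by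
    rw [← h.mate, h.kd_s]; simp⟩
  have hT := D.before_tail h.tail hK h.br_start hA
  have h0 := hT 0 le_rfl hK
  rw [it_zero] at h0
  have hv := D.vertex h.dg_start
  rw [h'.prev_it he (t := -1) (by linarith [h'.K_lt]) (by norm_num), α_α', it_it,
    h.mate, α_α', it_it] at hv
  rw [show 1 + (D.len - 1) = D.len by ring, D.it_len hr,
    show -1 + (K' - 1 - -1) = K' - 1 by ring, ← D.α_α d, Equiv.apply_eq_iff_eq] at hv
  intro hc
  have := D.cnt_zero h'.kd_r hc (K' - 1)
  refine this ⟨h'.br_start, ?_⟩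
  rw [← hv, kd_it] at h0
  exact h0

variable (D)

lemma cnt_I_of_pos {d e : ι} {K : ℤ} {s : Bool} (hb : 0 < D.b s) (h : D.Arc d e K s) :
    D.cnt D.PI d = 0 := by
  by_contra hI
  let S : Set ι := {w | ∃ d e K z, D.Arc d e K s ∧ D.cnt D.PI d ≠ 0 ∧ D.zero d z ∧ z < K ∧
    K ≤ z + D.μ ∧ D.p - D.μ ≤ z ∧ z < D.p ∧ w = D.it (D.p - 1 - z) e}
  obtain ⟨z, hz⟩ := h.mixed_marks hI hb
  obtain ⟨w, ⟨d, e, K, z, h, hI, hz, hzK, hKz, hzμ, hzp, rfl⟩, hmax⟩ :=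
    Set.exists_max_image S (D.pot s) S.toFinite
      ⟨_, d, e, K, z, h, hI, hz.1, hz.2.1, hz.2.2.1, hz.2.2.2.1, hz.2.2.2.2, rfl⟩
  obtain ⟨d', e', K', h', he⟩ := D.exists_prev_arc h.kd_s h.dg_start
  have hI' := h.mixed_prev h' he hI
  obtain ⟨z', hz', hzK', hKz', hzμ', hzp'⟩ := h'.mixed_marks hI' hb
  have hmem : D.it (D.p - 1 - z') e' ∈ S :=
    ⟨d', e', K', z', h', hI', hz', hzK', hKz', hzμ', hzp', rfl⟩
  have hle := hmax _ hmem
  rw [show D.it (D.p - 1 - z') e' = D.it (D.p - 1 - z' - (D.len - K')) e by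
    rw [← he, it_it]; congr 1; ring] at hle
  have hr := h.kd_r
  have hr' := h'.kd_r
  have hl := D.len_ge
  have hμ0 := D.hμ0
  have hμp := D.hμp
  have hK := h.pos
  have hKl := h.K_lt
  have hK' := h'.pos
  have hKl' := h'.K_lt
  have hdl : D.p ∣ D.len := ⟨2 * D.n, by unfold len; ring⟩
  have hlen : D.len = (2 * D.n - 2) * D.p + 2 * D.p := by unfold len; ring
  have hM2 : 2 * D.p ≤ (2 * D.n - 2) * D.p := by nlinarith [D.hn, D.hp]
  have hfar := D.b_far hb
  set M := (2 * D.n - 2) * D.p with hM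
  have hP := D.hps s
  set T := D.p + D.μ - z - K' + z' with hT
  -- marks after the corner
  have m1 : D.v (D.it (D.p - 1 - z) e) = D.p - 1 := by
    rw [h.v_top (by omega) (by omega)]
    refine D.zero_of_zero hr hz ?_
    rw [show D.len - 1 - (D.p - 1 - z) - z = D.len - D.p by ring]
    exact dvd_sub hdl dvd_rfl
  have m2 : D.v (D.it (2 * D.p - 1 - z - D.μ) e) = 0 := by
    rw [h.v_zero (by omega) (by omega)]
    refine D.top_of_zero hr hz ?_
    rw [show D.len - 1 - (2 * D.p - 1 - z - D.μ) - z - D.μ = D.len - D.p * 2 by ring]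
    exact dvd_sub hdl (dvd_mul_right _ _)
  have m3 : D.v (D.it (D.len - 1 - z - D.p) e) = D.p - 1 := by
    rw [h.v_top (by omega) (by omega)]
    exact D.zero_of_zero hr hz (by ring_nf; exact dvd_rfl)
  -- marks before the corner
  have m1' : D.v (D.it (K' - 1 - z' - D.μ) e) = 0 := by
    rw [h'.prev_v_zero he (by omega) (by omega)]
    exact D.top_of_zero hr' hz' (by ring_nf; exact dvd_zero _)
  have m2' : D.v (D.it (K' - 1 - z' - D.p) e) = D.p - 1 := by
    rw [h'.prev_v_top he (by omega) (by omega)]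
    exact D.zero_of_zero hr' hz' (by ring_nf; exact dvd_rfl)
  have m3' : D.v (D.it (2 * D.p - 1 - z' - D.μ - (D.len - K')) e) = 0 := by
    rw [h'.prev_v_zero he (by omega) (by omega)]
    refine D.top_of_zero hr' hz' ?_
    rw [show K' - 1 - (2 * D.p - 1 - z' - D.μ - (D.len - K')) - z' - D.μ = D.len - D.p * 2 by ring]
    exact dvd_sub hdl (dvd_mul_right _ _)
  have hs := h.kd_s
  have c1 := D.cross_zero_top hs (by omega) (by omega)
    (h.not_dg_cross h' he (by omega) (by omega)) m3' m3
  have c2 := D.cross_top_zero hs (by omega) (by omega)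
    (h.not_dg_cross h' he (by omega) (by omega)) m2' m2
  have c3 := D.v_cross hs (i := K' - 1 - z' - D.μ) (j := D.p - 1 - z) (by omega) (by omega)
    (h.not_dg_cross h' he (by omega) (by omega))
  rw [m1, m1'] at c3
  replace c3 := D.dvd_of_cross c3
  have c4 := D.pot_cross hs (i := D.p - 1 - z' - (D.len - K')) (j := D.p - 1 - z) (by omega)
    (by omega) (h.not_dg_cross h' he (by omega) (by omega))
  have c5 : (M - D.p + D.μ) * D.b s ≤ D.ps s - D.p := by
    have hz1 : D.zero d (z + D.p) := D.zero_of_zero hr hz (by ring_nf; exact dvd_rfl)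
    have ht1 : D.top d (z - 2 * D.p + D.len + D.μ) := by
      refine D.top_of_zero hr hz ?_
      rw [show z - 2 * D.p + D.len + D.μ - z - D.μ = D.len - D.p * 2 by ring]
      exact dvd_sub hdl (dvd_mul_right _ _)
    have := D.run_zero_top (l := D.len - 1) (k := K) hr (by omega) (by omega) (by omega) (by omega)
      h.tail.2.2.2.2 h.tail.2.2.2.1 hz1 ht1
    rw [show z - 2 * D.p + D.len + D.μ - (z + D.p) = M - D.p + D.μ by rw [hlen]; ring] at this
    exact this
  rw [show D.len - 1 - z - D.p - (2 * D.p - 1 - z' - D.μ - (D.len - K')) = 2 * M + T by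
    rw [hT, hlen]; ring] at c1
  rw [show 2 * D.p - 1 - z - D.μ - (K' - 1 - z' - D.p) = T + 2 * D.p - 2 * D.μ by
    rw [hT]; ring] at c2
  rw [show D.p - 1 - z - (K' - 1 - z' - D.μ) = T by rw [hT]; ring] at c3
  rw [show D.p - 1 - z - (D.p - 1 - z' - (D.len - K')) = M + D.p - D.μ + T by
    rw [hT, hlen]; ring] at c4
  have hT1 : 1 ≤ T := by omega
  have hT2 : T ≤ 2 * D.μ - 1 := by omega
  obtain ⟨hκ4, hT3⟩ := jump_eq_one hμ0 hμp hb hP (by omega) hfar c1 c2 c3 hT1 hT2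
  rw [hκ4, hT3] at c4
  rw [c4] at hle
  nlinarith

lemma mirror_Arc {d e : ι} {K : ℤ} {s : Bool} (h : D.Arc d e K s) : D.mirror.Arc d e K s :=
  ⟨h.tail, h.pos, h.br_start, h.br_end, h.mate⟩

/-- Every break on a relator face is towards the special faces. -/
lemma cnt_I {d : ι} (h : D.kd d = none) : D.cnt D.PI d = 0 := by
  by_contra hI
  have hA : 0 < D.cnt D.PA d := by
    rcases D.cnt_cases h (D.cnt_eq_four h) with h | h <;> omega
  obtain ⟨j, hj1, hj2⟩ := D.exists_rotate h hA
  obtain ⟨s, hs⟩ := Option.ne_none_iff_exists'.1 hj2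
  obtain ⟨K, hK0, hKl, hbr, hT⟩ := D.exists_tail (by simpa) hs
  have harc : D.Arc (D.it j d) _ K s := ⟨hT, hK0, hbr, hj1, rfl⟩
  rw [← D.cnt_it _ h j] at hI
  apply hI
  rcases lt_or_gt_of_ne (D.b_ne s) with hb | hb
  · exact D.mirror.cnt_I_of_pos (by rw [mirror_b]; unfold b; linarith) (D.mirror_Arc harc)
  · exact D.cnt_I_of_pos hb harc

lemma cnt_A {d : ι} (h : D.kd d = none) : D.cnt D.PA d = 2 := by
  have := D.cnt_eq_four h
  have := D.cnt_I h
  omega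

lemma PA_of_br {d : ι} (h : D.kd d = none) (hb : D.br d) : D.PA d := by
  refine ⟨hb, fun hc => ?_⟩
  have := D.cnt_zero h (D.cnt_I h) 0
  rw [it_zero] at this
  exact this ⟨hb, hc⟩

variable {D}

lemma Arc.br_iff {d e : ι} {K : ℤ} {s : Bool} (h : D.Arc d e K s) {k : ℤ} (h0 : 0 ≤ k)
    (hk : k < D.len) : D.br (D.it k d) ↔ k = K - 1 ∨ k = D.len - 1 := by
  have hr := h.kd_r
  have hK := h.pos
  have hKl := h.K_lt
  constructor
  · intro hb
    by_contra! hc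
    have := D.le_cnt (P := D.PA) (d := d) {k, K - 1, D.len - 1} (by
      intro m hm
      simp only [Finset.mem_insert, Finset.mem_singleton] at hm
      rcases hm with rfl | rfl | rfl
      · exact ⟨by omega, by omega, D.PA_of_br (by simpa) hb⟩
      · exact ⟨by omega, by omega, D.PA_of_br (by simpa) h.br_start⟩
      · exact ⟨by omega, by omega, D.PA_of_br (by simpa) h.br_end⟩)
    rw [Finset.card_eq_three.2 ⟨k, K - 1, D.len - 1, by omega, by omega, by omega, rfl⟩,
      D.cnt_A hr] at this
    omega
  · rintro (rfl | rfl)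
    · exact h.br_start
    · exact h.br_end

lemma Arc.other_kd {d e : ι} {K : ℤ} {s : Bool} (h : D.Arc d e K s) :
    ∃ s', D.kd (D.α d) = some s' := by
  have hK := h.pos
  have hKl := h.K_lt
  have h1 := (D.PA_of_br (by simpa using h.kd_r) h.br_start).2
  rw [D.kd_run (i := 0) (j := K - 1) (by omega) (fun k h1 h2 hb => by
    rw [h.br_iff h1 (by omega)] at hb; omega), it_zero] at h1
  exact Option.ne_none_iff_exists'.1 h1

lemma Arc.other' {d e : ι} {K : ℤ} {s s' : Bool} (h : D.Arc d e K s)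
    (hs : D.kd (D.α d) = some s') :
    D.Arc (D.it K d) (D.α (D.it (K - 1) d)) (D.len - K) s' := by
  have hr := h.kd_r
  have hK := h.pos
  have hKl := h.K_lt
  refine ⟨⟨by simpa, by omega, by omega, ?_, ?_⟩, by omega, ?_, ?_, ?_⟩
  · rwa [it_it, sub_add_cancel, D.it_len hr]
  · intro k h1 h2 hb
    rw [it_it, show k + K = (k + K - D.len) + D.len by ring, D.it_add_len hr,
      h.br_iff (by omega) (by omega)] at hb
    omega
  · rw [it_it, show D.len - K - 1 + K = D.len - 1 by ring]; exact h.br_end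
  · rw [it_it, show D.len - 1 + K = (K - 1) + D.len by ring, D.it_add_len hr]; exact h.br_start
  · rw [it_it, show D.len - 1 + K = (K - 1) + D.len by ring, D.it_add_len hr]

lemma Arc.kd_tail {d e : ι} {K : ℤ} {s : Bool} (h : D.Arc d e K s) {k : ℤ} (h0 : K ≤ k)
    (hk : k < D.len) : D.kd (D.α (D.it k d)) = some s := by
  rw [D.kd_run h0 (fun t h1 h2 => h.tail.2.2.2.2 t h1 (by omega))]
  exact h.tail.2.2.2.1

lemma Arc.kd_head {d e : ι} {K : ℤ} {s s' : Bool} (h : D.Arc d e K s)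
    (hs : D.kd (D.α d) = some s') {k : ℤ} (h0 : 0 ≤ k)
    (hk : k < K) : D.kd (D.α (D.it k d)) = some s' := by
  have hKl := h.K_lt
  have := (h.other' hs).kd_tail (k := k + D.len - K) (by omega) (by omega)
  rwa [it_it, show k + D.len - K + K = k + D.len by ring, D.it_add_len h.kd_r] at this

lemma Arc.mono {d e : ι} {K : ℤ} {s : Bool} (h : D.Arc d e K s)
    (hs : D.kd (D.α d) = some s) (k : ℤ) : D.kd (D.α (D.it k d)) = some s := by
  rw [← D.it_emod h.kd_r]
  have h1 := Int.emod_nonneg k D.len_pos.ne'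
  have h2 := Int.emod_lt_of_pos k D.len_pos
  rcases lt_or_ge (k % D.len) K with h3 | h3
  · exact h.kd_head hs h1 h3
  · exact h.kd_tail h3 h2

lemma Arc.kd_other {d e : ι} {K : ℤ} {s : Bool} (h : D.Arc d e K s) :
    D.kd (D.α d) = some (!s) := by
  obtain ⟨s', hs'⟩ := h.other_kd
  rcases eq_or_ne s' s with rfl | hne
  · exfalso
    classical
    obtain ⟨e, he, hek⟩ := (D.closed_set
      (Z := Finset.univ.filter (fun d => (D.kd d = none ∧ ∀ k, D.kd (D.α (D.it k d)) = some s') ∨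
        (D.kd d = some s' ∧ ∀ k, D.kd (D.α (D.it k (D.α d))) = some s')))
      ⟨d, by simpa using Or.inl ⟨h.kd_r, h.mono hs'⟩⟩ (by
        intro d hd
        simp only [Finset.mem_filter, Finset.mem_univ, true_and, D.kd_φ] at hd ⊢
        refine hd.imp (fun hd => ⟨hd.1, fun k => ?_⟩) (fun hd => ⟨hd.1, ?_⟩)
        · rw [φ_eq, it_it]; exact hd.2 _
        · by_cases hb : D.br d
          · have hdg : D.dg (D.it 1 d) := by rw [dg, it_it]; simpa using hb
            obtain ⟨K, hA⟩ := D.exists_arc (e := D.it 1 d) (s := s') (by simpa using hd.1) hdg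
            have hv := D.vertex hdg
            rw [it_it, neg_add_cancel, it_zero] at hv
            intro k
            have := hA.mono (by
              rw [← hv, α_α', kd_it]; exact hd.2 (-1)) (k - 1)
            rwa [it_it, sub_add_cancel, ← φ_eq] at this
          · intro k
            have := D.α_succ hb
            rw [← φ_eq] at this
            rw [this, it_it]; exact hd.2 _) (by
        intro d hd
        simp only [Finset.mem_filter, Finset.mem_univ, true_and] at hd ⊢
        rcases hd with hd | hd
        · right
          refine ⟨by simpa using hd.2 0, fun k => ?_⟩
          rw [α_α']; exact hd.2 k
        · exact Or.inl ⟨D.special_mate hd.1, hd.2⟩)).1 (!s')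
    rw [Finset.mem_filter, hek] at he
    simp at he
  · rw [hs']
    revert hne; cases s <;> cases s' <;> simp

lemma Arc.other {d e : ι} {K : ℤ} {s : Bool} (h : D.Arc d e K s) :
    D.Arc (D.it K d) (D.α (D.it (K - 1) d)) (D.len - K) (!s) := h.other' h.kd_other

variable (D)

lemma exists_arc_of_relator {d : ι} (h : D.kd d = none) : ∃ j e K s, D.Arc (D.it j d) e K s := by
  obtain ⟨j, hj1, hj2⟩ := D.exists_rotate (P := D.PA) h (by rw [D.cnt_A h]; norm_num)
  obtain ⟨s, hs⟩ := Option.ne_none_iff_exists'.1 hj2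
  obtain ⟨K, hK0, hKl, hbr, hT⟩ := D.exists_tail (by simpa) hs
  exact ⟨j, _, K, s, hT, hK0, hbr, hj1, rfl⟩

lemma relator_mate {d : ι} (h : D.kd d = none) : D.kd (D.α d) ≠ none := by
  obtain ⟨j, e, K, s, hA⟩ := D.exists_arc_of_relator h
  have h1 := Int.emod_nonneg (-j) D.len_pos.ne'
  have h2 := Int.emod_lt_of_pos (-j) D.len_pos
  have h3 := D.it_emod hA.kd_r (-j)
  rw [D.it_it (-j), neg_add_cancel, it_zero] at h3
  rw [← h3]
  rcases lt_or_ge ((-j) % D.len) K with h4 | h4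
  · simp [hA.kd_head hA.kd_other h1 h4]
  · simp [hA.kd_tail h4 h2]

/-- A relator dart followed by a break and glued to the special face `i`. -/
def PK (i : Bool) (d : ι) : Prop := D.br d ∧ D.kd (D.α d) = some i

instance (i : Bool) : DecidablePred (D.PK i) := fun d => by unfold PK; infer_instance

lemma cnt_K {d : ι} (h : D.kd d = none) (i : Bool) : D.cnt (D.PK i) d = 1 := by
  obtain ⟨j, e, K, s, hA⟩ := D.exists_arc_of_relator h
  rw [← D.cnt_it _ h j]
  have hK := hA.pos
  have hKl := hA.K_lt
  have hs := hA.kd_other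
  unfold cnt
  rw [Finset.card_eq_one]
  refine ⟨if i = s then D.len - 1 else K - 1, ?_⟩
  ext k
  simp only [Finset.mem_filter, Finset.mem_Ico, Finset.mem_singleton]
  unfold PK
  constructor
  · rintro ⟨⟨h1, h2⟩, h3, h4⟩
    rcases (hA.br_iff h1 h2).1 h3 with rfl | rfl
    · rw [hA.kd_head hs (by omega) (by omega)] at h4
      rw [if_neg]
      rintro rfl
      simp at h4
    · rw [hA.kd_tail (by omega) (by omega)] at h4
      rw [if_pos (by simpa using h4.symm)]
  · rintro rfl
    split_ifs with h5
    · exact ⟨⟨by omega, by omega⟩, hA.br_end, by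
        rw [h5]; exact hA.kd_tail (by omega) (by omega)⟩
    · refine ⟨⟨by omega, by omega⟩, hA.br_start, ?_⟩
      rw [hA.kd_head hs (by omega) (by omega)]
      revert h5; cases i <;> cases s <;> simp

instance : DecidablePred D.dg := fun d => by unfold dg; infer_instance

/-- The branch corners of the special face `i`. -/
def corners (i : Bool) : Finset ι := Finset.univ.filter (fun e => D.kd e = some i ∧ D.dg e)

lemma mem_corners {i : Bool} {e : ι} : e ∈ D.corners i ↔ D.kd e = some i ∧ D.dg e := by
  simp [corners]

lemma card_corners (i : Bool) : ((D.corners i).card : ℤ) = D.N := by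
  have h1 := D.sum_cnt (D.PK i) (Z := Finset.univ) (by simp)
  rw [Finset.sum_congr rfl (fun d hd => D.cnt_K (Finset.mem_filter.1 hd).2 i)] at h1
  have h2 := D.card_r
  rw [show 2 * D.n * D.p = D.len from rfl] at h2
  simp only [Finset.sum_const, smul_eq_mul, mul_one] at h1
  rw [h2] at h1
  have h3 := mul_left_cancel₀ D.len_pos.ne' h1
  rw [h3]
  norm_cast
  refine Finset.card_nbij' D.α D.α ?_ ?_ ?_ ?_
  · intro e he
    rw [Finset.mem_coe, mem_corners] at he
    simp only [Finset.coe_filter, Set.mem_ofPred_eq]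
    unfold PK
    rw [α_α']
    exact ⟨Finset.mem_univ _, D.special_mate he.1, (D.dg_iff e).1 he.2, he.1⟩
  · intro d hd
    simp only [Finset.coe_filter, Set.mem_ofPred_eq] at hd
    unfold PK at hd
    rw [Finset.mem_coe, mem_corners, dg_iff, α_α']
    exact ⟨hd.2.2.2, hd.2.2.1⟩
  · intro e _; exact D.α_α e
  · intro e _; exact D.α_α e

lemma len_mul_N : D.len * D.N = 2 * D.ps false + 2 * D.ps true := by
  rw [← D.card_s false, ← D.card_s true, len, ← D.card_r]
  norm_cast
  rw [← Finset.card_union_of_disjoint (by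
    rw [Finset.disjoint_filter]; intro d _ h1 h2; rw [h1] at h2; simp at h2)]
  refine Finset.card_nbij' D.α D.α ?_ ?_ ?_ ?_
  · intro d hd
    simp only [Finset.coe_filter, Set.mem_ofPred_eq] at hd
    obtain ⟨s, hs⟩ := Option.ne_none_iff_exists'.1 (D.relator_mate hd.2)
    cases s <;> simp [hs]
  · intro d hd
    simp only [Finset.coe_union, Finset.coe_filter, Set.mem_union, Set.mem_ofPred_eq] at hd
    rcases hd with hd | hd <;> simp [D.special_mate hd.2]
  · intro e _; exact D.α_α e
  · intro e _; exact D.α_α e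

lemma sum_it (i : Bool) (f : ι → ℤ) (k : ℤ) :
    ∑ d ∈ Finset.univ.filter (fun d => D.kd d = some i), f (D.it k d) =
      ∑ d ∈ Finset.univ.filter (fun d => D.kd d = some i), f d := by
  refine Finset.sum_nbij' (D.it k) (D.it (-k)) ?_ ?_ ?_ ?_ ?_ <;> simp [it_it]

lemma sum_jump (i : Bool) : ∑ e ∈ D.corners i, D.jump e = 2 * D.b i := by
  set S := Finset.univ.filter (fun d => D.kd d = some i) with hS
  have h1 : ∑ e ∈ D.corners i, D.jump e = ∑ e ∈ S, D.jump e := by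
    refine Finset.sum_subset ?_ ?_
    · intro e he
      simp [hS, ((D.mem_corners).1 he).1]
    · intro e he hne
      rw [hS, Finset.mem_filter] at he
      rw [mem_corners] at hne
      exact D.jump_zero (fun h => hne ⟨he.2, h⟩) (D.special_mate he.2)
  have h2 := D.sum_it i D.v (-1)
  have h3 := D.sum_it i D.x (-1)
  have hc := D.card_s i
  rw [← hS] at h2 h3 hc
  rw [Finset.sum_congr rfl (fun e he => D.x_s_pred (i := i) (by
    rw [hS] at he; exact (Finset.mem_filter.1 he).2))] at h3
  simp only [Finset.sum_add_distrib, Finset.sum_sub_distrib, ← Finset.mul_sum, Finset.sum_const,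
    nsmul_eq_mul, hc] at h3
  have h4 : ∑ e ∈ S, D.c e = 2 * D.qs i := by
    have : D.ps i * ∑ e ∈ S, D.c e = D.ps i * (2 * D.qs i) := by linarith
    exact mul_left_cancel₀ (D.hps i).ne' this
  rw [h1]
  unfold jump
  simp only [Finset.sum_add_distrib, Finset.sum_sub_distrib, ← Finset.mul_sum, Finset.sum_const,
    nsmul_eq_mul, hc, h2, h4]
  unfold b; ring

/-- The configuration of arcs around a branch point. -/
structure Vtx (d d' e e' g g' : ι) (K K' : ℤ) (s : Bool) : Prop where
  arc : D.Arc d e K s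
  prev : D.Arc d' e' K' s
  arc' : D.Arc (D.it K' d') g (D.len - K') (!s)
  prev' : D.Arc (D.it K d) g' (D.len - K) (!s)
  join : D.it (D.len - K') e' = e
  join' : D.it K g' = g

variable {D}

lemma Vtx.symm {d d' e e' g g' : ι} {K K' : ℤ} {s : Bool} (h : D.Vtx d d' e e' g g' K K' s) :
    D.Vtx (D.it K' d') (D.it K d) g g' e e' (D.len - K') (D.len - K) (!s) := by
  have h1 := D.it_len h.arc.kd_r
  have h2 := D.it_len h.prev.kd_r
  refine ⟨h.arc', h.prev', ?_, ?_, ?_, h.join⟩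
  · rw [it_it, sub_add_cancel, sub_sub_cancel, Bool.not_not, h1]; exact h.arc
  · rw [it_it, sub_add_cancel, sub_sub_cancel, Bool.not_not, h2]; exact h.prev
  · rw [sub_sub_cancel]; exact h.join'

lemma Vtx.mirror {d d' e e' g g' : ι} {K K' : ℤ} {s : Bool} (h : D.Vtx d d' e e' g g' K K' s) :
    D.mirror.Vtx d d' e e' g g' K K' s :=
  ⟨D.mirror_Arc h.arc, D.mirror_Arc h.prev, D.mirror_Arc h.arc', D.mirror_Arc h.prev', h.join,
    h.join'⟩

variable (D)

/-- The branch corner opposite to a given one. -/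
def opp (e : ι) : ι := D.α (D.it (-1) (D.α (D.it (-1) e)))

lemma exists_vtx {e : ι} {s : Bool} (h : D.kd e = some s) (hd : D.dg e) :
    ∃ d d' e' g' K K', D.Vtx d d' e e' (D.opp e) g' K K' s := by
  obtain ⟨K, hA⟩ := D.exists_arc h hd
  obtain ⟨d', e', K', hA', hj⟩ := D.exists_prev_arc h hd
  have hKl := hA.K_lt
  have hK := hA.pos
  have h1 := hA'.prev_it hj (t := -1) (by linarith [hA'.K_lt]) (by norm_num)
  rw [show K' - 1 - -1 = K' by ring] at h1
  have hopp : D.opp e = D.α (D.it (K' - 1) d') := by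
    rw [opp, h1, α_α', it_it, neg_add_eq_sub]
  refine ⟨D.it 1 (D.α e), d', e', _, K, K', hA, hA', ?_, hA.other, hj, ?_⟩
  · rw [hopp]; exact hA'.other
  · have h2 := hA.other.run (t := K - 1) (by omega) (by omega)
    rw [D.it_it _ K, show D.len - 1 - (K - 1) + K = D.len by ring, D.it_len hA.kd_r,
      ← D.vertex hd, α_α'] at h2
    have h3 := congrArg (D.it 1) h2
    rw [it_it, add_sub_cancel, it_it] at h3
    rw [opp, ← D.vertex hd, h3]
    simp

lemma mirror_jump {e : ι} {s : Bool} (h : D.kd e = some s) : D.mirror.jump e = - D.jump e := by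
  have h1 := D.special_mate h
  have h2 := D.special_mate (d := D.it (-1) e) (i := s) (by simpa)
  have h3 : D.mirror.c e = 1 - D.c e := rfl
  have h4 : D.mirror.q = D.p - D.q := rfl
  unfold jump v
  rw [h3, h4, mirror_it, mirror_α, mirror_α, D.mirror_x_r h1, D.mirror_x_r h2, mirror_p]
  ring

variable {D}

/-- Marks near the ends of the arcs at a branch point. -/
lemma Vtx.after {d d' e e' g g' : ι} {K K' : ℤ} {s : Bool} (h : D.Vtx d d' e e' g g' K K' s) :
    (∃ j, 0 ≤ j ∧ j < D.p ∧ j < D.len - K ∧ D.zero d (-1 - j)) ∧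
    (∃ j, 0 ≤ j ∧ j < D.p ∧ j < D.len - K ∧ D.top d (-1 - j)) := by
  have hr := h.arc.kd_r
  obtain ⟨-, -, ⟨z, h0, h1, h2, hz⟩, ⟨y, h3, h4, h5, hy⟩⟩ := h.prev'.tail.near
  unfold zero at *; unfold top at *
  rw [it_it] at hz hy
  constructor
  · refine ⟨D.len - K - 1 - z, by omega, by omega, by omega, ?_⟩
    rw [← D.it_add_len hr, ← hz]; congr 2; ring
  · refine ⟨D.len - K - 1 - y, by omega, by omega, by omega, ?_⟩
    rw [← D.it_add_len hr, ← hy]; congr 2; ring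

lemma Vtx.before {d d' e e' g g' : ι} {K K' : ℤ} {s : Bool} (h : D.Vtx d d' e e' g g' K K' s) :
    (∃ i, -D.p ≤ i ∧ i < 0 ∧ -(D.len - K') ≤ i ∧ D.zero d' (K' - 1 - i)) ∧
    (∃ i, -D.p ≤ i ∧ i < 0 ∧ -(D.len - K') ≤ i ∧ D.top d' (K' - 1 - i)) := by
  have hr := h.prev.kd_r
  obtain ⟨⟨z, h0, h1, h2, hz⟩, ⟨y, h3, h4, h5, hy⟩, -⟩ := h.arc'.tail.near
  unfold zero at *; unfold top at *
  rw [it_it] at hz hy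
  constructor
  · refine ⟨-1 - z, by omega, by omega, by omega, ?_⟩
    rw [← hz]; congr 2; ring
  · refine ⟨-1 - y, by omega, by omega, by omega, ?_⟩
    rw [← hy]; congr 2; ring

lemma Vtx.v_top_after {d d' e e' g g' : ι} {K K' : ℤ} {s : Bool} (h : D.Vtx d d' e e' g g' K K' s)
    {j : ℤ} (h0 : 0 ≤ j) (h1 : j < D.len - K) (hz : D.zero d (-1 - j)) :
    D.v (D.it j e) = D.p - 1 := by
  rw [h.arc.v_top h0 h1]; unfold zero at *
  rw [← hz, ← D.it_add_len h.arc.kd_r (-1 - j)]; congr 2; ring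

lemma Vtx.v_zero_after {d d' e e' g g' : ι} {K K' : ℤ} {s : Bool} (h : D.Vtx d d' e e' g g' K K' s)
    {j : ℤ} (h0 : 0 ≤ j) (h1 : j < D.len - K) (hz : D.top d (-1 - j)) :
    D.v (D.it j e) = 0 := by
  rw [h.arc.v_zero h0 h1]; unfold top at *
  rw [← hz, ← D.it_add_len h.arc.kd_r (-1 - j)]; congr 2; ring

lemma Vtx.zero_top {d d' e e' g g' : ι} {K K' : ℤ} {s : Bool} (h : D.Vtx d d' e e' g g' K K' s)
    {i j : ℤ} (hi : i < 0) (hi' : -(D.len - K') ≤ i) (hj : 0 ≤ j) (hj' : j < D.len - K)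
    (h0 : D.top d' (K' - 1 - i)) (h1 : D.zero d (-1 - j)) :
    (j - i) * D.b s ≤ D.ps s * (D.jump e + 1) - D.p :=
  D.cross_zero_top h.arc.kd_s hi hj (h.arc.not_dg_cross h.prev h.join hi' hj')
    ((h.prev.prev_v_zero h.join hi' hi).2 h0) (h.v_top_after hj hj' h1)

lemma Vtx.top_zero {d d' e e' g g' : ι} {K K' : ℤ} {s : Bool} (h : D.Vtx d d' e e' g g' K K' s)
    {i j : ℤ} (hi : i < 0) (hi' : -(D.len - K') ≤ i) (hj : 0 ≤ j) (hj' : j < D.len - K)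
    (h0 : D.zero d' (K' - 1 - i)) (h1 : D.top d (-1 - j)) :
    D.ps s * (D.jump e - 1) + D.p ≤ (j - i) * D.b s :=
  D.cross_top_zero h.arc.kd_s hi hj (h.arc.not_dg_cross h.prev h.join hi' hj')
    ((h.prev.prev_v_top h.join hi' hi).2 h0) (h.v_zero_after hj hj' h1)

lemma Vtx.jump_nonneg {d d' e e' g g' : ι} {K K' : ℤ} {s : Bool}
    (h : D.Vtx d d' e e' g g' K K' s) (hb : 0 < D.b s) : 0 ≤ D.jump e := by
  obtain ⟨⟨j, h1, h2, h3, h4⟩, -⟩ := h.after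
  obtain ⟨-, ⟨i, h5, h6, h7, h8⟩⟩ := h.before
  have := h.zero_top h6 h7 h1 h3 h8 h4
  have hp := D.hp
  have : 0 < (j - i) * D.b s := by apply mul_pos _ hb; omega
  have hP := D.hps s
  by_contra! hc
  have : D.ps s * (D.jump e + 1) ≤ 0 := mul_nonpos_of_nonneg_of_nonpos hP.le (by omega)
  linarith

lemma Vtx.jump_nonpos {d d' e e' g g' : ι} {K K' : ℤ} {s : Bool}
    (h : D.Vtx d d' e e' g g' K K' s) (hb : D.b s < 0) : D.jump e ≤ 0 := by
  have := h.mirror.jump_nonneg (by rw [mirror_b]; linarith)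
  rw [D.mirror_jump h.arc.kd_s] at this
  linarith

lemma Vtx.jump_eq {d d' e e' g g' : ι} {K K' : ℤ} {s : Bool} (h : D.Vtx d d' e e' g g' K K' s) :
    D.jump e = D.x (D.it (K' - 1) d') - D.x (D.it (-1) d) + D.p * (D.c e - D.c (D.it K' d')) := by
  have h1 := h.prev.prev_it h.join (t := -1) (by linarith [h.prev.K_lt]) (by norm_num)
  rw [show K' - 1 - -1 = K' by ring] at h1
  have h2 := D.x_r_pred (d := D.it K' d') (by simpa using h.prev.kd_r)
  rw [it_it, neg_add_eq_sub] at h2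
  unfold jump v
  rw [h1, α_α', h.arc.mate, α_α', show D.len - 1 = -1 + D.len by ring, D.it_add_len h.arc.kd_r, h2]
  ring

lemma Vtx.jump_eq' {d d' e e' g g' : ι} {K K' : ℤ} {s : Bool} (h : D.Vtx d d' e e' g g' K K' s) :
    D.jump g = D.x (D.it (-1) d) - D.x (D.it (K' - 1) d') + D.p * (D.c g - D.c d) := by
  have := h.symm.jump_eq
  rw [it_it, it_it, it_it, show D.len - K - 1 + K = -1 + D.len by ring, D.it_add_len h.arc.kd_r,
    sub_add_cancel, D.it_len h.arc.kd_r, neg_add_eq_sub] at this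
  exact this

lemma Vtx.parity {d d' e e' g g' : ι} {K K' : ℤ} {s : Bool} (h : D.Vtx d d' e e' g g' K K' s) :
    2 ∣ D.c e + D.c (D.it K' d') + D.c g + D.c d := by
  have h1 := h.prev.prev_it h.join (t := -1) (by linarith [h.prev.K_lt]) (by norm_num)
  rw [show K' - 1 - -1 = K' by ring] at h1
  have h2 : D.α (D.it (K' - 1) d') = g := by
    rw [h.arc'.mate, it_it, show D.len - 1 + K' = K' - 1 + D.len by ring,
      D.it_add_len h.prev.kd_r]
  have h3 := D.vertex h.arc.dg_start
  have h4 : D.it 1 (D.α e) = d := by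
    rw [h.arc.mate, α_α', it_it, add_sub_cancel, D.it_len h.arc.kd_r]
  have h5 : D.α (D.φ⁻¹ e) = D.it K' d' := by rw [φinv_eq, h1, α_α']
  have h6 : D.α (D.φ⁻¹ (D.it K' d')) = g := by rw [φinv_it, h2]
  have h7 : D.α (D.φ⁻¹ g) = d := by
    rw [← h4, ← h3, h1, α_α', it_it, neg_add_eq_sub, h2, φinv_eq]
  have h8 : D.α (D.φ⁻¹ d) = e := by
    rw [← h4, φinv_it, sub_self, it_zero, α_α']
  have := D.c_four e (by rw [h5, h6, h7, h8])
  rwa [h5, h6, h7] at this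

/-- The two jumps at a branch point add up to a multiple of `2 * p`. -/
lemma Vtx.jump_add {d d' e e' g g' : ι} {K K' : ℤ} {s : Bool} (h : D.Vtx d d' e e' g g' K K' s) :
    D.jump e + D.jump g = 0 ∨
    (D.c e = 1 ∧ D.c g = 1 ∧ D.c (D.it K' d') = 0 ∧ D.c d = 0) ∨
    (D.c e = 0 ∧ D.c g = 0 ∧ D.c (D.it K' d') = 1 ∧ D.c d = 1) := by
  have h1 := h.jump_eq
  have h2 := h.jump_eq'
  obtain ⟨k, hk⟩ := h.parity
  rcases D.c01 e with a | a <;> rcases D.c01 g with b | b <;>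
  rcases D.c01 (D.it K' d') with c | c <;> rcases D.c01 d with f | f <;>
  rw [a, b, c, f] at hk <;>
  first
  | (exfalso; omega)
  | (right; left; exact ⟨a, b, c, f⟩)
  | (right; right; exact ⟨a, b, c, f⟩)
  | (left; rw [h1, h2, a, b, c, f]; ring)

lemma Vtx.x_range {d d' e e' g g' : ι} {K K' : ℤ} {s : Bool} (h : D.Vtx d d' e e' g g' K K' s) :
    0 ≤ D.x (D.it (K' - 1) d') ∧ D.x (D.it (K' - 1) d') < D.p ∧
    0 ≤ D.x (D.it (-1) d) ∧ D.x (D.it (-1) d) < D.p :=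
  ⟨D.x_nonneg _, D.x_lt_r _ (by simpa using h.prev.kd_r), D.x_nonneg _,
    D.x_lt_r _ (by simpa using h.arc.kd_r)⟩

/-- The distances across the two opposite corners add up to `2 * p`. -/
lemma Vtx.opposite {d d' e e' g g' : ι} {K K' : ℤ} {s : Bool} (h : D.Vtx d d' e e' g g' K K' s) :
    D.ps s * (D.jump e - 1) + D.ps (!s) * (- D.jump g - 1) + 2 * D.p ≤
      D.b s * 2 * D.p ∨ D.b s + D.b (!s) ≠ 0 := by
  rw [or_iff_not_imp_right, not_not]
  intro hb
  obtain ⟨-, ⟨j, h1, h2, h3, h4⟩⟩ := h.after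
  obtain ⟨⟨i, h5, h6, h7, h8⟩, -⟩ := h.before
  have hr := h.arc.kd_r
  have hr' := h.prev.kd_r
  obtain ⟨-, ⟨y, y1, y2, y3, y4⟩, -⟩ := h.arc.tail.near
  obtain ⟨-, -, ⟨z, z1, z2, z3, z4⟩, -⟩ := h.prev.tail.near
  have hy : y = D.p - 1 - j := by
    have := D.dvd_of_x_eq hr (j := -1 - j) (k := y) (by unfold top at h4 y4; rw [h4, y4])
    obtain ⟨m, hm⟩ := this
    have hp := D.hp
    have : 0 < m := by by_contra! hc; nlinarith
    have : m < 2 := by by_contra! hc; nlinarith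
    obtain rfl : m = 1 := by omega
    linarith
  have hz : z = K' - 1 - (i + D.p) := by
    have := D.dvd_zero_zero hr' z4 h8
    obtain ⟨m, hm⟩ := this
    have hp := D.hp
    have : 0 < m := by by_contra! hc; nlinarith
    have : m < 2 := by by_contra! hc; nlinarith
    obtain rfl : m = 1 := by omega
    linarith
  have a1 := h.top_zero h6 h7 h1 h3 h8 h4
  have a2 := h.symm.zero_top (i := j - D.p) (j := i + D.p) (by omega) (by omega) (by omega)
    (by omega) (by
      unfold top at *
      rw [it_it, ← y4, ← D.it_add_len hr y, hy]; congr 2; ring) (by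
      unfold zero at *
      rw [it_it, ← z4, hz]; congr 2; ring)
  have : D.b (!s) = - D.b s := by linarith
  rw [this] at a2
  linarith

variable (D)

lemma opp_mem {e : ι} {s : Bool} (h : e ∈ D.corners s) : D.opp e ∈ D.corners (!s) := by
  rw [mem_corners] at h
  obtain ⟨d, d', e', g', K, K', hv⟩ := D.exists_vtx h.1 h.2
  rw [mem_corners]
  exact ⟨hv.arc'.kd_s, hv.arc'.dg_start⟩

lemma opp_opp {e : ι} (h : D.dg e) : D.opp (D.opp e) = e := by
  have := D.vertex h
  unfold opp
  rw [this, it_it]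
  simp [α_α']

lemma sum_jump_opp (s : Bool) : ∑ e ∈ D.corners s, (D.jump e + D.jump (D.opp e)) =
    2 * D.b s + 2 * D.b (!s) := by
  rw [Finset.sum_add_distrib, sum_jump, ← D.sum_jump (!s)]
  congr 1
  refine Finset.sum_nbij' D.opp D.opp ?_ ?_ ?_ ?_ ?_
  · intro e he; exact D.opp_mem he
  · intro e he; simpa using D.opp_mem he
  · intro e he; exact D.opp_opp ((D.mem_corners).1 he).2
  · intro e he; exact D.opp_opp ((D.mem_corners).1 he).2
  · intro e _; rfl

lemma not_opposite {s : Bool} (hs : 0 < D.b s) (hs' : D.b (!s) < 0) : False := by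
  have hz : ∀ e ∈ D.corners s, D.jump e + D.jump (D.opp e) = 0 := by
    intro e he
    rw [mem_corners] at he
    obtain ⟨d, d', e', g', K, K', hv⟩ := D.exists_vtx he.1 he.2
    have h1 := hv.jump_nonneg hs
    have h2 := hv.symm.jump_nonpos hs'
    have h3 := hv.jump_eq
    have h4 := hv.jump_eq'
    obtain ⟨x1, x2, x3, x4⟩ := hv.x_range
    rcases hv.jump_add with h | ⟨a, b, c, f⟩ | ⟨a, b, c, f⟩
    · exact h
    · rw [b, f] at h4; linarith
    · rw [a, c] at h3; linarith
  have hsum := D.sum_jump_opp s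
  rw [Finset.sum_congr rfl hz, Finset.sum_const_zero] at hsum
  have hb : D.b s + D.b (!s) = 0 := by linarith
  have hfar : D.ps s + D.ps (!s) < D.len * D.b s := by
    have hf := D.far_opp
    change D.b false + D.b true = 0 → _ < D.len * |D.b false| at hf
    cases s
    · have := hf hb
      rwa [abs_of_pos hs] at this
    · have := hf (by rw [add_comm]; exact hb)
      have hb' : D.b true + D.b false = 0 := hb
      have hs'' : D.b false < 0 := hs'
      rw [abs_of_neg hs'', show - D.b false = D.b true by linarith] at this
      show D.ps true + D.ps false < _
      linarith
  have hN := D.len_mul_N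
  have hNs : D.len * D.N = 2 * (D.ps s + D.ps (!s)) := by
    cases s
    · simp only [Bool.not_false]; linarith
    · simp only [Bool.not_true]; linarith
  have hl := D.len_pos
  have hN2 : D.N < 2 * D.b s := by
    by_contra! hc
    have := mul_le_mul_of_nonneg_left hc hl.le
    linarith
  have hNpos : 0 < D.N := by
    have h1 := D.hps s
    have h2 := D.hps (!s)
    by_contra! hc
    have := mul_nonpos_of_nonneg_of_nonpos hl.le hc
    linarith
  have hcard := D.card_corners s
  have hne : (D.corners s).Nonempty := by
    rw [← Finset.card_pos]; omega
  obtain ⟨e, he, hmax⟩ := Finset.exists_max_image _ D.jump hne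
  have h1 := Finset.sum_le_card_nsmul _ _ _ hmax
  rw [sum_jump, nsmul_eq_mul, hcard] at h1
  have hκ : 2 ≤ D.jump e := by
    by_contra! hc
    have : D.N * D.jump e ≤ D.N * 1 := mul_le_mul_of_nonneg_left (by omega) hNpos.le
    linarith
  have hze := hz e he
  rw [mem_corners] at he
  obtain ⟨d, d', e', g', K, K', hv⟩ := D.exists_vtx he.1 he.2
  have h2 := (hv.opposite).resolve_right (by rw [not_not]; exact hb)
  rw [show - D.jump (D.opp e) = D.jump e by linarith] at h2
  have hp := D.hp
  have hn := D.hn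
  have h3 : D.n * D.p * D.N = D.ps s + D.ps (!s) := by
    have : 2 * (D.n * D.p * D.N) = 2 * (D.ps s + D.ps (!s)) := by rw [← hNs]; unfold len; ring
    linarith
  have h4 : D.n * D.p * D.N * (D.jump e - 1) + 2 * D.p ≤ D.N * D.jump e * D.p := by
    rw [h3]
    nlinarith [mul_le_mul_of_nonneg_right h1 (show 0 ≤ D.p by linarith)]
  have h5 : D.N * D.p * (D.n * (D.jump e - 1)) < D.N * D.p * D.jump e := by nlinarith
  have h6 := lt_of_mul_lt_mul_left h5 (by positivity)
  nlinarith

/-- If both slopes lie on the same side, they are close. -/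
lemma same_side (h : ∀ i, 0 < D.b i) : ∃ d d' e e' g g' K K',
    D.Vtx d d' e e' g g' K K' false ∧ D.c e = 1 ∧ D.c g = 1 ∧ D.c (D.it K' d') = 0 ∧ D.c d = 0 := by
  by_contra! hc
  have hz : ∀ e ∈ D.corners false, D.jump e + D.jump (D.opp e) = 0 := by
    intro e he
    rw [mem_corners] at he
    obtain ⟨d, d', e', g', K, K', hv⟩ := D.exists_vtx he.1 he.2
    have h1 := hv.jump_nonneg (h _)
    have h3 := hv.jump_eq
    obtain ⟨x1, x2, x3, x4⟩ := hv.x_range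
    rcases hv.jump_add with h | ⟨a, b, c, f⟩ | ⟨a, b, c, f⟩
    · exact h
    · exact absurd f (hc _ _ _ _ _ _ _ _ hv a b c)
    · rw [a, c] at h3; linarith
  have hsum := D.sum_jump_opp false
  rw [Finset.sum_congr rfl hz, Finset.sum_const_zero] at hsum
  have h1 := h false
  have h2 := h true
  rw [Bool.not_false] at hsum
  linarith

variable {D}

lemma Vtx.lt_of_c {d d' e e' g g' : ι} {K K' : ℤ} {s : Bool} (h : D.Vtx d d' e e' g g' K K' s)
    (hb : 0 < D.b s) (h1 : D.c e = 1) (h3 : D.c (D.it K' d') = 0) (h4 : D.c d = 0) :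
    D.q + 1 ≤ D.jump e ∧ D.ps s * D.q < (2 * D.p - 1) * D.b s := by
  have hj := h.jump_eq
  obtain ⟨x1, x2, x3, x4⟩ := h.x_range
  have hX := D.x_r' (d := D.it (K' - 1) d') (by simpa using h.prev.kd_r)
  rw [it_it, add_sub_cancel, h3] at hX
  have hX' := D.x_lt_r (D.it K' d') (by simpa using h.prev.kd_r)
  rw [h1, h3] at hj
  have hY := D.x_r' (d := D.it (-1) d) (by simpa using h.arc.kd_r)
  rw [it_it, add_neg_cancel, it_zero, h4] at hY
  have hY' := D.x_lt_r d h.arc.kd_r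
  have hκ : D.q + 1 ≤ D.jump e := by linarith
  refine ⟨hκ, ?_⟩
  obtain ⟨-, ⟨j, h1, h2, h3, h4⟩⟩ := h.after
  obtain ⟨⟨i, h5, h6, h7, h8⟩, -⟩ := h.before
  have a1 := h.top_zero h6 h7 h1 h3 h8 h4
  have hp := D.hp
  have a2 : (j - i) * D.b s ≤ (2 * D.p - 1) * D.b s := by
    apply mul_le_mul_of_nonneg_right _ hb.le; omega
  have a3 : D.ps s * D.q ≤ D.ps s * (D.jump e - 1) := by
    apply mul_le_mul_of_nonneg_left _ (D.hps s).le; omega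
  linarith

lemma Arc.zero_top_le {d e : ι} {K : ℤ} {s : Bool} (h : D.Arc d e K s)
    (hb : 0 < D.b s) (hs : D.ps s * D.q < (2 * D.p - 1) * D.b s) {i j : ℤ} (hi : K ≤ i)
    (hi' : i < D.len) (hj : K ≤ j) (hj' : j < D.len) (h0 : D.zero d i) (h1 : D.top d j) :
    j - i ≤ D.μ := by
  obtain ⟨h2, h3, h4, h5, h6⟩ := h.tail
  have := D.run_zero_top (l := D.len - 1) h2 hi hj (by omega) (by omega) h6 h5 h0 h1
  have hp := D.hp
  have hq := D.hq0
  obtain ⟨k, hk⟩ := D.hμq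
  have hk1 : 1 ≤ k := by
    by_contra! hc
    nlinarith [mul_pos D.hμ0 hq]
  obtain ⟨m, hm⟩ := D.dvd_zero_top h2 h0 h1
  by_contra! hc
  have hm1 : 1 ≤ m := by
    by_contra! hc'
    nlinarith
  have hd : D.p + D.μ ≤ j - i := by nlinarith
  have e1 : (D.p + D.μ) * D.b s * D.q ≤ (D.ps s - D.p) * D.q :=
    mul_le_mul_of_nonneg_right ((mul_le_mul_of_nonneg_right hd hb.le).trans this) hq.le
  have e2 : 2 * D.p - 1 ≤ (D.p + D.μ) * D.q := by nlinarith
  have e3 := mul_le_mul_of_nonneg_right e2 hb.le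
  nlinarith

/-- The same bound on the complementary arc. -/
lemma Arc.zero_top_le' {d e : ι} {K : ℤ} {s : Bool} (h : D.Arc d e K s)
    (hb : 0 < D.b (!s)) (hs : D.ps (!s) * D.q < (2 * D.p - 1) * D.b (!s)) {i j : ℤ} (hi : 0 ≤ i)
    (hi' : i < K) (hj : 0 ≤ j) (hj' : j < K) (h0 : D.zero d i) (h1 : D.top d j) :
    j - i ≤ D.μ := by
  have := h.other.zero_top_le (i := i + (D.len - K)) (j := j + (D.len - K)) hb hs (by omega)
    (by omega) (by omega) (by omega) (by
      unfold zero; rw [it_it, add_assoc, sub_add_cancel, D.it_add_len h.kd_r]; exact h0) (by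
      unfold top; rw [it_it, add_assoc, sub_add_cancel, D.it_add_len h.kd_r]; exact h1)
  linarith

lemma Arc.exists_zero_before (hb : ∀ i, 0 < D.b i)
    (hs : ∀ i, D.ps i * D.q < (2 * D.p - 1) * D.b i)
    {d e : ι} {K : ℤ} {s : Bool} (h : D.Arc d e K s) :
    ∃ z, -D.μ ≤ z ∧ z ≤ -1 ∧ D.zero d z := by
  obtain ⟨z, h0, h1, hz⟩ := D.exists_zero h.kd_r 0
  have hp := D.hp
  have hμ := D.hμp
  have hμ0 := D.hμ0
  have hl := D.len_ge
  have hK := h.K_lt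
  by_cases hc : D.p - D.μ ≤ z
  · exact ⟨z - D.p, by omega, by omega, D.zero_of_zero h.kd_r hz ⟨-1, by ring⟩⟩
  · exfalso
    have t1 : D.top d (z + D.p + D.μ) := D.top_of_zero h.kd_r hz ⟨1, by ring⟩
    have z2 : D.zero d (z + 2 * D.p) := D.zero_of_zero h.kd_r hz ⟨2, by ring⟩
    have t2 : D.top d (z + 3 * D.p + D.μ) := D.top_of_zero h.kd_r hz ⟨3, by ring⟩
    rcases lt_or_ge (z + D.p + D.μ) K with h2 | h2
    · have := h.zero_top_le' (hb _) (hs _) (by omega) (by omega) (by omega) h2 hz t1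
      omega
    · have := h.zero_top_le (hb _) (hs _) (by omega) (by omega) (by omega) (by omega) z2 t2
      omega

lemma Arc.ps_ge (hb : ∀ i, 0 < D.b i)
    (hs : ∀ i, D.ps i * D.q < (2 * D.p - 1) * D.b i)
    {d e : ι} {K : ℤ} {s : Bool} (h : D.Arc d e K s) :
    D.μ * D.b (!s) + D.p ≤ D.ps (!s) := by
  obtain ⟨z, h0, h1, hz⟩ := h.exists_zero_before hb hs
  have hp := D.hp
  have hμ := D.hμp
  have hμ0 := D.hμ0
  have hl := D.len_ge
  have hK := h.K_lt
  have z1 : D.zero d (z + D.p) := D.zero_of_zero h.kd_r hz ⟨1, by ring⟩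
  have t1 : D.top d (z + D.p + D.μ) := D.top_of_zero h.kd_r hz ⟨1, by ring⟩
  have z2 : D.zero d (z + 2 * D.p) := D.zero_of_zero h.kd_r hz ⟨2, by ring⟩
  have t2 : D.top d (z + 3 * D.p + D.μ) := D.top_of_zero h.kd_r hz ⟨3, by ring⟩
  have hlt : z + D.p + D.μ < K := by
    by_contra! h2
    have := h.zero_top_le (hb _) (hs _) (by omega) (by omega) (by omega) (by omega) z2 t2
    omega
  have hr := h.kd_r
  obtain ⟨h2, h3, h4, h5, h6⟩ := h.other.tail
  have := D.run_zero_top (l := D.len - 1) (i := z + D.p + (D.len - K))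
    (j := z + D.p + D.μ + (D.len - K)) h2 (by omega) (by omega) (by omega) (by omega) h6 h5 (by
      unfold zero; rw [it_it, add_assoc, sub_add_cancel, D.it_add_len h.kd_r]; exact z1) (by
      unfold top; rw [it_it, add_assoc, sub_add_cancel, D.it_add_len h.kd_r]; exact t1)
  linarith

lemma eq_of_dvd_sub {p a b : ℤ} (hp : 0 < p) (h : p ∣ a - b) (h1 : a < b + p) (h2 : b < a + p) :
    a = b := by
  obtain ⟨m, hm⟩ := h
  have : -1 < m := by by_contra! hc; nlinarith
  have : m < 1 := by by_contra! hc; nlinarith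
  obtain rfl : m = 0 := by omega
  linarith

/-- Wide crossings with prescribed marks. -/
lemma Vtx.top_zero_marks {d d' e e' g g' : ι} {K K' : ℤ} {s : Bool}
    (h : D.Vtx d d' e e' g g' K K' s) {y w : ℤ} (hy : D.top d y) (hy0 : 0 ≤ y) (hyp : y < D.p)
    (hw : D.zero d' w) (hw0 : w < K') (hwp : K' ≤ w + D.p) :
    D.ps s * (D.jump e - 1) + D.p ≤ (2 * D.p - y - K' + w) * D.b s := by
  obtain ⟨-, ⟨j, h1, h2, h3, h4⟩⟩ := h.after
  obtain ⟨⟨i, h5, h6, h7, h8⟩, -⟩ := h.before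
  have hp := D.hp
  have e1 : y - D.p = -1 - j := eq_of_dvd_sub (p := D.p) (by omega)
    (by
      have := D.dvd_of_x_eq h.arc.kd_r (j := -1 - j) (k := y) (hy.trans h4.symm)
      obtain ⟨m, hm⟩ := this
      exact ⟨m - 1, by linear_combination hm⟩) (by omega) (by omega)
  have e2 : w + D.p = K' - 1 - i := eq_of_dvd_sub (p := D.p) (by omega)
    (by
      obtain ⟨m, hm⟩ := D.dvd_zero_zero h.prev.kd_r h8 hw
      exact ⟨m + 1, by linear_combination hm⟩) (by omega) (by omega)
  have := h.top_zero h6 h7 h1 h3 h8 h4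
  have e3 : j - i = 2 * D.p - y - K' + w := by linarith
  rwa [e3] at this

lemma Vtx.μ_eq_one (hb : ∀ i, 0 < D.b i)
    (hs : ∀ i, D.ps i * D.q < (2 * D.p - 1) * D.b i)
    {d d' e e' g g' : ι} {K K' : ℤ} {s : Bool}
    (h : D.Vtx d d' e e' g g' K K' s) (h1 : D.c e = 1) (h2 : D.c g = 1)
    (h3 : D.c (D.it K' d') = 0) (h4 : D.c d = 0) : D.μ = 1 := by
  have j1 := h.jump_eq
  have j2 := h.jump_eq'
  rw [h1, h3] at j1
  rw [h2, h4] at j2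
  have hr := h.arc.kd_r
  have hr' := h.prev.kd_r
  have l1 := (h.lt_of_c (hb _) h1 h3 h4).1
  have l2 := (h.symm.lt_of_c (hb _) h2 (by rw [it_it, sub_add_cancel, D.it_len hr, h4]) h3).1
  have p1 := h.arc.ps_ge hb hs
  have p2 := h.prev'.ps_ge hb hs
  rw [Bool.not_not] at p2
  obtain ⟨z, z0, z1, hz⟩ := h.arc.exists_zero_before hb hs
  obtain ⟨w, w0, w1, hw⟩ := h.arc'.exists_zero_before hb hs
  have hp := D.hp
  have hμ := D.hμp
  have hμ0 := D.hμ0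
  have a1 := h.top_zero_marks (y := z + D.μ) (w := w + K')
    (D.top_of_zero hr hz ⟨0, by ring⟩) (by omega) (by omega) (by
      unfold zero at *; rw [← hw, it_it]) (by omega) (by omega)
  have a2 := h.symm.top_zero_marks (y := w + D.μ) (w := z + (D.len - K))
    (D.top_of_zero h.arc'.kd_r hw ⟨0, by ring⟩) (by omega) (by omega) (by
      unfold zero at *; rw [← hz, it_it, add_assoc, sub_add_cancel, D.it_add_len hr])
    (by omega) (by omega)
  have hq := D.hq0
  have key : ∀ {κ P b T : ℤ}, 0 < b → D.μ * b + D.p ≤ P → D.q + 1 ≤ κ →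
      P * (κ - 1) + D.p ≤ T * b → D.μ * (κ - 1) + 1 ≤ T := by
    intro κ P b T hb hP hκ hT
    by_contra! hc
    have i1 : T * b ≤ D.μ * (κ - 1) * b := mul_le_mul_of_nonneg_right (by omega) hb.le
    have i2 : (D.μ * b + D.p) * (κ - 1) ≤ P * (κ - 1) :=
      mul_le_mul_of_nonneg_right hP (by omega)
    have i3 : 0 < D.p * (κ - 1) := mul_pos (by omega) (by omega)
    nlinarith
  have b1 := key (hb _) p2 l1 a1
  have b2 := key (hb _) p1 l2 a2
  by_contra! hc
  have : 2 ≤ D.μ := by omega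
  nlinarith

lemma exists_corner (D : Diagram ι) (s : Bool) : ∃ e, D.kd e = some s ∧ D.dg e := by
  have hl := D.len_mul_N
  have hc := D.card_corners s
  have h0 := D.hps false
  have h1 := D.hps true
  have : 0 < D.N := by
    by_contra! hc
    have := mul_nonpos_of_nonneg_of_nonpos D.len_pos.le hc
    linarith
  have : (D.corners s).Nonempty := by
    rw [← Finset.card_pos]; omega
  obtain ⟨e, he⟩ := this
  exact ⟨e, (D.mem_corners).1 he⟩

lemma q_of_μ (hμ : D.μ = 1) : D.q = D.p - 1 := by
  obtain ⟨k, hk⟩ := D.hμq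
  have h1 := D.hq0
  have h2 := D.hqp
  rw [hμ] at hk
  have : 0 < k := by by_contra! hc; nlinarith
  have : k < 2 := by by_contra! hc; nlinarith
  obtain rfl : k = 1 := by omega
  linarith

lemma Arc.zero_neg_one (hb : ∀ i, 0 < D.b i)
    (hs : ∀ i, D.ps i * D.q < (2 * D.p - 1) * D.b i)
    (hμ : D.μ = 1) {d e : ι} {K : ℤ} {s : Bool} (h : D.Arc d e K s) : D.zero d (-1) := by
  obtain ⟨z, h0, h1, hz⟩ := h.exists_zero_before hb hs
  obtain rfl : z = -1 := by omega
  exact hz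

lemma Arc.length_le (hb : ∀ i, 0 < D.b i)
    (hs : ∀ i, D.ps i * D.q < (2 * D.p - 1) * D.b i)
    (hμ : D.μ = 1) {d e : ι} {K : ℤ} {s : Bool} (h : D.Arc d e K s) : K ≤ 2 * D.p := by
  have h1 := h.zero_neg_one hb hs hμ
  have hz := h.other.zero_neg_one hb hs hμ
  have h2 : D.zero d (K - 1) := by
    unfold zero at *; rw [← hz, it_it]; congr 2; ring
  obtain ⟨m, hm⟩ := D.dvd_zero_zero h.kd_r h1 h2
  by_contra! hc
  have hp := D.hp
  have hm3 : 3 ≤ m := by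
    by_contra! hc'
    have : D.p * m ≤ D.p * 2 := mul_le_mul_of_nonneg_left (by omega) (by omega)
    linarith
  have hK : 3 * D.p ≤ K := by nlinarith
  have := h.zero_top_le' (hb _) (hs _) (i := D.p - 1) (j := 2 * D.p) (by omega) (by omega)
    (by omega) (by omega) (D.zero_of_zero h.kd_r h1 ⟨1, by ring⟩)
    (D.top_of_zero h.kd_r h1 ⟨2, by rw [hμ]; ring⟩)
  omega

lemma Arc.length_eq (hb : ∀ i, 0 < D.b i)
    (hs : ∀ i, D.ps i * D.q < (2 * D.p - 1) * D.b i)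
    (hμ : D.μ = 1) {d e : ι} {K : ℤ} {s : Bool} (h : D.Arc d e K s) :
    K = 2 * D.p ∧ D.len = 4 * D.p := by
  have h1 := h.length_le hb hs hμ
  have h2 := h.other.length_le hb hs hμ
  have h3 := D.len_ge
  omega

lemma Vtx.jump_eq_p (hb : ∀ i, 0 < D.b i)
    (hs : ∀ i, D.ps i * D.q < (2 * D.p - 1) * D.b i)
    (hμ : D.μ = 1) {d d' e e' g g' : ι} {K K' : ℤ} {s : Bool}
    (h : D.Vtx d d' e e' g g' K K' s) : D.jump e = D.p := by
  have j1 := h.jump_eq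
  have hr := h.arc.kd_r
  have hr' := h.prev.kd_r
  have hq := q_of_μ hμ
  have hp := D.hp
  have z1 := h.arc.zero_neg_one hb hs hμ
  have z2 := h.arc'.zero_neg_one hb hs hμ
  have z2' : D.zero d' (K' - 1) := by
    unfold zero at *; rw [← z2, it_it]; congr 2; ring
  have t2 : D.top d' K' := D.top_of_zero hr' z2' ⟨0, by rw [hμ]; ring⟩
  have hc : D.c (D.it K' d') = 0 := by
    have := D.x_r' (d := D.it (K' - 1) d') (by simpa using hr')
    rw [it_it, add_sub_cancel] at this
    unfold zero at z2'; unfold top at t2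
    rw [z2', t2, hq] at this
    have : D.p * D.c (D.it K' d') = 0 := by linarith
    exact (mul_eq_zero.1 this).resolve_left (by omega)
  unfold zero at z1 z2'
  rw [z1, z2', hc] at j1
  rcases D.c01 e with h0 | h0
  · exfalso
    rw [h0] at j1
    obtain ⟨k1, k2⟩ := h.arc.length_eq hb hs hμ
    obtain ⟨k3, -⟩ := h.prev.length_eq hb hs hμ
    have := h.zero_top (i := -1 - D.p) (j := D.p) (by omega) (by omega) (by omega) (by omega)
      (D.top_of_zero hr' (k := K' - 1) z2' ⟨1, by rw [hμ]; ring⟩)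
      (D.zero_of_zero hr (k := -1) z1 ⟨-1, by ring⟩)
    have hq0 := D.hq0
    have := hs s
    have hP := D.hps s
    have := hb s
    rw [show D.jump e = 0 by linarith] at *
    nlinarith
  · rw [h0] at j1; linarith

lemma ps_eq (hb : ∀ i, 0 < D.b i)
    (hs : ∀ i, D.ps i * D.q < (2 * D.p - 1) * D.b i)
    (hμ : D.μ = 1) (s : Bool) : D.ps s = 2 * D.b s := by
  obtain ⟨e, he, hd⟩ := D.exists_corner s
  have step : ∀ e, D.kd e = some s → D.dg e → D.kd (D.it (2 * D.p) e) = some s ∧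
      D.dg (D.it (2 * D.p) e) ∧
      D.pot s (D.it (2 * D.p) e) = D.pot s e + (D.ps s * D.p - 2 * D.p * D.b s) := by
    intro e he hd
    obtain ⟨d, d', e', g', K, K', hv⟩ := D.exists_vtx he hd
    obtain ⟨k1, k2⟩ := hv.arc.length_eq hb hs hμ
    have hl : D.len - K = 2 * D.p := by omega
    have h1 := hv.arc.dg_end
    rw [hl] at h1
    have h2 : D.kd (D.it (2 * D.p) e) = some s := by simpa using he
    refine ⟨h2, h1, ?_⟩
    obtain ⟨d2, d2', e2', g2', K2, K2', hv2⟩ := D.exists_vtx h2 h1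
    have h3 := D.pot_succ h2
    rw [hv2.jump_eq_p hb hs hμ, it_it, neg_add_eq_sub] at h3
    have hp := D.hp
    have h4 := D.pot_run he (i := 0) (j := 2 * D.p - 1) (by omega) (fun k hk hk' =>
      hv.arc.not_dg hk (by omega))
    rw [it_zero] at h4
    rw [h3, h4]; ring
  let f : ℕ → {e : ι // D.kd e = some s ∧ D.dg e} := fun k =>
    Nat.rec ⟨e, he, hd⟩ (fun _ e => ⟨D.it (2 * D.p) e.1, (step e.1 e.2.1 e.2.2).1,
      (step e.1 e.2.1 e.2.2).2.1⟩) k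
  have := no_drift (fun e : {e : ι // D.kd e = some s ∧ D.dg e} => D.pot s e.1) f _
    (fun k => (step (f k).1 (f k).2.1 (f k).2.2).2.2)
  have hp := D.hp
  have h5 : D.p * (D.ps s - 2 * D.b s) = 0 := by linarith
  have := (mul_eq_zero.1 h5).resolve_left (by omega)
  linarith

lemma not_same_side (hb : ∀ i, 0 < D.b i) : False := by
  obtain ⟨d, d', e, e', g, g', K, K', h, h1, h2, h3, h4⟩ := D.same_side hb
  have hs : ∀ i, D.ps i * D.q < (2 * D.p - 1) * D.b i := by
    intro i
    cases i
    · exact (h.lt_of_c (hb _) h1 h3 h4).2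
    · exact (h.symm.lt_of_c (hb _) h2
        (by rw [it_it, sub_add_cancel, D.it_len h.arc.kd_r, h4]) h3).2
  have hμ := h.μ_eq_one hb hs h1 h2 h3 h4
  have e0 := ps_eq hb hs hμ false
  have e1 := ps_eq hb hs hμ true
  have hp := D.hp
  apply D.slopes
  unfold b at e0 e1
  have : 2 * D.p * (D.ps false * D.qs true) = 2 * D.p * (D.ps true * D.qs false) := by
    linear_combination D.ps true * e0 - D.ps false * e1
  exact mul_left_cancel₀ (by omega) this

/-- There is no such diagram. -/
theorem impossible (D : Diagram ι) : False := by
  have h0 : D.b false ≠ 0 := D.b_ne false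
  have h1 : D.b true ≠ 0 := D.b_ne true
  rcases lt_or_gt_of_ne h0 with h0 | h0 <;> rcases lt_or_gt_of_ne h1 with h1 | h1
  · refine D.mirror.not_same_side (fun i => ?_)
    rw [mirror_b]
    cases i <;> linarith
  · exact D.not_opposite (s := true) h1 h0
  · exact D.not_opposite (s := false) h0 h1
  · exact D.not_same_side (fun i => by cases i <;> assumption)

end Diagram

/-- The product of the labels of the entries of `L` before the first occurrence of `x`. -/
def pos {κ Γ : Type} [DecidableEq κ] [Group Γ] (l : κ → Γ) : List κ → κ → Γ
  | [], _ => 1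
  | y :: L, x => if x = y then 1 else l y * pos l L x

section
variable {κ Γ : Type} [DecidableEq κ] [Group Γ]

lemma pos_append_left (l : κ → Γ) {A : List κ} (B : List κ) {x : κ} (hx : x ∈ A) :
    pos l (A ++ B) x = pos l A x := by
  induction A with
  | nil => simp at hx
  | cons y A ih =>
    simp only [List.cons_append, pos]
    split_ifs with h
    · rfl
    · rw [ih ((List.mem_cons.1 hx).resolve_left h)]

lemma pos_append_right (l : κ → Γ) {A : List κ} (B : List κ) {x : κ} (hx : x ∉ A) :
    pos l (A ++ B) x = (A.map l).prod * pos l B x := by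
  induction A with
  | nil => simp
  | cons y A ih =>
    rw [List.mem_cons, not_or] at hx
    simp only [List.cons_append, pos, if_neg hx.1, List.map_cons, List.prod_cons, mul_assoc]
    rw [ih hx.2]

lemma pos_map {κ' : Type} [DecidableEq κ'] (f : κ' → κ) (l : κ → Γ) {L : List κ'} {x : κ'}
    (hf : ∀ y ∈ L, f x = f y → x = y) : pos l (L.map f) (f x) = pos (l ∘ f) L x := by
  induction L with
  | nil => rfl
  | cons y L ih =>
    simp only [List.map_cons, pos]
    have h1 : f x = f y ↔ x = y := ⟨hf y (by simp), fun h => by rw [h]⟩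
    simp only [h1, Function.comp_apply]
    split_ifs
    · rfl
    · rw [ih (fun z hz => hf z (by simp [hz]))]

lemma pos_congr {l l' : κ → Γ} {L : List κ} (h : ∀ x ∈ L, l x = l' x) (x : κ) :
    pos l L x = pos l' L x := by
  induction L with
  | nil => rfl
  | cons y L ih =>
    simp only [pos]
    rw [h y (by simp), ih (fun z hz => h z (by simp [hz]))]

/-- Removing a cancelling pair does not change the positions of the other entries. -/
lemma pos_remove (l : κ → Γ) {A B : List κ} {u v x : κ} (huv : l u * l v = 1)
    (hu : x ≠ u) (hv : x ≠ v) : pos l (A ++ u :: v :: B) x = pos l (A ++ B) x := by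
  by_cases hx : x ∈ A
  · rw [pos_append_left _ _ hx, pos_append_left _ _ hx]
  · rw [pos_append_right _ _ hx, pos_append_right _ _ hx]
    simp [pos, hu, hv, ← mul_assoc, huv]

lemma pos_pair (l : κ → Γ) {A B : List κ} {u v : κ} (hu : u ∉ A) (hv : v ∉ A) (huv : u ≠ v) :
    pos l (A ++ u :: v :: B) v = pos l (A ++ u :: v :: B) u * l u := by
  rw [pos_append_right _ _ hu, pos_append_right _ _ hv]
  simp [pos, huv.symm]

end

/-- The inverse letter. -/
def bar (a : Fin 2 × Bool) : Fin 2 × Bool := (a.1, !a.2)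

@[simp] lemma bar_bar (a : Fin 2 × Bool) : bar (bar a) = a := by simp [bar]

lemma bar_ne (a : Fin 2 × Bool) : bar a ≠ a := by
  intro h
  have := congrArg Prod.snd h
  simp [bar] at this

/-- A nonempty word representing the identity contains a cancelling pair. -/
lemma exists_cancel {L : List (Fin 2 × Bool)} (h : FreeGroup.mk L = 1) (hne : L ≠ []) :
    ∃ A B a, L = A ++ a :: bar a :: B := by
  by_contra! hc
  have hr : FreeGroup.IsReduced L := by
    unfold FreeGroup.IsReduced
    rw [List.isChain_iff_forall_rel_of_append_cons_cons]
    rintro ⟨x, b⟩ ⟨y, c⟩ A B hL hxy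
    simp only at hxy
    subst hxy
    by_contra hbc
    refine hc A B (x, b) ?_
    rw [hL]
    unfold bar
    cases b <;> cases c <;> simp_all
  have h1 := congrArg FreeGroup.toWord h
  rw [FreeGroup.toWord_mk, hr.reduce_eq, FreeGroup.toWord_one] at h1
  exact hne h1

/-- A planar pairing `α` of the letters of the word `L` which are fixed by `δ`; the other letters
are matched with each other by `δ` and run along auxiliary stems. -/
def Pairing {κ : Type} [DecidableEq κ] (δ : κ → κ) (lam : κ → Fin 2 × Bool) (L : List κ)
    (α : κ → κ) : Prop :=
  (∀ x ∈ L, δ x = x → α x ∈ L ∧ δ (α x) = α x ∧ α (α x) = x ∧ lam (α x) = bar (lam x)) ∧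
  ∀ (Γ : Type) [Group Γ] (l : κ → Γ), (∀ x ∈ L, δ x = x → l (α x) = (l x)⁻¹) →
    ∃ l' : κ → Γ, (∀ x ∈ L, δ x = x → l' x = l x) ∧
      (∀ x ∈ L, δ x ≠ x → l' (δ x) = (l' x)⁻¹) ∧ (L.map l').prod = 1 ∧
      ((∀ x ∈ L, δ x ≠ x → pos l' L (δ x) = pos l' L x * l' x) →
        ∀ x ∈ L, δ x = x → pos l' L (α x) = pos l' L x * l' x)

section
variable {κ : Type} [DecidableEq κ] {δ : κ → κ} {lam : κ → Fin 2 × Bool}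

/-- Folding a stem letter `s` onto a neighbour `o`, which then replaces the mate of `s`. -/
lemma Pairing.fold (hδ : ∀ x, δ (δ x) = x) {A B : List κ} {u v s o : κ}
    (hL : (A ++ u :: v :: B).Nodup) (hmem : ∀ x ∈ A ++ u :: v :: B, δ x ∈ A ++ u :: v :: B)
    (hso : (s = u ∧ o = v) ∨ (s = v ∧ o = u)) (hs : δ s ≠ s) (hne : δ s ≠ o) {α : κ → κ}
    (h : Pairing δ lam ((A ++ B).map (fun x => if x = δ s then o else x)) α) :
    Pairing δ lam (A ++ u :: v :: B) α := by
  set f : κ → κ := fun x => if x = δ s then o else x with hf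
  set L := A ++ u :: v :: B with hLdef
  set L' := (A ++ B).map f with hL'def
  have huv : u ∉ A ∧ v ∉ A ∧ u ∉ B ∧ v ∉ B ∧ u ≠ v ∧ (A ++ B).Nodup := by
    rw [hLdef] at hL
    simp only [List.nodup_append, List.nodup_cons, List.mem_cons, not_or] at hL ⊢
    grind
  obtain ⟨uA, vA, uB, vB, hne', hAB⟩ := huv
  have uAB : u ∉ A ++ B := by simp [uA, uB]
  have vAB : v ∉ A ++ B := by simp [vA, vB]
  have hmemL : ∀ x, x ∈ L ↔ x ∈ A ++ B ∨ x = s ∨ x = o := by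
    intro x; rw [hLdef]; simp only [List.mem_append, List.mem_cons]
    rcases hso with ⟨rfl, rfl⟩ | ⟨rfl, rfl⟩ <;> tauto
  have hsAB : s ∉ A ++ B := by
    rcases hso with ⟨rfl, rfl⟩ | ⟨rfl, rfl⟩ <;> assumption
  have hoAB : o ∉ A ++ B := by
    rcases hso with ⟨rfl, rfl⟩ | ⟨rfl, rfl⟩ <;> assumption
  have hos : o ≠ s := by
    rcases hso with ⟨rfl, rfl⟩ | ⟨rfl, rfl⟩
    · exact hne'.symm
    · exact hne'
  have hδs : δ s ∈ A ++ B := by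
    have := (hmemL _).1 (hmem s ((hmemL _).2 (by tauto)))
    tauto
  have hmemL' : ∀ x, x ∈ L' ↔ x ∈ L ∧ x ≠ s ∧ x ≠ δ s := by
    intro x
    rw [hL'def, List.mem_map, hmemL, hf]
    constructor
    · rintro ⟨y, hy, rfl⟩
      dsimp only
      split_ifs with h1
      · exact ⟨by tauto, hos, hne.symm⟩
      · exact ⟨by tauto, fun h2 => hsAB (h2 ▸ hy), h1⟩
    · rintro ⟨h1, h2, h3⟩
      rcases h1 with h1 | h1 | h1
      · exact ⟨x, h1, by simp [h3]⟩
      · exact absurd h1 h2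
      · exact ⟨δ s, hδs, by simp [h1]⟩
  have hδδ : ∀ x, x ∈ L' → δ x ∈ L' := by
    intro x hx
    rw [hmemL'] at hx ⊢
    exact ⟨hmem _ hx.1, fun h1 => hx.2.2 (by rw [← h1, hδ]),
      fun h1 => hx.2.1 (by rw [← hδ x, h1, hδ])⟩
  have hreal : ∀ x, x ∈ L → δ x = x → x ∈ L' := by
    intro x hx h1
    rw [hmemL']
    refine ⟨hx, fun h2 => hs (h2 ▸ h1), fun h2 => ?_⟩
    rw [h2, hδ] at h1
    exact hs h1.symm
  obtain ⟨h1, h2⟩ := h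
  refine ⟨fun x hx hx' => ?_, ?_⟩
  · obtain ⟨h3, h4⟩ := h1 x (hreal x hx hx') hx'
    exact ⟨((hmemL' _).1 h3).1, h4⟩
  intro Γ _ l hl
  obtain ⟨l1, k1, k2, k3, k4⟩ := h2 Γ l (fun x hx hx' => hl x ((hmemL' x).1 hx).1 hx')
  set l' : κ → Γ := fun x => if x = δ s then l1 o else if x = s then (l1 o)⁻¹ else l1 x with hl'
  have e1 : ∀ x ∈ L', l' x = l1 x := by
    intro x hx
    rw [hmemL'] at hx
    simp [hl', hx.2.1, hx.2.2]
  have e2 : l' (δ s) = l1 o := by simp [hl']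
  have e3 : l' s = (l1 o)⁻¹ := by simp [hl', Ne.symm hs]
  have e4 : ∀ x ∈ A ++ B, l' x = (l1 ∘ f) x := by
    intro x hx
    have : x ≠ s := fun h => hsAB (h ▸ hx)
    simp only [hl', hf, Function.comp_apply, this, if_false]
    split_ifs <;> rfl
  have e5 : l' o = l1 o := e1 o ((hmemL' o).2 ⟨(hmemL o).2 (by tauto), hos, hne.symm⟩)
  have e6 : l' u * l' v = 1 := by
    rcases hso with ⟨rfl, rfl⟩ | ⟨rfl, rfl⟩ <;> rw [e5, e3] <;> simp
  have e7 : ∀ x ∈ A ++ B, pos l1 L' (f x) = pos l' L x := by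
    intro x hx
    have hxu : x ≠ u := fun h => uAB (h ▸ hx)
    have hxv : x ≠ v := fun h => vAB (h ▸ hx)
    rw [hLdef, pos_remove l' e6 hxu hxv, pos_congr e4, hL'def, pos_map]
    intro y hy hxy
    simp only [hf] at hxy
    split_ifs at hxy with i1 i2 i2
    · rw [i1, i2]
    · exact absurd hy (hxy ▸ hoAB)
    · exact absurd hx (hxy ▸ hoAB)
    · exact hxy
  refine ⟨l', fun x hx hx' => ?_, fun x hx hx' => ?_, ?_, ?_⟩
  · rw [e1 x (hreal x hx hx'), k1 x (hreal x hx hx') hx']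
  · by_cases i1 : x = s
    · rw [i1, e2, e3, inv_inv]
    by_cases i2 : x = δ s
    · rw [i2, hδ, e2, e3]
    have := (hmemL' x).2 ⟨hx, i1, i2⟩
    rw [e1 x this, e1 _ (hδδ x this), k2 x this hx']
  · have : (L.map l').prod = ((A ++ B).map l').prod := by
      rw [hLdef]
      simp only [List.map_append, List.map_cons, List.prod_append, List.prod_cons]
      rw [← mul_assoc (l' u), e6, one_mul]
    rw [this, List.map_congr_left e4, ← List.map_map, k3]
  · intro hst
    have e8 : pos l' L (δ s) = pos l' L o := by
      rw [hst s ((hmemL s).2 (by tauto)) hs]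
      have := pos_pair (B := B) l' uA vA hne'
      rcases hso with ⟨rfl, rfl⟩ | ⟨rfl, rfl⟩
      · exact this.symm
      · rw [hLdef, this, mul_assoc, e6, mul_one]
    have e9 : ∀ x ∈ L', pos l1 L' x = pos l' L x := by
      intro x hx
      rw [hL'def, List.mem_map] at hx
      obtain ⟨y, hy, rfl⟩ := hx
      rw [e7 y hy]
      simp only [hf]
      split_ifs with i1
      · rw [i1, e8]
      · rfl
    intro x hx hx'
    have hxL' := hreal x hx hx'
    have := k4 (fun y hy hy' => by
      rw [e9 y hy, e9 _ (hδδ y hy), ← e1 y hy]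
      exact hst y ((hmemL' y).1 hy).1 hy') x hxL' hx'
    rw [e9 x hxL', e9 _ (h1 x hxL' hx').1, ← e1 x hxL'] at this
    exact this

lemma Pairing.cancel_stem (hδ : ∀ x, δ (δ x) = x) {A B : List κ} {u : κ}
    (hL : (A ++ u :: δ u :: B).Nodup)
    (hδL : ∀ x ∈ A ++ u :: δ u :: B, δ x ∈ A ++ u :: δ u :: B) {α : κ → κ}
    (h : Pairing δ lam (A ++ B) α) : Pairing δ lam (A ++ u :: δ u :: B) α := by
  have huv : u ∉ A ++ B ∧ δ u ∉ A ++ B ∧ u ≠ δ u := by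
    simp only [List.nodup_append, List.nodup_cons, List.mem_cons, not_or, List.mem_append] at hL ⊢
    grind
  obtain ⟨hu, hv, hne⟩ := huv
  have hmem : ∀ x, x ∈ A ++ u :: δ u :: B ↔ x ∈ A ++ B ∨ x = u ∨ x = δ u := by
    intro x; simp only [List.mem_append, List.mem_cons]; tauto
  have hreal : ∀ x, x ∈ A ++ u :: δ u :: B → δ x = x → x ∈ A ++ B := by
    intro x hx hx'
    rcases (hmem x).1 hx with h1 | rfl | rfl
    · exact h1
    · exact absurd hx'.symm hne
    · rw [hδ] at hx'; exact absurd hx' hne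
  obtain ⟨h1, h2⟩ := h
  refine ⟨fun x hx hx' => ?_, ?_⟩
  · obtain ⟨h3, h4⟩ := h1 x (hreal x hx hx') hx'
    exact ⟨(hmem _).2 (Or.inl h3), h4⟩
  intro Γ _ l hl
  obtain ⟨l1, k1, k2, k3, k4⟩ := h2 Γ l (fun x hx hx' => hl x ((hmem x).2 (Or.inl hx)) hx')
  set l' : κ → Γ := fun x => if x = u ∨ x = δ u then 1 else l1 x with hl'
  have e1 : ∀ x ∈ A ++ B, l' x = l1 x := by
    intro x hx
    have i1 : x ≠ u := fun h => hu (h ▸ hx)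
    have i2 : x ≠ δ u := fun h => hv (h ▸ hx)
    simp [hl', i1, i2]
  have e2 : l' u = 1 := by simp [hl']
  have e3 : l' (δ u) = 1 := by simp [hl']
  have e4 : ∀ x ∈ A ++ B, pos l' (A ++ u :: δ u :: B) x = pos l1 (A ++ B) x := by
    intro x hx
    have e5 : l' u * l' (δ u) = 1 := by rw [e2, e3, mul_one]
    have i1 : x ≠ u := fun h => hu (h ▸ hx)
    have i2 : x ≠ δ u := fun h => hv (h ▸ hx)
    rw [pos_remove l' e5 i1 i2, pos_congr e1]
  have hstem : ∀ x ∈ A ++ B, δ x ∈ A ++ u :: δ u :: B → δ x ∈ A ++ B := by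
    intro x hx h3
    rcases (hmem _).1 h3 with h4 | h4 | h4
    · exact h4
    · rw [← h4, hδ] at hv; exact absurd hx hv
    · rw [← hδ x, h4, hδ] at hx; exact absurd hx hu
  refine ⟨l', fun x hx hx' => ?_, fun x hx hx' => ?_, ?_, ?_⟩
  · rw [e1 x (hreal x hx hx'), k1 x (hreal x hx hx') hx']
  · rcases (hmem x).1 hx with i1 | rfl | rfl
    · rw [e1 x i1, e1 _ (hstem x i1 (hδL x hx)), k2 x i1 hx']
    · rw [e2, e3, inv_one]
    · rw [hδ, e2, e3, inv_one]
  · have : (A ++ B).map l' = (A ++ B).map l1 := List.map_congr_left e1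
    rw [← k3, ← this]
    simp only [List.map_append, List.map_cons, List.prod_append, List.prod_cons]
    rw [e2, e3, one_mul, one_mul]
  · intro hst x hx hx'
    have hxL' := hreal x hx hx'
    have := k4 (fun y hy hy' => by
      have hy2 := (hmem y).2 (Or.inl hy)
      have h3 := hstem y hy (hδL y hy2)
      rw [← e4 y hy, ← e4 _ h3, ← e1 y hy]
      exact hst y hy2 hy') x hxL' hx'
    rw [e4 x hxL', e4 _ (h1 x hxL' hx').1, e1 x hxL', this]

/-- Two adjacent letters which are inverse to each other may be matched. -/
lemma Pairing.cancel_real {A B : List κ} {u v : κ} (hL : (A ++ u :: v :: B).Nodup)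
    (hδu : δ u = u) (hδv : δ v = v) (huv : lam v = bar (lam u)) {α : κ → κ}
    (hδ2 : ∀ x ∈ A ++ B, δ x ≠ x → δ x ∈ A ++ B)
    (h : Pairing δ lam (A ++ B) α) :
    Pairing δ lam (A ++ u :: v :: B) (fun x => if x = u then v else if x = v then u else α x) := by
  have huv' : u ∉ A ++ B ∧ v ∉ A ++ B ∧ u ≠ v ∧ u ∉ A ∧ v ∉ A := by
    simp only [List.nodup_append, List.nodup_cons, List.mem_cons, not_or, List.mem_append] at hL ⊢
    grind
  obtain ⟨hu, hv, hne, hu', hv'⟩ := huv'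
  have hmem : ∀ x, x ∈ A ++ u :: v :: B ↔ x ∈ A ++ B ∨ x = u ∨ x = v := by
    intro x; simp only [List.mem_append, List.mem_cons]; tauto
  set α' : κ → κ := fun x => if x = u then v else if x = v then u else α x with hα'
  have a1 : α' u = v := by simp [hα']
  have a2 : α' v = u := by simp [hα', hne.symm]
  have a3 : ∀ x ∈ A ++ B, α' x = α x := by
    intro x hx
    have i1 : x ≠ u := fun h => hu (h ▸ hx)
    have i2 : x ≠ v := fun h => hv (h ▸ hx)
    simp [hα', i1, i2]
  obtain ⟨h1, h2⟩ := h
  refine ⟨fun x hx hx' => ?_, ?_⟩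
  · rcases (hmem x).1 hx with i1 | rfl | rfl
    · obtain ⟨h3, h4, h5, h6⟩ := h1 x i1 hx'
      rw [a3 x i1, a3 _ h3]
      exact ⟨(hmem _).2 (Or.inl h3), h4, h5, h6⟩
    · rw [a1, a2]
      exact ⟨(hmem _).2 (by tauto), hδv, rfl, by assumption⟩
    · rw [a2, a1]
      exact ⟨(hmem _).2 (by tauto), hδu, rfl, by simp [*]⟩
  intro Γ _ l hl
  obtain ⟨l1, k1, k2, k3, k4⟩ := h2 Γ l (fun x hx hx' => by
    rw [← a3 x hx]; exact hl x ((hmem x).2 (Or.inl hx)) hx')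
  have luv : l v = (l u)⁻¹ := by
    have := hl u ((hmem u).2 (by tauto)) hδu
    rwa [a1] at this
  set l' : κ → Γ := fun x => if x = u ∨ x = v then l x else l1 x with hl'
  have e1 : ∀ x ∈ A ++ B, l' x = l1 x := by
    intro x hx
    have i1 : x ≠ u := fun h => hu (h ▸ hx)
    have i2 : x ≠ v := fun h => hv (h ▸ hx)
    simp [hl', i1, i2]
  have e2 : l' u = l u := by simp [hl']
  have e3 : l' v = (l u)⁻¹ := by simp [hl', luv]
  have e5 : l' u * l' v = 1 := by rw [e2, e3, mul_inv_cancel]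
  have e4 : ∀ x ∈ A ++ B, pos l' (A ++ u :: v :: B) x = pos l1 (A ++ B) x := by
    intro x hx
    have i1 : x ≠ u := fun h => hu (h ▸ hx)
    have i2 : x ≠ v := fun h => hv (h ▸ hx)
    rw [pos_remove l' e5 i1 i2, pos_congr e1]
  have hstem : ∀ x ∈ A ++ u :: v :: B, δ x ≠ x → x ∈ A ++ B := by
    intro x hx h3
    rcases (hmem _).1 hx with h4 | rfl | rfl
    · exact h4
    · exact absurd hδu h3
    · exact absurd hδv h3
  refine ⟨l', fun x hx hx' => ?_, fun x hx hx' => ?_, ?_, ?_⟩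
  · rcases (hmem x).1 hx with i1 | rfl | rfl
    · rw [e1 x i1, k1 x i1 hx']
    · rw [e2]
    · rw [e3, luv]
  · have i1 := hstem x hx hx'
    rw [e1 x i1, e1 _ (hδ2 x i1 hx'), k2 x i1 hx']
  · have : (A ++ B).map l' = (A ++ B).map l1 := List.map_congr_left e1
    rw [← k3, ← this]
    simp only [List.map_append, List.map_cons, List.prod_append, List.prod_cons]
    rw [← mul_assoc (l' u), e5, one_mul]
  · intro hst x hx hx'
    have hp := pos_pair (B := B) l' hu' hv' hne
    rcases (hmem x).1 hx with i1 | rfl | rfl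
    · have := k4 (fun y hy hy' => by
        have h3 := hδ2 y hy hy'
        rw [← e4 y hy, ← e4 _ h3, ← e1 y hy]
        exact hst y ((hmem y).2 (Or.inl hy)) hy') x i1 hx'
      rw [a3 x i1, e4 x i1, e4 _ (h1 x i1 hx').1, e1 x i1, this]
    · rw [a1, hp]
    · rw [a2, hp, mul_assoc, e5, mul_one]

/-- Every word representing the identity has a planar pairing. -/
theorem exists_pairing (hδ : ∀ x, δ (δ x) = x) (hlam : ∀ x, δ x ≠ x → lam (δ x) = bar (lam x))
    {L : List κ} (hL : L.Nodup) (hLδ : ∀ x ∈ L, δ x ∈ L) (h1 : FreeGroup.mk (L.map lam) = 1) :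
    ∃ α, Pairing δ lam L α := by
  induction hn : L.length using Nat.strong_induction_on generalizing L with
  | _ N ih =>
  subst hn
  rcases eq_or_ne L [] with rfl | hne
  · exact ⟨id, by simp, fun Γ _ l _ => ⟨l, by simp⟩⟩
  obtain ⟨A', B', a, hab⟩ := exists_cancel h1 (by simpa using hne)
  obtain ⟨A, L₂, rfl, rfl, h2⟩ := List.map_eq_append_iff.1 hab
  obtain ⟨u, L₃, rfl, hu, h3⟩ := List.map_eq_cons_iff.1 h2
  obtain ⟨v, B, rfl, hv, rfl⟩ := List.map_eq_cons_iff.1 h3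
  rw [← hu] at hv
  have hAB1 : FreeGroup.mk ((A ++ B).map lam) = 1 := by
    rw [← h1, List.map_append, List.map_append, List.map_cons, List.map_cons, hv]
    symm
    apply Quot.sound
    exact FreeGroup.Red.Step.not
  have hlt : ∀ L' : List κ, L'.length = (A ++ B).length →
      L'.length < (A ++ u :: v :: B).length := by
    intro L' h; rw [h]; simp
  have huv : u ∉ A ∧ v ∉ A ∧ u ∉ B ∧ v ∉ B ∧ u ≠ v ∧ (A ++ B).Nodup := by
    simp only [List.nodup_append, List.nodup_cons, List.mem_cons, not_or] at hL ⊢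
    grind
  obtain ⟨uA, vA, uB, vB, hne', hAB⟩ := huv
  have uAB : u ∉ A ++ B := by simp [uA, uB]
  have vAB : v ∉ A ++ B := by simp [vA, vB]
  have hmemL : ∀ x, x ∈ A ++ u :: v :: B ↔ x ∈ A ++ B ∨ x = u ∨ x = v := by
    intro x; simp only [List.mem_append, List.mem_cons]; tauto
  have key : ∀ s o, ((s = u ∧ o = v) ∨ (s = v ∧ o = u)) → δ s ≠ s → δ s ≠ o →
      ∃ α, Pairing δ lam (A ++ u :: v :: B) α := by
    intro s o hso hs hso'
    have hlo : lam o = bar (lam s) := by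
      rcases hso with ⟨rfl, rfl⟩ | ⟨rfl, rfl⟩
      · exact hv
      · rw [hv, bar_bar]
    have hos : o ≠ s := by
      rcases hso with ⟨rfl, rfl⟩ | ⟨rfl, rfl⟩
      · exact hne'.symm
      · exact hne'
    have hso2 : ∀ x, x ∈ A ++ u :: v :: B ↔ x ∈ A ++ B ∨ x = s ∨ x = o := by
      intro x; rw [hmemL]
      rcases hso with ⟨rfl, rfl⟩ | ⟨rfl, rfl⟩ <;> tauto
    have hsAB : s ∉ A ++ B := by
      rcases hso with ⟨rfl, rfl⟩ | ⟨rfl, rfl⟩ <;> assumption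
    have hoAB : o ∉ A ++ B := by
      rcases hso with ⟨rfl, rfl⟩ | ⟨rfl, rfl⟩ <;> assumption
    have hmemL' : ∀ x, x ∈ (A ++ B).map (fun x => if x = δ s then o else x) ↔
        x ∈ A ++ u :: v :: B ∧ x ≠ s ∧ x ≠ δ s := by
      intro x
      have hδs : δ s ∈ A ++ B := by
        have := (hso2 _).1 (hLδ s ((hso2 _).2 (by tauto)))
        tauto
      rw [List.mem_map, hso2]
      constructor
      · rintro ⟨y, hy, rfl⟩
        split_ifs with i1
        · exact ⟨by tauto, hos, hso'.symm⟩
        · exact ⟨by tauto, fun h2 => hsAB (h2 ▸ hy), i1⟩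
      · rintro ⟨i1, i2, i3⟩
        rcases i1 with i1 | i1 | i1
        · exact ⟨x, i1, by simp [i3]⟩
        · exact absurd i1 i2
        · exact ⟨δ s, hδs, by simp [i1]⟩
    obtain ⟨α, hα⟩ := ih _ (hlt ((A ++ B).map (fun x => if x = δ s then o else x)) (by simp))
      (L := (A ++ B).map (fun x => if x = δ s then o else x))
      (by
        refine (List.nodup_map_iff_inj_on hAB).2 fun x hx y hy hxy => ?_
        split_ifs at hxy with i1 i2 i2
        · rw [i1, i2]
        · exact absurd hy (hxy ▸ hoAB)
        · exact absurd hx (hxy ▸ hoAB)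
        · exact hxy)
      (by
        intro x hx
        rw [hmemL'] at hx ⊢
        exact ⟨hLδ _ hx.1, fun i1 => hx.2.2 (by rw [← i1, hδ]),
          fun i1 => hx.2.1 (by rw [← hδ x, i1, hδ])⟩)
      (by
        rw [← hAB1, List.map_map]
        congr 1
        refine List.map_congr_left fun x _ => ?_
        simp only [Function.comp_apply]
        split_ifs with i1
        · rw [i1, hlo, hlam s hs]
        · rfl) rfl
    exact ⟨α, Pairing.fold hδ hL hLδ hso hs hso' hα⟩
  by_cases hδu : δ u = u
  · by_cases hδv : δ v = v
    · have hcl : ∀ x ∈ A ++ B, δ x ∈ A ++ B := by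
        intro x hx
        rcases (hmemL _).1 (hLδ x ((hmemL x).2 (Or.inl hx))) with i1 | i1 | i1
        · exact i1
        · rw [← hδ x, i1, hδu] at hx; exact absurd hx uAB
        · rw [← hδ x, i1, hδv] at hx; exact absurd hx vAB
      obtain ⟨α, hα⟩ := ih _ (hlt (A ++ B) rfl) hAB hcl hAB1 rfl
      exact ⟨_, Pairing.cancel_real hL hδu hδv hv (fun x hx _ => hcl x hx) hα⟩
    · exact key v u (Or.inr ⟨rfl, rfl⟩) hδv (fun h => hne' (by rw [← hδu, ← h, hδ]))
  · by_cases hδuv : δ u = v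
    · subst hδuv
      have hcl : ∀ x ∈ A ++ B, δ x ∈ A ++ B := by
        intro x hx
        rcases (hmemL _).1 (hLδ x ((hmemL x).2 (Or.inl hx))) with i1 | i1 | i1
        · exact i1
        · rw [← hδ x, i1] at hx; exact absurd hx vAB
        · rw [← hδ x, i1, hδ] at hx; exact absurd hx uAB
      obtain ⟨α, hα⟩ := ih _ (hlt (A ++ B) rfl) hAB hcl hAB1 rfl
      exact ⟨α, Pairing.cancel_stem hδ hL hLδ hα⟩
    · exact key u v (Or.inl ⟨rfl, rfl⟩) hδu hδuv

end

section
variable {κ Γ : Type} [DecidableEq κ] [Group Γ]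

/-- Positions along a stem and along the reversed stem agree. -/
lemma pos_reverse (l : κ → Γ) (δ : κ → κ) {T : List κ} (hinj : ((T.map δ)).Nodup) {x : κ}
    (hx : x ∈ T) (hl : ∀ y ∈ T, l (δ y) = (l y)⁻¹) (hT : T.Nodup) :
    (T.map l).prod * pos l (T.map δ).reverse (δ x) = pos l T x * l x := by
  have hrev : ∀ T : List κ, (∀ y ∈ T, l (δ y) = (l y)⁻¹) →
      ((T.map δ).reverse.map l).prod = ((T.map l).prod)⁻¹ := by
    intro T
    induction T with
    | nil => simp
    | cons y T ih =>
      intro h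
      rw [List.map_cons, List.reverse_cons, List.map_append, List.prod_append,
        ih (fun z hz => h z (by simp [hz]))]
      simp [h y (by simp)]
  induction T with
  | nil => simp at hx
  | cons y T ih =>
    rw [List.map_cons, List.nodup_cons] at hinj
    rw [List.nodup_cons] at hT
    have hl' : ∀ z ∈ T, l (δ z) = (l z)⁻¹ := fun z hz => hl z (by simp [hz])
    simp only [List.map_cons, List.prod_cons, List.reverse_cons, pos]
    split_ifs with hxy
    · subst hxy
      rw [pos_append_right _ _ (by simpa using hinj.1), hrev T hl']
      simp [pos, mul_assoc]
    · have hxT := (List.mem_cons.1 hx).resolve_left hxy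
      rw [pos_append_left _ _ (by simpa using ⟨x, hxT, rfl⟩), mul_assoc, ih hinj.2 hxT hl' hT.2,
        mul_assoc]

lemma pos_ofFn (l : κ → Γ) {n : ℕ} (f : Fin n → κ) (hf : Function.Injective f) (k : Fin n) :
    pos l (List.ofFn f) (f k) = ((List.ofFn (l ∘ f)).take k).prod := by
  induction n with
  | zero => exact k.elim0
  | succ n ih =>
    rw [List.ofFn_succ, List.ofFn_succ]
    refine Fin.cases ?_ (fun k => ?_) k
    · simp [pos]
    · simp only [pos, hf.eq_iff, Fin.succ_ne_zero, if_false, Fin.val_succ, List.take_succ_cons,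
        List.prod_cons]
      rw [ih (fun j => f j.succ) (fun a b h => by simpa using hf h) k]
      rfl

lemma pos_flatMap {J : Type} (l : κ → Γ) (seg : J → List κ)
    {T : List J} {i : J} {x : κ} (hi : i ∈ T) (hx : ∀ j, x ∈ seg j ↔ j = i) :
    ∃ a : Γ, ∀ y, (∀ j, y ∈ seg j ↔ j = i) → pos l (T.flatMap seg) y = a * pos l (seg i) y := by
  induction T with
  | nil => simp at hi
  | cons j T ih =>
    by_cases hj : j = i
    · subst hj
      refine ⟨1, fun y hy => ?_⟩
      rw [List.flatMap_cons, pos_append_left _ _ ((hy _).2 rfl), one_mul]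
    · obtain ⟨a, ha⟩ := ih ((List.mem_cons.1 hi).resolve_left (Ne.symm hj))
      refine ⟨((seg j).map l).prod * a, fun y hy => ?_⟩
      rw [List.flatMap_cons, pos_append_right _ _ (fun h => hj ((hy _).1 h)), ha y hy, mul_assoc]

end

section
variable {m : ℕ} (len glen : Fin m → ℕ)

/-- Face letters and stem letters. -/
abbrev Slot : Type := (Σ i, Fin (len i)) ⊕ (Σ i, Fin (glen i) × Bool)

variable {len glen}

/-- The two occurrences of a stem letter are exchanged. -/
def Slot.flip : Slot len glen → Slot len glen
  | .inl x => .inl x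
  | .inr ⟨i, k, b⟩ => .inr ⟨i, k, !b⟩

lemma Slot.flip_flip (x : Slot len glen) : x.flip.flip = x := by
  rcases x with x | ⟨i, k, b⟩ <;> simp [Slot.flip]

/-- The outgoing stem of a face. -/
def Slot.stem (i : Fin m) : List (Slot len glen) := List.ofFn fun k => .inr ⟨i, k, true⟩

/-- The boundary of a face. -/
def Slot.face (i : Fin m) : List (Slot len glen) := List.ofFn fun k => .inl ⟨i, k⟩

/-- A face with its stem. -/
def Slot.seg (i : Fin m) : List (Slot len glen) :=
  Slot.stem i ++ (Slot.face i ++ ((Slot.stem i).map Slot.flip).reverse)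

lemma Slot.mem_seg (x : Slot len glen) (i : Fin m) :
    x ∈ Slot.seg i ↔ i = (match x with | .inl y => y.1 | .inr y => y.1) := by
  simp only [Slot.seg, Slot.stem, Slot.face, List.mem_append, List.mem_reverse, List.mem_map,
    List.mem_ofFn]
  constructor
  · rintro (⟨k, rfl⟩ | ⟨k, rfl⟩ | ⟨_, ⟨k, rfl⟩, rfl⟩) <;> rfl
  · intro h
    subst h
    rcases x with ⟨i, k⟩ | ⟨i, k, b⟩
    · exact Or.inr (Or.inl ⟨k, rfl⟩)
    · cases b
      · exact Or.inr (Or.inr ⟨_, ⟨k, rfl⟩, rfl⟩)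
      · exact Or.inl ⟨k, rfl⟩

lemma Slot.nodup_stem (i : Fin m) : (Slot.stem i : List (Slot len glen)).Nodup :=
  List.nodup_ofFn.2 fun a b h => by simpa using h

lemma Slot.nodup_face (i : Fin m) : (Slot.face i : List (Slot len glen)).Nodup :=
  List.nodup_ofFn.2 fun a b h => by simpa using h

lemma Slot.nodup_seg (i : Fin m) : (Slot.seg i : List (Slot len glen)).Nodup := by
  rw [Slot.seg, List.nodup_append, List.nodup_append]
  refine ⟨nodup_stem i, ⟨nodup_face i, ?_, ?_⟩, ?_⟩
  · exact List.nodup_reverse.2 ((nodup_stem i).map fun a b h => by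
      rw [← flip_flip a, h, flip_flip])
  · simp [stem, face, flip, List.mem_ofFn]
  · simp [stem, face, flip, List.mem_ofFn]

lemma Slot.nodup_flatMap :
    ((List.finRange m).flatMap (Slot.seg (len := len) (glen := glen))).Nodup := by
  rw [List.nodup_flatMap]
  refine ⟨fun i _ => nodup_seg i, (List.nodup_finRange m).imp fun {i j} hij => ?_⟩
  intro x hx hx'
  rw [mem_seg] at hx hx'
  exact hij (hx.trans hx'.symm)

lemma Slot.prod_seg {Γ : Type} [Group Γ] (l : Slot len glen → Γ)
    (hl : ∀ x : Slot len glen, x.flip ≠ x → l x.flip = (l x)⁻¹) (i : Fin m) :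
    ((Slot.seg i).map l).prod = ((Slot.stem i).map l).prod *
      (List.ofFn fun k => l (.inl ⟨i, k⟩)).prod * (((Slot.stem i).map l).prod)⁻¹ := by
  have h : ∀ T : List (Slot len glen), (∀ x ∈ T, x.flip ≠ x) →
      ((T.map flip).reverse.map l).prod = ((T.map l).prod)⁻¹ := by
    intro T
    induction T with
    | nil => simp
    | cons y T ih =>
      intro h
      rw [List.map_cons, List.reverse_cons, List.map_append, List.prod_append,
        ih (fun z hz => h z (by simp [hz]))]
      simp [hl y (h y (by simp))]
  rw [seg, List.map_append, List.map_append, List.prod_append, List.prod_append, h, mul_assoc]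
  · congr 3
    simp [face, List.map_ofFn, Function.comp_def]
  · intro x hx
    simp only [stem, List.mem_ofFn] at hx
    obtain ⟨k, rfl⟩ := hx
    simp [flip]

/-- A product of conjugates of words which is trivial in the free group gives rise to a
pairing of the letters of these words for which the surface obtained from polygons is a sphere. -/
theorem exists_spherical (len : Fin m → ℕ) (lam : (Σ i, Fin (len i)) → Fin 2 × Bool)
    (g : Fin m → List (Fin 2 × Bool))
    (h : ((List.finRange m).map fun i => FreeGroup.mk (g i) *
      FreeGroup.mk (List.ofFn fun k => lam ⟨i, k⟩) * (FreeGroup.mk (g i))⁻¹).prod = 1) :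
    ∃ α : (Σ i, Fin (len i)) → (Σ i, Fin (len i)), (∀ x, α (α x) = x) ∧
      (∀ x, lam (α x) = bar (lam x)) ∧
      ∀ (Γ : Type) [Group Γ] (l : (Σ i, Fin (len i)) → Γ), (∀ x, l (α x) = (l x)⁻¹) →
        (∃ t : Fin m → Γ, ((List.finRange m).map fun i => t i *
          (List.ofFn fun k => l ⟨i, k⟩).prod * (t i)⁻¹).prod = 1) ∧
        ((∀ i, (List.ofFn fun k => l ⟨i, k⟩).prod = 1) →
          ∃ t : (Σ i, Fin (len i)) → Γ,
            (∀ x, t (Equiv.sigmaCongrRight (fun i => finRotate (len i)) x) = t x * l x) ∧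
            ∀ x, t (α x) = t x * l x) := by
  set glen : Fin m → ℕ := fun i => (g i).length with hglen
  set lamK : Slot len glen → Fin 2 × Bool := fun x => match x with
    | .inl y => lam y
    | .inr ⟨i, k, b⟩ => if b then (g i)[k] else bar ((g i)[k]) with hlamK
  set L : List (Slot len glen) := (List.finRange m).flatMap Slot.seg with hL
  have hmem : ∀ x, x ∈ L := by
    intro x
    rw [hL, List.mem_flatMap]
    exact ⟨_, List.mem_finRange _, (Slot.mem_seg x _).2 rfl⟩
  have hlam : ∀ x, Slot.flip x ≠ x → lamK (Slot.flip x) = bar (lamK x) := by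
    rintro (x | ⟨i, k, b⟩) hx
    · exact absurd rfl hx
    · cases b <;> simp [hlamK, Slot.flip]
  have hprod : ∀ T : List (Slot len glen),
      FreeGroup.mk (T.map lamK) = (T.map fun x => FreeGroup.mk [lamK x]).prod := by
    intro T
    induction T with
    | nil => simp [FreeGroup.one_eq_mk]
    | cons y T ih =>
      rw [List.map_cons, List.map_cons, List.prod_cons, ← ih, FreeGroup.mul_mk]
      rfl
  have h1 : FreeGroup.mk (L.map lamK) = 1 := by
    rw [← h, hprod, hL, List.map_flatMap, List.flatMap_def, List.prod_flatten, List.map_map]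
    congr 1
    refine List.map_congr_left fun i _ => ?_
    rw [Function.comp_apply, Slot.prod_seg (fun x => FreeGroup.mk [lamK x])]
    · have e1 : ((Slot.stem i : List (Slot len glen)).map fun x => FreeGroup.mk [lamK x]).prod
          = FreeGroup.mk (g i) := by
        rw [← hprod]
        congr 1
        rw [Slot.stem, List.map_ofFn]
        exact List.ofFn_getElem
      have e2 : (List.ofFn fun k => FreeGroup.mk [lamK (.inl ⟨i, k⟩)]).prod =
          FreeGroup.mk (List.ofFn fun k => lam ⟨i, k⟩) := by
        have := hprod (Slot.face i)
        rw [Slot.face, List.map_ofFn, List.map_ofFn] at this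
        exact this.symm
      rw [e1, e2]
    · intro x hx
      rw [hlam x hx, FreeGroup.inv_mk]
      rfl
  obtain ⟨β, hβ, hβ'⟩ := exists_pairing (δ := Slot.flip) (lam := lamK) Slot.flip_flip hlam
    (Slot.nodup_flatMap) (fun x _ => hmem _) h1
  have hα : ∀ x, ∃ y, β (.inl x) = .inl y := by
    intro x
    have := (hβ (.inl x) (hmem _) rfl).2.1
    rcases hy : β (.inl x) with y | ⟨i, k, b⟩
    · exact ⟨y, rfl⟩
    · rw [hy] at this
      simp [Slot.flip] at this
  choose α hα using hα
  refine ⟨α, fun x => ?_, fun x => ?_, fun Γ _ l hl => ?_⟩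
  · have := (hβ (.inl x) (hmem _) rfl).2.2.1
    rw [hα, hα] at this
    exact Sum.inl_injective this
  · have := (hβ (.inl x) (hmem _) rfl).2.2.2
    rw [hα] at this
    exact this
  have hreal : ∀ x : Slot len glen, x.flip = x → ∃ y, x = .inl y := by
    rintro (y | ⟨i, k, b⟩) hx
    · exact ⟨y, rfl⟩
    · simp [Slot.flip] at hx
  obtain ⟨l', k1, k2, k3, k4⟩ := hβ' Γ (Sum.elim l fun _ => 1) (by
    intro x _ hx
    obtain ⟨y, rfl⟩ := hreal x hx
    rw [hα]
    exact hl y)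
  have k1' : ∀ x, l' (.inl x) = l x := fun x => k1 (.inl x) (hmem _) rfl
  have k2' : ∀ x : Slot len glen, x.flip ≠ x → l' x.flip = (l' x)⁻¹ := fun x hx => k2 x (hmem _) hx
  refine ⟨⟨fun i => ((Slot.stem i).map l').prod, ?_⟩, fun hface => ?_⟩
  · rw [← k3, List.map_flatMap, List.flatMap_def, List.prod_flatten, List.map_map]
    congr 1
    refine List.map_congr_left fun i _ => ?_
    rw [Function.comp_apply, Slot.prod_seg l' k2']
    simp [k1']
  have hseg : ∀ i, ∃ a : Γ, ∀ y : Slot len glen, y ∈ Slot.seg i →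
      pos l' L y = a * pos l' (Slot.seg i) y := by
    intro i
    by_cases hi : ∃ y : Slot len glen, y ∈ Slot.seg i
    · obtain ⟨y, hy⟩ := hi
      have hz : ∀ z : Slot len glen, z ∈ Slot.seg i → ∀ j, z ∈ Slot.seg j ↔ j = i := by
        intro z hz j
        rw [Slot.mem_seg] at hz ⊢
        rw [← hz]
      obtain ⟨a, ha⟩ := pos_flatMap l' Slot.seg (List.mem_finRange i) (hz y hy)
      exact ⟨a, fun z h => ha z (hz z h)⟩
    · exact ⟨1, fun y hy => absurd ⟨y, hy⟩ hi⟩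
  choose a ha using hseg
  have hstem : ∀ i k, pos l' (Slot.seg i) (.inr ⟨i, k, false⟩) =
      pos l' (Slot.seg i) (.inr ⟨i, k, true⟩) * l' (.inr ⟨i, k, true⟩) := by
    intro i k
    have hW : ((Slot.face i).map l').prod = 1 := by
      rw [← hface i, Slot.face, List.map_ofFn]
      simp [Function.comp_def, k1']
    have hk : (.inr ⟨i, k, true⟩ : Slot len glen) ∈ Slot.stem i := by simp [Slot.stem]
    rw [Slot.seg, pos_append_left _ _ hk, pos_append_right _ _ (by simp [Slot.stem, List.mem_ofFn]),
      pos_append_right _ _ (by simp [Slot.face, List.mem_ofFn]), hW, one_mul,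
      ← pos_reverse l' Slot.flip _ hk _ (Slot.nodup_stem i)]
    · rfl
    · exact (Slot.nodup_stem i).map fun a b h => by
        rw [← Slot.flip_flip a, h, Slot.flip_flip]
    · intro y hy
      refine k2' y ?_
      simp only [Slot.stem, List.mem_ofFn] at hy
      obtain ⟨k, rfl⟩ := hy
      simp [Slot.flip]
  have k5 := k4 (by
    rintro (x | ⟨i, k, b⟩) - hx
    · exact absurd rfl hx
    · have e1 := ha i (.inr ⟨i, k, true⟩) ((Slot.mem_seg _ _).2 rfl)
      have e2 := ha i (.inr ⟨i, k, false⟩) ((Slot.mem_seg _ _).2 rfl)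
      have e3 : pos l' L (.inr ⟨i, k, false⟩) = pos l' L (.inr ⟨i, k, true⟩) *
          l' (.inr ⟨i, k, true⟩) := by
        rw [e1, e2, hstem, mul_assoc]
      cases b
      · have e4 := k2' (.inr ⟨i, k, true⟩) (by simp [Slot.flip])
        have e5 : l' (.inr ⟨i, k, false⟩) = (l' (.inr ⟨i, k, true⟩))⁻¹ := e4
        change pos l' L (.inr ⟨i, k, true⟩) = _
        rw [e3, e5, mul_inv_cancel_right]
      · exact e3)
  refine ⟨fun x => pos l' L (.inl x), fun x => ?_, fun x => ?_⟩
  · obtain ⟨i, k⟩ := x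
    have e1 : ∀ k, pos l' L (.inl ⟨i, k⟩) = a i * (((Slot.stem i).map l').prod *
        ((List.ofFn (fun k => l ⟨i, k⟩)).take k).prod) := by
      intro k
      rw [ha i _ ((Slot.mem_seg _ _).2 rfl), Slot.seg,
        pos_append_right _ _ (by simp [Slot.stem, List.mem_ofFn]),
        pos_append_left _ _ (by simp [Slot.face, List.mem_ofFn]), Slot.face,
        pos_ofFn l' _ (fun a b h => by simpa using h) k]
      simp [Function.comp_def, k1']
    change pos l' L (.inl ⟨i, finRotate _ k⟩) = pos l' L (.inl ⟨i, k⟩) * l ⟨i, k⟩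
    rw [e1, e1, mul_assoc, mul_assoc]
    congr 2
    have e2 : ((List.ofFn fun k => l ⟨i, k⟩).take k).prod * l ⟨i, k⟩ =
        ((List.ofFn fun k => l ⟨i, k⟩).take (k + 1)).prod := by
      rw [List.prod_take_succ _ _ (by simp)]
      simp
    rw [e2]
    have hi := hface i
    generalize (fun k => l ⟨i, k⟩) = w at *
    clear e1 e2
    generalize len i = n at *
    cases n with
    | zero => exact k.elim0
    | succ n =>
      rw [coe_finRotate]
      split_ifs with hk
      · have : (List.ofFn w).take (k + 1) = List.ofFn w := List.take_of_length_le (by simp [hk])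
        rw [this, hi, List.take_zero, List.prod_nil]
      · rfl
  · have := k5 (.inl x) (hmem _) rfl
    rw [hα, k1'] at this
    exact this

end

lemma perm_inv_apply {ι : Type} (f : Equiv.Perm ι) (x : ι) : f⁻¹ (f x) = x :=
  f.symm_apply_apply x

lemma perm_apply_inv {ι : Type} (f : Equiv.Perm ι) (x : ι) : f (f⁻¹ x) = x :=
  f.apply_symm_apply x

section
variable {ι O J : Type} [Fintype ι] [DecidableEq ι] [DecidableEq O] [Fintype J] [DecidableEq J]

/-- The Euler inequality for a union `Z` of components of a planar surface: every closed
antisymmetric cochain is exact (`hX`), hence there are many vertices. -/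
lemma card_vertices_ge (φ α : Equiv.Perm ι) (hα : ∀ x, α (α x) = x) (sgn : ι → Bool)
    (hsgn : ∀ x, sgn (α x) = !sgn x) (o : ι → O)
    (ho : ∀ t : ι → ℚ, (∀ x, t (φ x) = t (α x)) → ∀ x y, o x = o y → t x = t y)
    (fc : ι → J)
    (hX : ∀ l : ι → ℚ, (∀ x, l (α x) = - l x) → (∀ j, ∑ x with fc x = j, l x = 0) →
      ∃ t : ι → ℚ, (∀ x, t (φ x) = t x + l x) ∧ ∀ x, t (α x) = t x + l x)
    {Z : Finset ι} (hZ : Z.Nonempty) (hφZ : ∀ d ∈ Z, φ d ∈ Z) (hαZ : ∀ d ∈ Z, α d ∈ Z) :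
    Z.card + 4 ≤ 2 * ((Z.image o).card + (Z.image fc).card) := by
  obtain ⟨x0, hx0⟩ := hZ
  set P := Z.filter (fun x => sgn x = true) with hP
  have hPcard : 2 * P.card = Z.card := by
    rw [← Finset.card_filter_add_card_filter_not (s := Z) (fun x => sgn x = true), two_mul]
    congr 1
    refine Finset.card_bij (fun x _ => α x) ?_ ?_ ?_
    · intro x hx
      rw [hP, Finset.mem_filter] at hx
      rw [Finset.mem_filter, hsgn, hx.2]
      exact ⟨hαZ x hx.1, by simp⟩
    · intro x _ y _ h
      exact α.injective h
    · intro y hy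
      rw [Finset.mem_filter] at hy
      refine ⟨α y, ?_, hα y⟩
      rw [hP, Finset.mem_filter, hsgn]
      exact ⟨hαZ y hy.1, by simpa using hy.2⟩
  set O' := (Z.image o).erase (o x0)
  set J' := (Z.image fc).erase (fc x0)
  have hO' : O'.card + 1 = (Z.image o).card :=
    Finset.card_erase_add_one (Finset.mem_image_of_mem _ hx0)
  have hJ' : J'.card + 1 = (Z.image fc).card :=
    Finset.card_erase_add_one (Finset.mem_image_of_mem _ hx0)
  let E : (P → ℚ) →ₗ[ℚ] (ι → ℚ) :=
    { toFun := fun f x => if h : x ∈ P then f ⟨x, h⟩ else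
        if h : α x ∈ P then - f ⟨α x, h⟩ else 0
      map_add' := by
        intro f g; ext x; simp only [Pi.add_apply]; split_ifs <;> ring
      map_smul' := by
        intro f g; ext x; simp only [Pi.smul_apply, smul_eq_mul, RingHom.id_apply]
        split_ifs <;> ring }
  let B : (P → ℚ) →ₗ[ℚ] (J' → ℚ) :=
    { toFun := fun f j => ∑ x with fc x = j, E f x
      map_add' := by
        intro f g; ext x; simp only [map_add, Pi.add_apply, Finset.sum_add_distrib]
      map_smul' := by
        intro f g; ext x
        simp only [map_smul, Pi.smul_apply, smul_eq_mul, RingHom.id_apply, Finset.mul_sum] }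
  let G : (O' → ℚ) →ₗ[ℚ] (O → ℚ) :=
    { toFun := fun g w => if h : w ∈ O' then g ⟨w, h⟩ else 0
      map_add' := by
        intro f g; ext x; simp only [Pi.add_apply]; split_ifs <;> ring
      map_smul' := by
        intro f g; ext x; simp only [Pi.smul_apply, smul_eq_mul, RingHom.id_apply]
        split_ifs <;> ring }
  let T : (O' → ℚ) →ₗ[ℚ] (P → ℚ) :=
    { toFun := fun g x => G g (o (φ x)) - G g (o x)
      map_add' := by
        intro f g; ext x; simp only [map_add, Pi.add_apply]; ring
      map_smul' := by
        intro f g; ext x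
        simp only [map_smul, Pi.smul_apply, smul_eq_mul, RingHom.id_apply]; ring }
  have hEZ : ∀ f x, x ∉ Z → E f x = 0 := by
    intro f x hx
    have h1 : x ∉ P := fun h => hx (Finset.mem_filter.1 h).1
    have h2 : α x ∉ P := fun h => hx (by rw [← hα x]; exact hαZ _ (Finset.mem_filter.1 h).1)
    change (if h : x ∈ P then f ⟨x, h⟩ else if h : α x ∈ P then - f ⟨α x, h⟩ else 0) = 0
    rw [dif_neg h1, dif_neg h2]
  have hEα : ∀ f x, E f (α x) = - E f x := by
    intro f x
    change (if h : α x ∈ P then f ⟨α x, h⟩ else if h : α (α x) ∈ P then - f ⟨α (α x), h⟩ else 0) =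
      - (if h : x ∈ P then f ⟨x, h⟩ else if h : α x ∈ P then - f ⟨α x, h⟩ else 0)
    by_cases h1 : x ∈ P
    · have h2 : α x ∉ P := by
        intro h
        have h3 := (Finset.mem_filter.1 h).2
        rw [hsgn, (Finset.mem_filter.1 h1).2] at h3
        simp at h3
      simp [h1, h2, hα]
    · by_cases h2 : α x ∈ P <;> simp [h1, h2, hα]
  have hle : LinearMap.ker B ≤ LinearMap.range T := by
    intro f hf
    rw [LinearMap.mem_ker] at hf
    have hsum : ∀ j, j ≠ fc x0 → ∑ x with fc x = j, E f x = 0 := by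
      intro j hj
      by_cases h1 : j ∈ J'
      · exact congrFun hf ⟨j, h1⟩
      · refine Finset.sum_eq_zero fun x hx => hEZ f x fun hxZ => h1 ?_
        rw [Finset.mem_filter] at hx
        exact Finset.mem_erase.2 ⟨hj, Finset.mem_image.2 ⟨x, hxZ, hx.2⟩⟩
    have htot : ∑ x, E f x = 0 := by
      have h1 : ∑ x, E f x = ∑ x, E f (α x) := (Equiv.sum_comp α (E f)).symm
      have h2 : ∑ x, E f (α x) = - ∑ x, E f x := by
        rw [← Finset.sum_neg_distrib]; exact Finset.sum_congr rfl fun x _ => hEα f x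
      linarith
    have hsum' : ∀ j, ∑ x with fc x = j, E f x = 0 := by
      intro j
      rcases ne_or_eq j (fc x0) with h1 | rfl
      · exact hsum j h1
      · rw [← Finset.sum_fiberwise Finset.univ fc,
          Finset.sum_eq_single (fc x0) (fun j _ hj => hsum j hj) (by simp)] at htot
        exact htot
    obtain ⟨t, ht1, ht2⟩ := hX (E f) (hEα f) hsum'
    have hinv := ho t (fun x => by rw [ht1, ht2])
    have hex : ∀ w : O', ∃ x, o x = w := fun w => by
      obtain ⟨x, -, hx⟩ := Finset.mem_image.1 (Finset.mem_erase.1 w.2).2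
      exact ⟨x, hx⟩
    choose rp hrp using hex
    refine ⟨fun w => t (rp w) - t x0, ?_⟩
    have hG : ∀ x ∈ Z, G (fun w => t (rp w) - t x0) (o x) = t x - t x0 := by
      intro x hx
      change (if h : o x ∈ O' then t (rp ⟨o x, h⟩) - t x0 else 0) = t x - t x0
      split_ifs with h
      · rw [hinv _ x (hrp ⟨o x, h⟩)]
      · have : o x = o x0 := by
          by_contra h1
          exact h (Finset.mem_erase.2 ⟨h1, Finset.mem_image_of_mem _ hx⟩)
        rw [hinv _ _ this, sub_self]
    ext x
    have hxZ := (Finset.mem_filter.1 x.2).1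
    change G _ (o (φ x)) - G _ (o x) = _
    rw [hG _ hxZ, hG _ (hφZ _ hxZ), ht1]
    have : E f x = f x := dif_pos x.2
    rw [this]; ring
  have d1 := LinearMap.finrank_range_add_finrank_ker B
  have d2 : Module.finrank ℚ (LinearMap.range B) ≤ J'.card := by
    refine (Submodule.finrank_le _).trans ?_
    simp
  have d3 : Module.finrank ℚ (LinearMap.ker B) ≤ O'.card := by
    refine (Submodule.finrank_mono hle).trans ((LinearMap.finrank_range_le T).trans ?_)
    simp
  have d4 : Module.finrank ℚ (P → ℚ) = P.card := by simp
  omega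

/-- The combinatorial Gauss–Bonnet inequality. -/
theorem euler_count (φ α : Equiv.Perm ι) (hα : ∀ x, α (α x) = x) (lam : ι → Fin 2 × Bool)
    (hlam : ∀ x, lam (α x) = bar (lam x)) (hty : ∀ x, (lam (φ x)).1 ≠ (lam x).1)
    (fc : ι → J)
    (hX : ∀ l : ι → ℚ, (∀ x, l (α x) = - l x) → (∀ j, ∑ x with fc x = j, l x = 0) →
      ∃ t : ι → ℚ, (∀ x, t (φ x) = t x + l x) ∧ ∀ x, t (α x) = t x + l x)
    {Z : Finset ι} (hZ : Z.Nonempty) (hφZ : ∀ d ∈ Z, φ d ∈ Z) (hαZ : ∀ d ∈ Z, α d ∈ Z) :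
    (Z.filter (fun d => φ (α (φ d)) ≠ α d)).card + 8 +
      (if ∃ d ∈ Z, φ (α (φ d)) ≠ α d ∧
        α (φ⁻¹ (α (φ⁻¹ (α (φ⁻¹ (α d)))))) ≠ φ d then 1 else 0) ≤ 4 * (Z.image fc).card := by
  classical
  set σ : Equiv.Perm ι := φ⁻¹.trans α with hσ
  have σdef : ∀ x, σ x = α (φ⁻¹ x) := fun x => rfl
  have σφ : ∀ x, σ (φ x) = α x := fun x => by rw [σdef, perm_inv_apply]
  have hφ'Z : ∀ d ∈ Z, φ⁻¹ d ∈ Z := by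
    intro d hd
    have h1 : ∀ k : ℕ, (φ ^ k) d ∈ Z := by
      intro k
      induction k with
      | zero => exact hd
      | succ k ih => rw [pow_succ', Equiv.Perm.mul_apply]; exact hφZ _ ih
    have h2 : φ⁻¹ d = (φ ^ (orderOf φ - 1)) d := by
      apply φ.injective
      rw [perm_apply_inv, ← Equiv.Perm.mul_apply, ← pow_succ',
        Nat.sub_add_cancel (orderOf_pos φ), pow_orderOf_eq_one]
      rfl
    rw [h2]; exact h1 _
  have hσZ : ∀ d ∈ Z, σ d ∈ Z := fun d hd => hαZ _ (hφ'Z d hd)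
  let o : ι → Quotient (Equiv.Perm.SameCycle.setoid σ) := fun x => Quotient.mk _ x
  have hoσ : ∀ x, o (σ x) = o x := fun x =>
    Quotient.sound (Equiv.Perm.SameCycle.refl σ x).apply_left
  have key := card_vertices_ge φ α hα (fun x => (lam x).2) (fun x => by rw [hlam]; rfl) o
    (by
      intro t ht x y hxy
      have h1 : ∀ x, t (σ x) = t x := fun x => by
        rw [σdef, ← ht, perm_apply_inv]
      obtain ⟨k, rfl⟩ := (Quotient.exact hxy : σ.SameCycle x y).exists_nat_pow_eq
      clear hxy
      induction k with
      | zero => rfl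
      | succ k ih => rw [pow_succ', Equiv.Perm.mul_apply, h1, ← ih]) fc hX hZ hφZ hαZ
  have tyσ : ∀ x, (lam (σ x)).1 ≠ (lam x).1 := by
    intro x h
    rw [σdef, hlam] at h
    have := hty (φ⁻¹ x)
    rw [perm_apply_inv] at this
    exact this h.symm
  have n1 : ∀ x, σ x ≠ x := fun x h => tyσ x (by rw [h])
  have n3 : ∀ x, σ (σ (σ x)) ≠ x := by
    intro x h
    have h1 := tyσ x
    have h2 := tyσ (σ x)
    have h3 := tyσ (σ (σ x))
    rw [h] at h3
    omega
  set w : ι → ℕ := fun x => if σ (σ x) = x then 2 else 1 with hw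
  have hw1 : ∀ x, 1 ≤ w x := by intro x; simp only [hw]; split_ifs <;> norm_num
  set S := if ∃ d ∈ Z, φ (α (φ d)) ≠ α d ∧
        α (φ⁻¹ (α (φ⁻¹ (α (φ⁻¹ (α d)))))) ≠ φ d then 1 else 0 with hS
  have br_iff : ∀ d, φ (α (φ d)) ≠ α d ↔ σ (σ (φ d)) ≠ φ d := by
    intro d
    rw [not_iff_not, σφ, σdef]
    constructor
    · intro h; rw [← h, perm_inv_apply, hα]
    · intro h; rw [← h, hα, perm_apply_inv]
  have hsub : ∀ y ∈ Z, ∀ T : Finset ι, T ⊆ Z.filter (fun x => o x = o y) →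
      ∑ x ∈ T, w x ≤ ∑ x ∈ Z with o x = o y, w x := fun y _ T hT =>
    Finset.sum_le_sum_of_subset hT
  have hmem : ∀ y ∈ Z, y ∈ Z.filter (fun x => o x = o y) ∧
      ∀ x ∈ Z.filter (fun x => o x = o y), σ x ∈ Z.filter (fun x => o x = o y) := by
    intro y hy
    refine ⟨Finset.mem_filter.2 ⟨hy, rfl⟩, fun x hx => ?_⟩
    rw [Finset.mem_filter] at hx ⊢
    exact ⟨hσZ x hx.1, by rw [hoσ, hx.2]⟩
  have four : ∀ y ∈ Z, 4 ≤ ∑ x ∈ Z with o x = o y, w x := by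
    intro y hy
    obtain ⟨m1, m2⟩ := hmem y hy
    by_cases h2 : σ (σ y) = y
    · refine le_trans ?_ (hsub y hy {y, σ y} ?_)
      · rw [Finset.sum_pair (n1 y).symm]
        simp [hw, h2]
      · intro x hx
        rw [Finset.mem_insert, Finset.mem_singleton] at hx
        rcases hx with rfl | rfl
        · exact m1
        · exact m2 _ m1
    · refine le_trans ?_ (hsub y hy {y, σ y, σ (σ y), σ (σ (σ y))} ?_)
      · have hc : ({y, σ y, σ (σ y), σ (σ (σ y))} : Finset ι).card = 4 := by
          rw [Finset.card_insert_of_notMem, Finset.card_insert_of_notMem,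
            Finset.card_insert_of_notMem, Finset.card_singleton]
          · simp [(n1 _).symm]
          · simp [(n1 _).symm, Ne.symm h2]
          · simp [(n1 _).symm, Ne.symm h2, (n3 _).symm]
        rw [← hc, Finset.card_eq_sum_ones]
        exact Finset.sum_le_sum fun x _ => hw1 x
      · intro x hx
        simp only [Finset.mem_insert, Finset.mem_singleton] at hx
        rcases hx with rfl | rfl | rfl | rfl
        · exact m1
        · exact m2 _ m1
        · exact m2 _ (m2 _ m1)
        · exact m2 _ (m2 _ (m2 _ m1))
  have five : ∀ y ∈ Z, σ (σ y) ≠ y → σ (σ (σ (σ y))) ≠ y → 5 ≤ ∑ x ∈ Z with o x = o y, w x := by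
    intro y hy h2 h4
    obtain ⟨m1, m2⟩ := hmem y hy
    refine le_trans ?_ (hsub y hy {y, σ y, σ (σ y), σ (σ (σ y)), σ (σ (σ (σ y)))} ?_)
    · have hc : ({y, σ y, σ (σ y), σ (σ (σ y)), σ (σ (σ (σ y)))} : Finset ι).card = 5 := by
        rw [Finset.card_insert_of_notMem, Finset.card_insert_of_notMem,
          Finset.card_insert_of_notMem, Finset.card_insert_of_notMem, Finset.card_singleton]
        · simp [(n1 _).symm]
        · simp [(n1 _).symm, Ne.symm h2]
        · simp [(n1 _).symm, Ne.symm h2, (n3 _).symm]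
        · simp [(n1 _).symm, Ne.symm h2, (n3 _).symm, Ne.symm h4]
      rw [← hc, Finset.card_eq_sum_ones]
      exact Finset.sum_le_sum fun x _ => hw1 x
    · intro x hx
      simp only [Finset.mem_insert, Finset.mem_singleton] at hx
      rcases hx with rfl | rfl | rfl | rfl | rfl
      · exact m1
      · exact m2 _ m1
      · exact m2 _ (m2 _ m1)
      · exact m2 _ (m2 _ (m2 _ m1))
      · exact m2 _ (m2 _ (m2 _ (m2 _ m1)))
  have hge : 4 * (Z.image o).card + S ≤ ∑ x ∈ Z, w x := by
    rw [← Finset.sum_fiberwise_of_maps_to (t := Z.image o) (g := o)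
      (fun x hx => Finset.mem_image_of_mem _ hx)]
    have hfour : ∀ v ∈ Z.image o, 4 ≤ ∑ x ∈ Z with o x = v, w x := by
      intro v hv
      obtain ⟨y, hy, rfl⟩ := Finset.mem_image.1 hv
      exact four y hy
    have h4 : 4 * (Z.image o).card = ∑ _v ∈ Z.image o, 4 := by simp [mul_comm]
    rw [h4]
    by_cases hs : ∃ d ∈ Z, φ (α (φ d)) ≠ α d ∧ α (φ⁻¹ (α (φ⁻¹ (α (φ⁻¹ (α d)))))) ≠ φ d
    · rw [hS, if_pos hs]
      obtain ⟨d, hd, hd1, hd2⟩ := hs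
      refine Finset.sum_lt_sum hfour ⟨o (φ d), Finset.mem_image_of_mem _ (hφZ d hd), ?_⟩
      refine five _ (hφZ d hd) ((br_iff d).1 hd1) ?_
      rw [σφ]
      exact hd2
    · rw [hS, if_neg hs]
      exact Finset.sum_le_sum hfour
  have hwsum : ∑ x ∈ Z, w x + (Z.filter (fun d => φ (α (φ d)) ≠ α d)).card = 2 * Z.card := by
    have h1 : (Z.filter (fun d => φ (α (φ d)) ≠ α d)).card =
        (Z.filter (fun e => σ (σ e) ≠ e)).card := by
      refine Finset.card_bij (fun x _ => φ x) ?_ ?_ ?_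
      · intro x hx
        rw [Finset.mem_filter] at hx ⊢
        exact ⟨hφZ x hx.1, (br_iff x).1 hx.2⟩
      · intro x _ y _ h
        exact φ.injective h
      · intro y hy
        rw [Finset.mem_filter] at hy
        refine ⟨φ⁻¹ y, ?_, perm_apply_inv φ y⟩
        rw [Finset.mem_filter, br_iff, perm_apply_inv]
        exact ⟨hφ'Z y hy.1, hy.2⟩
    rw [h1, Finset.card_filter, ← Finset.sum_add_distrib, mul_comm, ← smul_eq_mul,
      ← Finset.sum_const]
    refine Finset.sum_congr rfl fun x _ => ?_
    simp only [hw]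
    by_cases h : σ (σ x) = x <;> simp [h]
  omega

end

lemma finRotate_pow_val {n : ℕ} (k : Fin n) (t : ℕ) :
    (((finRotate n) ^ t) k : ℕ) = (k + t) % n := by
  cases n with
  | zero => exact k.elim0
  | succ n =>
    induction t with
    | zero => simp [Nat.mod_eq_of_lt k.2]
    | succ t ih =>
      rw [pow_succ', Equiv.Perm.mul_apply, finRotate_apply, Fin.val_add, ih, Fin.val_one',
        ← Nat.add_mod, add_assoc]

lemma finRotate_pow_self (n : ℕ) : (finRotate n) ^ n = 1 := by
  ext k
  rw [finRotate_pow_val]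
  simp [Nat.mod_eq_of_lt k.2]

lemma exists_finRotate_pow {n : ℕ} (k k' : Fin n) : ∃ t : ℕ, ((finRotate n) ^ t) k = k' := by
  refine ⟨n - k + k', Fin.ext ?_⟩
  rw [finRotate_pow_val]
  have h1 : (k : ℕ) + (n - k + k') = n + k' := by omega
  rw [h1, Nat.add_mod_left, Nat.mod_eq_of_lt k'.2]

lemma ofFn_eq_split {Γ : Type} {n : ℕ} (w : Fin n → Γ) (k : Fin n) :
    List.ofFn w = (List.ofFn w).take k ++ w k :: (List.ofFn w).drop (k + 1) := by
  conv_lhs => rw [← List.take_append_drop k (List.ofFn w)]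
  congr 1
  rw [List.drop_eq_getElem_cons (by simp)]
  simp

lemma drop_append_take_ofFn {Γ : Type} {n : ℕ} (w : Fin n → Γ) (k : Fin n) :
    (List.ofFn w).drop (k + 1) ++ (List.ofFn w).take k =
      (List.range (n - 1)).map fun t => w (((finRotate n) ^ (t + 1)) k) := by
  refine List.ext_getElem (by simp; omega) fun t h1 h2 => ?_
  have hk := k.2
  simp only [List.length_map, List.length_range] at h2
  rw [List.getElem_map, List.getElem_range]
  by_cases ht : t < n - (k + 1)
  · rw [List.getElem_append_left (by simpa using ht), List.getElem_drop, List.getElem_ofFn]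
    congr 1
    apply Fin.ext
    rw [finRotate_pow_val]
    simp only
    rw [Nat.mod_eq_of_lt (by omega)]
    omega
  · rw [List.getElem_append_right (by simpa using ht), List.getElem_take, List.getElem_ofFn]
    congr 1
    apply Fin.ext
    rw [finRotate_pow_val]
    simp only [List.length_drop, List.length_ofFn]
    rw [Nat.mod_eq_sub_mod (by omega), Nat.mod_eq_of_lt (by omega)]
    omega

/-- Changing one letter of a word. -/
lemma prod_ofFn_update {Γ : Type} [Group Γ] {n : ℕ} (w : Fin n → Γ) (k : Fin n) (a : Γ) :
    (List.ofFn (Function.update w k a)).prod =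
      ((List.ofFn w).take k).prod * a * ((List.ofFn w).drop (k + 1)).prod := by
  have h1 : (List.ofFn (Function.update w k a)).take k = (List.ofFn w).take k := by
    refine List.ext_getElem (by simp) fun t h1 h2 => ?_
    simp only [List.length_take, List.length_ofFn, lt_inf_iff] at h1
    rw [List.getElem_take, List.getElem_take, List.getElem_ofFn, List.getElem_ofFn,
      Function.update_of_ne]
    intro h
    have := congrArg Fin.val h
    simp only at this
    omega
  have h2 : (List.ofFn (Function.update w k a)).drop (k + 1) = (List.ofFn w).drop (k + 1) := by
    refine List.ext_getElem (by simp) fun t h1 h2 => ?_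
    rw [List.getElem_drop, List.getElem_drop, List.getElem_ofFn, List.getElem_ofFn,
      Function.update_of_ne]
    intro h
    have := congrArg Fin.val h
    simp only at this
    omega
  rw [ofFn_eq_split (Function.update w k a) k, List.prod_append, List.prod_cons, mul_assoc,
    Function.update_self, h1, h2]

/-- A cyclic word whose exponent signs follow a line of slope `Q / P`. -/
def IsLine (P Q : ℤ) (w : List (Fin 2 × Bool)) : Prop :=
  ∃ x : Fin w.length → ℤ, ∀ k, 0 ≤ x k ∧ x k < P ∧
    x (finRotate _ k) = x k + Q - P * (if (w.get (finRotate _ k)).2 = (w.get k).2 then 0 else 1) ∧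
    (w.get (finRotate _ k)).1 ≠ (w.get k).1

/-- A relation of length `m` among the conjugates of the words `W`, each of the words
`W (Sum.inr b)` being used exactly once. -/
def IsRep (W : Bool ⊕ Bool → List (Fin 2 × Bool)) (m : ℕ) : Prop :=
  ∃ (t : Fin m → F) (k : Fin m → Bool ⊕ Bool),
    ((List.finRange m).map fun i => t i * FreeGroup.mk (W (k i)) * (t i)⁻¹).prod = 1 ∧
    ∀ b, ∃! i, k i = Sum.inr b

lemma prod_map_filter {J Γ : Type} [Group Γ] (f : J → Γ) (p : J → Bool) (L : List J)
    (h : ∀ j ∈ L, p j = false → f j = 1) : ((L.filter p).map f).prod = (L.map f).prod := by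
  induction L with
  | nil => rfl
  | cons j L ih =>
    have ih := ih fun i hi => h i (by simp [hi])
    rw [List.filter_cons]
    split_ifs with hj
    · simp [ih]
    · simp [ih, h j (by simp) (by simpa using hj)]

/-- Two trivial relator faces may be discarded. -/
lemma IsRep.discard {W : Bool ⊕ Bool → List (Fin 2 × Bool)} {m : ℕ} (k : Fin m → Bool ⊕ Bool)
    (hk : ∀ b, ∃! i, k i = Sum.inr b) (f t : Fin m → F) (i j : Fin m)
    (hi : ∃ b, k i = Sum.inl b) (hj : ∃ b, k j = Sum.inl b) (fi : f i = 1) (fj : f j = 1)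
    (hf : ∀ a, a ≠ i → a ≠ j → f a = FreeGroup.mk (W (k a)))
    (h : ((List.finRange m).map fun a => t a * f a * (t a)⁻¹).prod = 1) :
    ∃ m' < m, IsRep W m' := by
  set L := (List.finRange m).filter fun a => decide (a ≠ i ∧ a ≠ j) with hL
  have hmem : ∀ a, a ∈ L ↔ a ≠ i ∧ a ≠ j := by simp [hL, List.mem_filter]
  refine ⟨L.length, ?_, fun a => t (L.get a), fun a => k (L.get a), ?_, ?_⟩
  · conv_rhs => rw [← List.length_finRange (n := m)]
    refine List.length_filter_lt_length_iff_exists.2 ⟨i, List.mem_finRange _, by simp⟩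
  · have h1 : ((List.finRange L.length).map fun a => t (L.get a) *
        FreeGroup.mk (W (k (L.get a))) * (t (L.get a))⁻¹) =
        L.map fun a => t a * FreeGroup.mk (W (k a)) * (t a)⁻¹ := by
      conv_rhs => rw [← List.map_get_finRange L, List.map_map]
      rfl
    rw [h1, ← h, ← prod_map_filter (fun a => t a * f a * (t a)⁻¹)
      (fun a => decide (a ≠ i ∧ a ≠ j))]
    · congr 1
      refine List.map_congr_left fun a ha => ?_
      rw [hf a ((hmem a).1 ha).1 ((hmem a).1 ha).2]
    · intro a _ ha
      have : a = i ∨ a = j := by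
        by_contra hc
        rw [not_or] at hc
        simp [hc] at ha
      rcases this with rfl | rfl
      · rw [fi]; group
      · rw [fj]; group
  · intro b
    obtain ⟨a, ha, hu⟩ := hk b
    have haL : a ∈ L := by
      rw [hmem]
      constructor
      · rintro rfl
        obtain ⟨c, hc⟩ := hi
        simp only [hc] at ha
        cases ha
      · rintro rfl
        obtain ⟨c, hc⟩ := hj
        simp only [hc] at ha
        cases ha
    obtain ⟨a', rfl⟩ := List.get_of_mem haL
    refine ⟨a', ha, fun c hc => ?_⟩
    have hnd : L.Nodup := (List.nodup_finRange m).filter _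
    exact (List.nodup_iff_injective_get.1 hnd) (hu _ hc)

section

variable {m : ℕ}

/-- The positions in the words of a family of faces. -/
abbrev Darts (W : Bool ⊕ Bool → List (Fin 2 × Bool)) (k : Fin m → Bool ⊕ Bool) : Type :=
  Σ i : Fin m, Fin (W (k i)).length

/-- The letter at a position. -/
def letter {W : Bool ⊕ Bool → List (Fin 2 × Bool)} {k : Fin m → Bool ⊕ Bool} (d : Darts W k) :
    Fin 2 × Bool := (W (k d.1)).get d.2

/-- The cyclic shift of every face. -/
def rot (W : Bool ⊕ Bool → List (Fin 2 × Bool)) (k : Fin m → Bool ⊕ Bool) :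
    Equiv.Perm (Darts W k) := Equiv.sigmaCongrRight fun _ => finRotate _

variable {W : Bool ⊕ Bool → List (Fin 2 × Bool)} {k : Fin m → Bool ⊕ Bool}

lemma rot_pow_mk (i : Fin m) (a : Fin (W (k i)).length) (t : ℕ) :
    ((rot W k) ^ t) ⟨i, a⟩ = ⟨i, ((finRotate _) ^ t) a⟩ := by
  induction t with
  | zero => rfl
  | succ t ih => rw [pow_succ', Equiv.Perm.mul_apply, ih, pow_succ', Equiv.Perm.mul_apply]; rfl

lemma rot_pow_length (d : Darts W k) : ((rot W k) ^ (W (k d.1)).length) d = d := by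
  obtain ⟨i, a⟩ := d
  rw [rot_pow_mk, finRotate_pow_self]
  rfl

lemma exists_rot_pow (d e : Darts W k) (h : d.1 = e.1) : ∃ t : ℕ, ((rot W k) ^ t) d = e := by
  obtain ⟨i, a⟩ := d
  obtain ⟨j, b⟩ := e
  obtain rfl : i = j := h
  obtain ⟨t, ht⟩ := exists_finRotate_pow a b
  exact ⟨t, by rw [rot_pow_mk, ht]⟩

/-- The corner bit before a position: whether the exponent changes sign. -/
def corner (d : Darts W k) : ℤ :=
  if (letter d).2 = (letter ((rot W k)⁻¹ d)).2 then 0 else 1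

lemma corner_eq (d : Darts W k) : corner d = 0 ∨ corner d = 1 := by
  unfold corner; split_ifs <;> simp

lemma corner_rot (d : Darts W k) :
    corner (rot W k d) = if (letter (rot W k d)).2 = (letter d).2 then 0 else 1 := by
  rw [corner, perm_inv_apply]

lemma fin_two_eq {a b c : Fin 2} (h1 : a ≠ c) (h2 : b ≠ c) : a = b := by omega

lemma not_of_corner (A B C : Bool)
    (h : (if A = !B then (0 : ℤ) else 1) = if B = C then 0 else 1) : A = !C := by
  cases A <;> cases B <;> cases C <;> simp at h ⊢

/-- A cancelling pair of relator positions propagates around both relators. -/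
lemma cancel_propagate (hty : ∀ d : Darts W k, (letter (rot W k d)).1 ≠ (letter d).1)
    {p q : ℤ} (x : Darts W k → ℤ)
    (hx : ∀ d b, k d.1 = Sum.inl b → 0 ≤ x d ∧ x d < p ∧
      x (rot W k d) = x d + q - p * corner (rot W k d))
    (d e : Darts W k) (b b' : Bool) (hd : k d.1 = Sum.inl b) (he : k e.1 = Sum.inl b')
    (hl : letter d = bar (letter e)) (h : x d + x e = p - 1) (t : ℕ) :
    x (((rot W k) ^ t) d) + x (((rot W k)⁻¹ ^ t) e) = p - 1 ∧
      letter (((rot W k) ^ t) d) = bar (letter (((rot W k)⁻¹ ^ t) e)) ∧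
      k (((rot W k) ^ t) d).1 = Sum.inl b ∧ k (((rot W k)⁻¹ ^ t) e).1 = Sum.inl b' := by
  induction t with
  | zero => exact ⟨h, hl, hd, he⟩
  | succ t ih =>
    rw [pow_succ', pow_succ', Equiv.Perm.mul_apply, Equiv.Perm.mul_apply]
    generalize ((rot W k) ^ t) d = d' at ih ⊢
    generalize hf : (rot W k)⁻¹ (((rot W k)⁻¹ ^ t) e) = f
    have hf' : (((rot W k)⁻¹ ^ t) e) = rot W k f := by rw [← hf, perm_apply_inv]
    rw [hf'] at ih
    obtain ⟨h1, h2, h3, h4⟩ := ih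
    obtain ⟨a1, a2, a3⟩ := hx d' b h3
    obtain ⟨b1, b2, b3⟩ := hx f b' h4
    obtain ⟨c1, c2, -⟩ := hx (rot W k d') b h3
    have hc : corner (rot W k d') = corner (rot W k f) := by
      rcases corner_eq (rot W k d') with u | u <;> rcases corner_eq (rot W k f) with v | v <;>
        rw [u] at a3 ⊢ <;> rw [v] at b3 ⊢ <;> linarith
    refine ⟨by rw [a3]; rw [hc]; linarith, ?_, h3, h4⟩
    rw [corner_rot, corner_rot] at hc
    have ht1 := hty d'
    have ht2 := hty f
    rw [h2] at hc ht1
    refine Prod.ext (fin_two_eq (c := (letter (rot W k f)).1) ht1 ht2.symm) ?_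
    simp only [bar] at hc ⊢
    exact not_of_corner _ _ _ hc

lemma letter_pow_even (hty : ∀ d : Darts W k, (letter (rot W k d)).1 ≠ (letter d).1)
    (d : Darts W k) (t : ℕ) : (letter (((rot W k) ^ t) d)).1 = (letter d).1 ↔ Even t := by
  induction t with
  | zero => simp
  | succ t ih =>
    rw [pow_succ', Equiv.Perm.mul_apply, Nat.even_add_one, ← ih]
    have := hty (((rot W k) ^ t) d)
    omega

lemma pair_ne_of_cancel (hty : ∀ d : Darts W k, (letter (rot W k d)).1 ≠ (letter d).1)
    {p q : ℤ} (x : Darts W k → ℤ)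
    (hx : ∀ d b, k d.1 = Sum.inl b → 0 ≤ x d ∧ x d < p ∧
      x (rot W k d) = x d + q - p * corner (rot W k d))
    (d e : Darts W k) (b b' : Bool) (hd : k d.1 = Sum.inl b) (he : k e.1 = Sum.inl b')
    (hl : letter d = bar (letter e)) (h : x d + x e = p - 1) : d.1 ≠ e.1 := by
  intro hde
  obtain ⟨s, rfl⟩ := exists_rot_pow d e hde
  have h1 : (letter (((rot W k) ^ s) d)).1 = (letter d).1 := by rw [hl]; rfl
  rw [letter_pow_even hty] at h1
  obtain ⟨u, rfl⟩ := h1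
  obtain ⟨-, h2, -⟩ := cancel_propagate hty x hx _ _ b b' hd he hl h u
  rw [pow_add, Equiv.Perm.mul_apply, inv_pow, perm_inv_apply] at h2
  exact bar_ne _ h2.symm

lemma mk_eq_prod_ofFn (w : List (Fin 2 × Bool)) :
    (List.ofFn fun a => FreeGroup.mk [w.get a]).prod = FreeGroup.mk w := by
  have : (List.ofFn fun a => FreeGroup.mk [w.get a]) = w.map fun c => FreeGroup.mk [c] := by
    conv_rhs => rw [← List.ofFn_get w, List.map_ofFn]
    rfl
  rw [this]
  clear this
  induction w with
  | nil => rfl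
  | cons c w ih => rw [List.map_cons, List.prod_cons, ih]; simp

end

section

variable {m : ℕ}
variable {W : Bool ⊕ Bool → List (Fin 2 × Bool)} {k : Fin m → Bool ⊕ Bool}

lemma mk_bar (c : Fin 2 × Bool) : FreeGroup.mk [bar c] = (FreeGroup.mk [c])⁻¹ := by
  rw [FreeGroup.inv_mk]; rfl

/-- If two letters cancel all around two relator faces, then the complementary words of the
letters are inverse to each other. -/
lemma cancel_prod (d e : Darts W k) (L : ℕ) (hLe : (W (k e.1)).length = L)
    (h : ∀ t : ℕ, letter (((rot W k) ^ t) d) = bar (letter (((rot W k)⁻¹ ^ t) e))) :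
    ((List.range (L - 1)).map fun t => FreeGroup.mk [letter (((rot W k) ^ (t + 1)) d)]).prod *
      ((List.range (L - 1)).map fun t => FreeGroup.mk [letter (((rot W k) ^ (t + 1)) e)]).prod
      = 1 := by
  rw [mul_eq_one_iff_eq_inv, List.prod_inv_reverse]
  congr 1
  refine List.ext_getElem (by simp) fun t h1 h2 => ?_
  simp only [List.length_map, List.length_range] at h1
  rw [List.getElem_map, List.getElem_range, List.getElem_reverse, List.getElem_map,
    List.getElem_map, List.getElem_range, h, mk_bar]
  simp only [List.length_map, List.length_range]
  congr 4
  rw [inv_pow, Equiv.Perm.inv_eq_iff_eq, ← Equiv.Perm.mul_apply, ← pow_add]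
  have h3 : t + 1 + (L - 1 - 1 - t + 1) = L := by omega
  rw [h3, ← hLe, rot_pow_length]

/-- In a minimal relation no two relator faces cancel. -/
lemma reduced_of_minimal (hmin : ∀ m' < m, ¬ IsRep W m')
    (hk : ∀ b, ∃! i, k i = Sum.inr b) (α : Darts W k → Darts W k)
    (hα : ∀ d, α (α d) = d) (hlam : ∀ d, letter (α d) = bar (letter d))
    (hU : ∀ l : Darts W k → F, (∀ d, l (α d) = (l d)⁻¹) →
      ∃ t : Fin m → F, ((List.finRange m).map fun i => t i * (List.ofFn fun a =>
        l ⟨i, a⟩).prod * (t i)⁻¹).prod = 1)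
    (hty : ∀ d : Darts W k, (letter (rot W k d)).1 ≠ (letter d).1)
    {p q : ℤ} (x : Darts W k → ℤ)
    (hx : ∀ d b, k d.1 = Sum.inl b → 0 ≤ x d ∧ x d < p ∧
      x (rot W k d) = x d + q - p * corner (rot W k d))
    (L : ℕ) (hL : ∀ b, (W (Sum.inl b)).length = L)
    (d : Darts W k) (b b' : Bool) (hd : k d.1 = Sum.inl b) (he : k (α d).1 = Sum.inl b') :
    x d + x (α d) ≠ p - 1 := by
  intro h
  have hl : letter d = bar (letter (α d)) := by rw [hlam, bar_bar]
  have hne := pair_ne_of_cancel hty x hx d (α d) b b' hd he hl h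
  have hprod := cancel_prod d (α d) L (by rw [he, hL])
    fun t => (cancel_propagate hty x hx _ _ b b' hd he hl h t).2.1
  have hαd := hα d
  generalize hE : α d = e at *
  obtain ⟨i, a⟩ := d
  obtain ⟨j, a'⟩ := e
  simp only at hd he hne
  have hde : (⟨i, a⟩ : Darts W k) ≠ ⟨j, a'⟩ := fun h => hne (congrArg Sigma.fst h)
  set l₀ : Darts W k → F := fun d => FreeGroup.mk [letter d] with hl₀
  have hs : ∀ (i : Fin m) (a : Fin (W (k i)).length), (W (k i)).length = L →
      ((List.range (L - 1)).map fun t => l₀ (((rot W k) ^ (t + 1)) ⟨i, a⟩)).prod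
      = ((List.ofFn fun a => l₀ ⟨i, a⟩).drop (a + 1)).prod *
        ((List.ofFn fun a => l₀ ⟨i, a⟩).take a).prod := by
    intro i a hLi
    rw [← hLi, ← List.prod_append, drop_append_take_ofFn]
    simp only [rot_pow_mk]
  have e1 := hs i a (by rw [hd, hL])
  have e2 := hs j a' (by rw [he, hL])
  rw [e1, e2] at hprod
  set A := ((List.ofFn fun a => l₀ ⟨i, a⟩).take a).prod
  set B := ((List.ofFn fun a => l₀ ⟨i, a⟩).drop (a + 1)).prod
  set A' := ((List.ofFn fun a => l₀ ⟨j, a⟩).take a').prod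
  set B' := ((List.ofFn fun a => l₀ ⟨j, a⟩).drop (a' + 1)).prod
  set γ : F := A⁻¹ * B⁻¹ with hγ
  set l : Darts W k → F := Function.update (Function.update l₀ ⟨i, a⟩ γ) ⟨j, a'⟩ γ⁻¹ with hldef
  have l1 : l ⟨i, a⟩ = γ := by
    rw [hldef, Function.update_of_ne hde, Function.update_self]
  have l2 : l ⟨j, a'⟩ = γ⁻¹ := by rw [hldef, Function.update_self]
  have l3 : ∀ d, d ≠ ⟨i, a⟩ → d ≠ ⟨j, a'⟩ → l d = l₀ d := fun d h1 h2 => by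
    rw [hldef, Function.update_of_ne h2, Function.update_of_ne h1]
  obtain ⟨t, ht⟩ := hU l fun d => by
    by_cases h1 : d = ⟨i, a⟩
    · rw [h1, hE, l1, l2]
    · by_cases h2 : d = ⟨j, a'⟩
      · rw [h2, hαd, l1, l2, inv_inv]
      · rw [l3 d h1 h2, l3 (α d) (fun h => h2 (by rw [← hα d, h, hE]))
          (fun h => h1 (by rw [← hα d, h, hαd]))]
        simp only [hl₀, hlam, mk_bar]
  obtain ⟨m', hm', hrep⟩ := IsRep.discard (W := W) k hk
    (fun i => (List.ofFn fun a => l ⟨i, a⟩).prod) t i j ⟨b, hd⟩ ⟨b', he⟩ (by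
      have : (fun c => l ⟨i, c⟩) = Function.update (fun c => l₀ ⟨i, c⟩) a γ := by
        funext c
        by_cases hc : c = a
        · rw [hc, l1, Function.update_self]
        · rw [Function.update_of_ne hc]
          refine l3 _ (fun h => hc ?_) (fun h => hne (congrArg Sigma.fst h))
          simpa using h
      simp only [this, prod_ofFn_update]
      change A * γ * B = 1
      rw [hγ]; group) (by
      have : (fun c => l ⟨j, c⟩) = Function.update (fun c => l₀ ⟨j, c⟩) a' γ⁻¹ := by
        funext c
        by_cases hc : c = a'
        · rw [hc, l2, Function.update_self]
        · rw [Function.update_of_ne hc]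
          refine l3 _ (fun h => hne (congrArg Sigma.fst h).symm) (fun h => hc ?_)
          simpa using h
      simp only [this, prod_ofFn_update]
      change A' * γ⁻¹ * B' = 1
      have h4 : γ⁻¹ = A'⁻¹ * B'⁻¹ := by
        rw [hγ, mul_inv_rev, inv_inv, inv_inv, mul_eq_one_iff_eq_inv.1 hprod, mul_inv_rev]
      rw [h4]; group) (fun c hci hcj => by
      rw [← mk_eq_prod_ofFn]
      congr 2
      funext u
      exact l3 _ (fun h => hci (congrArg Sigma.fst h)) (fun h => hcj (congrArg Sigma.fst h))) ht
  exact hmin m' hm' hrep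

end

/-- The arithmetic of the slopes of two special words in the gap around the relator slope
`q / p`, as used for spherical diagrams. -/
structure Slopes (n p μ q : ℤ) (ps qs : Bool → ℤ) : Prop where
  hn : 2 ≤ n
  hp : 2 ≤ p
  hμ0 : 0 < μ
  hμp : μ < p
  hq0 : 0 < q
  hqp : q < p
  hμq : p ∣ μ * q + 1
  hps : ∀ i, 0 < ps i
  b_ne : ∀ i, p * qs i - q * ps i ≠ 0
  slopes : ps false * qs true ≠ ps true * qs false
  far_pos : ∀ i, 0 < p * qs i - q * ps i →
    ps i < ((2 * n - 2) * p + μ) * (p * qs i - q * ps i)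
  far_neg : ∀ i, p * qs i - q * ps i < 0 →
    ps i < ((2 * n - 2) * p + (p - μ)) * (q * ps i - p * qs i)
  far_opp : (p * qs false - q * ps false) + (p * qs true - q * ps true) = 0 →
    ps false + ps true < 2 * n * p * |p * qs false - q * ps false|

lemma corner_two_bits (A B : Bool) :
    (if (!A) = !B then (0 : ℤ) else 1) = if B = A then 0 else 1 := by
  cases A <;> cases B <;> rfl

lemma corner_four_bits (A B C D : Bool) :
    (2 : ℤ) ∣ (if (!D) = A then 0 else 1) + (if (!A) = B then 0 else 1) +
      (if (!B) = C then 0 else 1) + (if (!C) = D then 0 else 1) := by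
  cases A <;> cases B <;> cases C <;> cases D <;> decide

/-- The type of the face of a position. -/
def faceKind {m : ℕ} {W : Bool ⊕ Bool → List (Fin 2 × Bool)} {k : Fin m → Bool ⊕ Bool}
    (d : Darts W k) : Option Bool := Sum.elim (fun _ => none) some (k d.1)

section
variable {m : ℕ} {W : Bool ⊕ Bool → List (Fin 2 × Bool)} {k : Fin m → Bool ⊕ Bool}

lemma faceKind_eq_none {d : Darts W k} (h : faceKind d = none) : ∃ b, k d.1 = Sum.inl b := by
  unfold faceKind at h
  rcases hk : k d.1 with b | b
  · exact ⟨b, rfl⟩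
  · simp [hk] at h

lemma faceKind_eq_some {d : Darts W k} {b : Bool} (h : faceKind d = some b) :
    k d.1 = Sum.inr b := by
  unfold faceKind at h
  rcases hk : k d.1 with b' | b'
  · simp [hk] at h
  · simp only [hk, Sum.elim_inr, Option.some.injEq] at h
    rw [h]

lemma filter_fst_eq (Z : Finset (Darts W k)) (hZ : ∀ d ∈ Z, rot W k d ∈ Z) (i : Fin m)
    (hi : i ∈ Z.image Sigma.fst) : (Z.filter fun d => d.1 = i).card = (W (k i)).length := by
  have : Z.filter (fun d => d.1 = i) =
      Finset.univ.map ⟨Sigma.mk i, sigma_mk_injective⟩ := by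
    ext d
    simp only [Finset.mem_filter, Finset.mem_map, Finset.mem_univ, true_and,
      Function.Embedding.coeFn_mk]
    constructor
    · rintro ⟨-, rfl⟩
      exact ⟨d.2, rfl⟩
    · rintro ⟨a, rfl⟩
      refine ⟨?_, rfl⟩
      obtain ⟨e, he, hei⟩ := Finset.mem_image.1 hi
      obtain ⟨t, ht⟩ := exists_rot_pow e ⟨i, a⟩ hei
      rw [← ht]
      clear ht
      induction t with
      | zero => exact he
      | succ t ih => rw [pow_succ', Equiv.Perm.mul_apply]; exact hZ _ ih
  rw [this, Finset.card_map, Finset.card_univ, Fintype.card_fin]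

lemma card_filter_none (Z : Finset (Darts W k)) (hZ : ∀ d ∈ Z, rot W k d ∈ Z) {L : ℤ}
    (hL : ∀ b, ((W (Sum.inl b)).length : ℤ) = L) :
    ((Z.filter fun d => faceKind d = none).card : ℤ) = L *
      (((Z.image Sigma.fst).filter fun i => Sum.elim (fun _ => none) some (k i) = none).card) := by
  set I := (Z.image Sigma.fst).filter fun i => Sum.elim (fun _ => none) some (k i) = none
  have h1 := Finset.card_eq_sum_card_fiberwise (s := Z.filter fun d => faceKind d = none)
    (t := I) (f := Sigma.fst) (by
      intro d hd
      simp only [Finset.coe_filter, Set.mem_ofPred_eq] at hd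
      simp only [I, Finset.coe_filter, Set.mem_ofPred_eq]
      exact ⟨Finset.mem_image_of_mem _ hd.1, hd.2⟩)
  rw [h1, Nat.cast_sum]
  rw [Finset.sum_congr rfl (g := fun _ => L), Finset.sum_const, nsmul_eq_mul, mul_comm]
  intro i hi
  obtain ⟨hi1, hi2⟩ := Finset.mem_filter.1 hi
  have h2 : (Z.filter fun d => faceKind d = none).filter (fun d => d.1 = i) =
      Z.filter fun d => d.1 = i := by
    rw [Finset.filter_filter]
    refine Finset.filter_congr fun d _ => ⟨fun h => h.2, fun h => ⟨?_, h⟩⟩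
    rw [faceKind, h]; exact hi2
  rw [h2, filter_fst_eq Z hZ i hi1]
  rcases hk : k i with b | b
  · exact hL b
  · simp [hk] at hi2

lemma card_image_fst (hk : ∀ b, ∃! i, k i = Sum.inr b) (Z : Finset (Darts W k)) :
    (((Z.image Sigma.fst).card : ℕ) : ℤ) ≤
      ((Z.image Sigma.fst).filter fun i => Sum.elim (fun _ => none) some (k i) = none).card +
      (if ∃ d ∈ Z, faceKind d = some false then 1 else 0) +
      (if ∃ d ∈ Z, faceKind d = some true then 1 else 0) := by
  set I := Z.image Sigma.fst
  have h1 := Finset.card_eq_sum_card_fiberwise (s := I) (t := Finset.univ)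
    (f := fun i => Sum.elim (fun _ => none) some (k i)) (fun _ _ => by simp)
  have h2 : ∀ b, ((I.filter fun i => Sum.elim (fun _ => none) some (k i) = some b).card : ℤ) ≤
      if ∃ d ∈ Z, faceKind d = some b then 1 else 0 := by
    intro b
    split_ifs with h
    · have : (I.filter fun i => Sum.elim (fun _ => none) some (k i) = some b).card ≤ 1 := by
        rw [Finset.card_le_one]
        intro i hi j hj
        refine (hk b).unique ?_ ?_
        · have := (Finset.mem_filter.1 hi).2
          rcases hki : k i with c | c <;> simp [hki] at this
          rw [this]
        · have := (Finset.mem_filter.1 hj).2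
          rcases hki : k j with c | c <;> simp [hki] at this
          rw [this]
      exact_mod_cast this
    · have : (I.filter fun i => Sum.elim (fun _ => none) some (k i) = some b) = ∅ := by
        rw [Finset.filter_eq_empty_iff]
        intro i hi hib
        obtain ⟨d, hd, rfl⟩ := Finset.mem_image.1 hi
        exact h ⟨d, hd, hib⟩
      rw [this]; simp
  rw [h1, Fintype.sum_option, Fintype.sum_bool]
  push_cast
  linarith [h2 false, h2 true]

lemma card_filter_some (hk : ∀ b, ∃! i, k i = Sum.inr b) (b : Bool)
    (hne : W (Sum.inr b) ≠ []) :
    (Finset.univ.filter fun d : Darts W k => faceKind d = some b).card =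
      (W (Sum.inr b)).length := by
  obtain ⟨i, hi, hu⟩ := hk b
  have hpos : 0 < (W (k i)).length := by rw [hi]; exact List.length_pos_iff.2 hne
  have : (Finset.univ.filter fun d : Darts W k => faceKind d = some b) =
      Finset.univ.filter fun d : Darts W k => d.1 = i := by
    refine Finset.filter_congr fun d _ => ⟨fun h => hu _ (faceKind_eq_some h), fun h => ?_⟩
    rw [faceKind, h, hi]; rfl
  rw [this, filter_fst_eq _ (fun _ _ => Finset.mem_univ _) i
    (Finset.mem_image.2 ⟨⟨i, ⟨0, hpos⟩⟩, Finset.mem_univ _, rfl⟩), hi]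

lemma corner_two (α : Darts W k → Darts W k)
    (hlam : ∀ d, letter (α d) = bar (letter d)) (d : Darts W k)
    (h : rot W k (α (rot W k d)) = α d) : corner (α d) = corner (rot W k d) := by
  rw [← h, corner_rot, corner_rot, h, hlam, hlam]
  simp only [bar]
  exact corner_two_bits _ _

lemma corner_four (α : Darts W k → Darts W k)
    (hlam : ∀ d, letter (α d) = bar (letter d)) (e f₁ f₂ f₃ f₄ : Darts W k)
    (h₁ : (rot W k)⁻¹ e = f₁) (h₂ : (rot W k)⁻¹ (α f₁) = f₂) (h₃ : (rot W k)⁻¹ (α f₂) = f₃)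
    (h₄ : (rot W k)⁻¹ (α f₃) = f₄) (h : α f₄ = e) :
    2 ∣ corner e + corner (α f₁) + corner (α f₂) + corner (α f₃) := by
  unfold corner
  rw [h₁, h₂, h₃, h₄, ← h, hlam, hlam, hlam, hlam]
  simp only [bar]
  exact corner_four_bits _ _ _ _

end

/-- Two special words whose slopes are in the gap are not related. -/
theorem no_rep {n p μ q : ℤ} {ps qs : Bool → ℤ} (hS : Slopes n p μ q ps qs)
    (W : Bool ⊕ Bool → List (Fin 2 × Bool))
    (hline_r : ∀ b, IsLine p q (W (Sum.inl b)))
    (hline_s : ∀ b, IsLine (ps b) (qs b) (W (Sum.inr b)))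
    (hlen_r : ∀ b, ((W (Sum.inl b)).length : ℤ) = 2 * n * p)
    (hlen_s : ∀ b, ((W (Sum.inr b)).length : ℤ) = 2 * ps b) (m : ℕ) : ¬ IsRep W m := by
  induction m using Nat.strong_induction_on with
  | _ m hmin =>
  rintro ⟨t, k, hprod, hk⟩
  obtain ⟨α, hα, hlam, hsph⟩ := exists_spherical (fun i => (W (k i)).length)
    (fun d => (W (k d.1)).get d.2) (fun i => (t i).toWord) (by
      simpa only [FreeGroup.mk_toWord, List.ofFn_get] using hprod)
  have hα' : ∀ d : Darts W k, α (α d) = d := hα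
  have hlam' : ∀ d : Darts W k, letter (α d) = bar (letter d) := hlam
  have hL : ∀ i, IsLine (Sum.elim (fun _ => p) ps (k i)) (Sum.elim (fun _ => q) qs (k i))
      (W (k i)) := by
    intro i
    rcases k i with b | b
    · exact hline_r b
    · exact hline_s b
  choose X hX using hL
  set x : Darts W k → ℤ := fun d => X d.1 d.2 with hx
  have hty : ∀ d : Darts W k, (letter (rot W k d)).1 ≠ (letter d).1 := fun d =>
    (hX d.1 d.2).2.2.2
  have hxx : ∀ d : Darts W k, 0 ≤ x d ∧ x d < Sum.elim (fun _ => p) ps (k d.1) ∧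
      x (rot W k d) = x d + Sum.elim (fun _ => q) qs (k d.1) -
        Sum.elim (fun _ => p) ps (k d.1) * corner (rot W k d) := fun d => by
    rw [corner_rot]
    exact ⟨(hX d.1 d.2).1, (hX d.1 d.2).2.1, (hX d.1 d.2).2.2.1⟩
  have hlenN : ∀ b, (W (Sum.inl b)).length = (2 * n * p).toNat := fun b => by
    have := hlen_r b; omega
  have hred := reduced_of_minimal hmin hk α hα' hlam' (fun l hl => (hsph F l hl).1) hty
    (p := p) (q := q) x (fun d b hb => by simpa only [hb, Sum.elim_inl] using hxx d) _ hlenN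
  have hn0 := hS.hn
  have hp0 := hS.hp
  refine Diagram.impossible (ι := Darts W k)
    { n := n, p := p, μ := μ, q := q, ps := ps, qs := qs
      φ := rot W k
      α := Function.Involutive.toPerm α hα'
      kd := faceKind, c := corner, x := x
      N := ((Finset.univ.image Sigma.fst).filter
        fun i => Sum.elim (fun _ => none) some (k i) = none).card
      hn := hS.hn, hp := hS.hp, hμ0 := hS.hμ0, hμp := hS.hμp, hq0 := hS.hq0, hqp := hS.hqp
      hμq := hS.hμq, hps := hS.hps
      α_α := hα'
      kd_φ := fun d => rfl
      c01 := corner_eq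
      c_two := fun d h => corner_two α hlam' d h
      c_four := fun e h => corner_four α hlam' e _ _ _ _ rfl rfl rfl rfl h
      x_nonneg := fun d => (hxx d).1
      x_lt_r := fun d hd => by
        obtain ⟨b, hb⟩ := faceKind_eq_none hd
        simpa only [hb, Sum.elim_inl] using (hxx d).2.1
      x_lt_s := fun d i hd => by
        simpa only [faceKind_eq_some hd, Sum.elim_inr] using (hxx d).2.1
      x_r := fun d hd => by
        obtain ⟨b, hb⟩ := faceKind_eq_none hd
        simpa only [hb, Sum.elim_inl] using (hxx d).2.2
      x_s := fun d i hd => by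
        simpa only [faceKind_eq_some hd, Sum.elim_inr] using (hxx d).2.2
      reduced := fun d hd he => by
        obtain ⟨b, hb⟩ := faceKind_eq_none hd
        obtain ⟨b', hb'⟩ := faceKind_eq_none he
        exact hred d b b' hb hb'
      period_r := fun d hd => by
        obtain ⟨b, hb⟩ := faceKind_eq_none hd
        have := rot_pow_length d
        rw [← hlen_r b, zpow_natCast]
        rwa [hb] at this
      card_r := card_filter_none _ (fun _ _ => Finset.mem_univ _) hlen_r
      card_s := fun i => by
        rw [card_filter_some hk i, hlen_s]
        intro h
        have h1 := hlen_s i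
        have h2 := hS.hps i
        rw [h] at h1
        simp at h1
        omega
      trans_s := fun d e i hd he => exists_rot_pow d e
        ((hk i).unique (faceKind_eq_some hd) (faceKind_eq_some he))
      euler := fun Z hZ hφ hαZ => ?_
      b_ne := hS.b_ne, slopes := hS.slopes
      far_pos := hS.far_pos, far_neg := hS.far_neg, far_opp := hS.far_opp }
  have h1 := euler_count (rot W k) (Function.Involutive.toPerm α hα') hα' letter hlam' hty
    Sigma.fst (fun l hl hs => by
      obtain ⟨s, hs1, hs2⟩ := (hsph (Multiplicative ℚ) (fun d => Multiplicative.ofAdd (l d))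
        (fun d => congrArg Multiplicative.ofAdd (hl d))).2 (fun i => by
          have h3 := hs i
          rw [Finset.sum_filter, Fintype.sum_sigma, Finset.sum_eq_single i] at h3
          · simp only [if_true] at h3
            rw [List.prod_ofFn, ← ofAdd_sum, h3]
            rfl
          · intro j _ hj
            simp [hj]
          · simp)
      exact ⟨fun d => Multiplicative.toAdd (s d),
        fun d => congrArg Multiplicative.toAdd (hs1 d),
        fun d => congrArg Multiplicative.toAdd (hs2 d)⟩) hZ hφ hαZ
  have h2 := card_filter_none Z hφ hlen_r
  have h3 := card_image_fst hk Z
  rw [h2]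
  have h4 : (0 : ℤ) ≤ 2 * n * p := by positivity
  rw [mul_left_comm (4 : ℤ)]
  refine mul_le_mul_of_nonneg_left ?_ h4
  zify at h1
  by_cases hf : ∃ d ∈ Z, faceKind d = some false <;>
  by_cases ht : ∃ d ∈ Z, faceKind d = some true <;>
  simp only [hf, ht, if_true, if_false] at h3 ⊢ <;> linarith

lemma isLine_map_range {P Q : ℤ} (N : ℕ) (f : ℕ → Fin 2 × Bool) (x : ℕ → ℤ)
    (h : ∀ k < N, 0 ≤ x k ∧ x k < P ∧
      x ((k + 1) % N) = x k + Q - P * (if (f ((k + 1) % N)).2 = (f k).2 then 0 else 1) ∧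
      (f ((k + 1) % N)).1 ≠ (f k).1) : IsLine P Q ((List.range N).map f) := by
  refine ⟨fun k => x k, fun k => ?_⟩
  have h1 := finRotate_pow_val k 1
  rw [pow_one] at h1
  have h2 := h k (by simpa using k.2)
  simp only [List.length_map, List.length_range] at h1
  simp only [List.get_eq_getElem, List.getElem_map, List.getElem_range, h1]
  exact h2

lemma isLine_invRev_map_range {P Q : ℤ} (N : ℕ) (f : ℕ → Fin 2 × Bool) (x : ℕ → ℤ)
    (h : ∀ k < N, 0 ≤ x k ∧ x k < P ∧
      x ((k + 1) % N) = x k + Q - P * (if (f ((k + 1) % N)).2 = (f k).2 then 0 else 1) ∧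
      (f ((k + 1) % N)).1 ≠ (f k).1) :
    IsLine P Q (FreeGroup.invRev ((List.range N).map f)) := by
  have h1 : FreeGroup.invRev ((List.range N).map f) =
      (List.range N).map fun k => bar (f (N - 1 - k)) := by
    refine List.ext_getElem (by simp [FreeGroup.invRev]) fun k h1 h2 => ?_
    simp [FreeGroup.invRev, bar]
  rw [h1]
  refine isLine_map_range N _ (fun k => P - 1 - x (N - 1 - k)) fun k hk => ?_
  set j := N - 1 - (k + 1) % N with hj
  have h2 : N - 1 - k = (j + 1) % N := by
    rcases Nat.lt_or_ge (k + 1) N with h3 | h3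
    · rw [Nat.mod_eq_of_lt h3] at hj
      rw [Nat.mod_eq_of_lt (by omega)]
      omega
    · have h4 : k + 1 = N := by omega
      rw [h4, Nat.mod_self] at hj
      have h5 : j + 1 = N := by omega
      rw [h5, Nat.mod_self]
      omega
  obtain ⟨a1, a2, a3, a4⟩ := h j (by omega)
  obtain ⟨b1, b2, -⟩ := h (N - 1 - k) (by omega)
  rw [h2] at b1 b2 ⊢
  refine ⟨by linarith, by linarith, ?_, a4.symm⟩
  have h6 : (if (bar (f j)).2 = (bar (f ((j + 1) % N))).2 then (0 : ℤ) else 1) =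
      if (f ((j + 1) % N)).2 = (f j).2 then 0 else 1 := corner_two_bits _ _
  rw [h6]
  linarith

/-- The letters of the (infinite) word of slope `s`. -/
def lineLetter (s : ℚ) (k : ℕ) : Fin 2 × Bool :=
  (⟨k % 2, Nat.mod_lt _ (by norm_num)⟩, decide (Even ((k : ℤ) * s.num / s.den)))

lemma line_conditions (s : ℚ) (h0 : 0 ≤ s) (h1 : s ≤ 1) (n : ℕ) (k : ℕ) :
    0 ≤ (k : ℤ) * s.num % s.den ∧ (k : ℤ) * s.num % s.den < s.den ∧
      ((((k + 1) % (2 * s.den * n) : ℕ) : ℤ) * s.num) % s.den = (k : ℤ) * s.num % s.den + s.num -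
        s.den * (if (lineLetter s ((k + 1) % (2 * s.den * n))).2 = (lineLetter s k).2
          then 0 else 1) ∧
      (lineLetter s ((k + 1) % (2 * s.den * n))).1 ≠ (lineLetter s k).1 := by
  have hd : (0 : ℤ) < s.den := by exact_mod_cast s.den_pos
  have hq0 : 0 ≤ s.num := Rat.num_nonneg.2 h0
  have hq1 : s.num ≤ s.den := Rat.num_le_denom_iff.2 h1
  set j := (k + 1) % (2 * s.den * n) with hj
  obtain ⟨e, he⟩ : ∃ e : ℕ, k + 1 = j + 2 * s.den * n * e :=
    ⟨(k + 1) / (2 * s.den * n), (Nat.mod_add_div _ _).symm⟩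
  have he' : (k : ℤ) + 1 = j + 2 * s.den * n * e := by exact_mod_cast he
  have e1 := Int.emod_add_mul_ediv ((k : ℤ) * s.num) s.den
  have e2 := Int.emod_add_mul_ediv ((j : ℤ) * s.num) s.den
  have u1 := Int.emod_nonneg ((k : ℤ) * s.num) hd.ne'
  have u2 := Int.emod_nonneg ((j : ℤ) * s.num) hd.ne'
  have v1 := Int.emod_lt_of_pos ((k : ℤ) * s.num) hd
  have v2 := Int.emod_lt_of_pos ((j : ℤ) * s.num) hd
  refine ⟨u1, v1, ?_, ?_⟩
  · set A := (k : ℤ) * s.num / s.den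
    set B := (j : ℤ) * s.num / s.den
    set x := (k : ℤ) * s.num % s.den
    set y := (j : ℤ) * s.num % s.den
    have key : y - x = s.num - s.den * ((B + 2 * (n * e * s.num)) - A) := by
      linear_combination e2 - e1 - s.num * he'
    set T := (B + 2 * (n * e * s.num)) - A with hT
    have hT1 : T < 2 := by nlinarith
    have hT0 : -1 < T := by nlinarith
    have hBA : B = A + T - 2 * (n * e * s.num) := by linarith
    have hpar : Even B ↔ Even (A + T) := by
      rw [hBA, Int.even_sub]
      simp
    have heq : (lineLetter s j).2 = (lineLetter s k).2 ↔ (Even (A + T) ↔ Even A) := by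
      rw [← hpar]
      exact decide_eq_decide
    obtain h | h : T = 0 ∨ T = 1 := by omega
    · rw [h] at key heq
      rw [if_pos (heq.2 (by simp))]
      linarith
    · rw [h] at key heq
      have : ¬ (Even (A + 1) ↔ Even A) := by
        rw [Int.even_add_one]; tauto
      rw [if_neg (fun hc => this (heq.1 hc))]
      linarith
  · simp only [lineLetter, ne_eq, Fin.mk.injEq]
    have : 2 * s.den * n * e = 2 * (s.den * n * e) := by ring
    omega

/-- The word of `u_s ^ n`. -/
def lineWord (s : ℚ) (n : ℕ) : List (Fin 2 × Bool) :=
  (List.range (2 * s.den * n)).map (lineLetter s)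

lemma length_lineWord (s : ℚ) (n : ℕ) : (lineWord s n).length = 2 * s.den * n := by
  simp [lineWord]

lemma isLine_lineWord (s : ℚ) (h0 : 0 ≤ s) (h1 : s ≤ 1) (n : ℕ) :
    IsLine s.den s.num (lineWord s n) :=
  isLine_map_range _ _ (fun k => (k : ℤ) * s.num % s.den) fun k _ => line_conditions s h0 h1 n k

lemma isLine_invRev_lineWord (s : ℚ) (h0 : 0 ≤ s) (h1 : s ≤ 1) (n : ℕ) :
    IsLine s.den s.num (FreeGroup.invRev (lineWord s n)) :=
  isLine_invRev_map_range _ _ (fun k => (k : ℤ) * s.num % s.den)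
    fun k _ => line_conditions s h0 h1 n k

lemma mk_eq_prod_map (w : List (Fin 2 × Bool)) :
    FreeGroup.mk w = (w.map fun c => FreeGroup.mk [c]).prod := by
  induction w with
  | nil => rfl
  | cons c w ih => rw [List.map_cons, List.prod_cons, ← ih]; simp

lemma uWord_eq (s : ℚ) (h0 : 0 ≤ s) : uWord s = FreeGroup.mk (lineWord s 1) := by
  rw [mk_eq_prod_map, uWord, lineWord, mul_one, List.map_map]
  congr 1
  refine List.map_congr_left fun k _ => ?_
  have h1 : ⌊(k : ℚ) * s⌋ = (k : ℤ) * s.num / s.den := by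
    rw [← Rat.floor_intCast_div_natCast]
    congr 1
    conv_lhs => rw [← Rat.num_div_den s]
    push_cast
    ring
  have h2 : 0 ≤ ⌊(k : ℚ) * s⌋ := Int.floor_nonneg.2 (by positivity)
  have h3 : Even ⌊(k : ℚ) * s⌋.toNat ↔ Even ((k : ℤ) * s.num / s.den) := by
    rw [← h1, ← Int.even_coe_nat, Int.toNat_of_nonneg h2]
  simp only [Function.comp, lineLetter, ← h3]
  by_cases h : Even ⌊(k : ℚ) * s⌋.toNat
  · rw [h.neg_one_pow, decide_eq_true h, zpow_one]; rfl
  · rw [(Nat.not_even_iff_odd.1 h).neg_one_pow, decide_eq_false h, zpow_neg, zpow_one, gen,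
      FreeGroup.of, FreeGroup.inv_mk]
    rfl

lemma lineLetter_add (s : ℚ) (j k : ℕ) :
    lineLetter s (2 * s.den * j + k) = lineLetter s k := by
  have hd : (s.den : ℤ) ≠ 0 := by exact_mod_cast s.den_ne_zero
  have h1 : ((2 * s.den * j + k : ℕ) : ℤ) * s.num / s.den =
      (k : ℤ) * s.num / s.den + 2 * (j * s.num) := by
    rw [← Int.add_mul_ediv_right _ _ hd]
    congr 1
    push_cast
    ring
  refine Prod.ext (Fin.ext ?_) ?_
  · simp only [lineLetter]
    rw [mul_assoc, Nat.mul_add_mod]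
  · simp only [lineLetter]
    rw [h1, decide_eq_decide, Int.even_add]
    simp

lemma mk_lineWord (s : ℚ) (n : ℕ) : FreeGroup.mk (lineWord s n) =
    FreeGroup.mk (lineWord s 1) ^ n := by
  induction n with
  | zero => simp [lineWord, FreeGroup.one_eq_mk]
  | succ n ih =>
    rw [pow_succ, ← ih, FreeGroup.mul_mk]
    congr 1
    rw [lineWord, lineWord, lineWord, mul_add, List.range_add, List.map_append, List.map_map]
    congr 1
    refine List.map_congr_left fun k _ => ?_
    exact lineLetter_add s n k

lemma cfQ_nonneg (L : List ℕ) : 0 ≤ cfQ L := by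
  induction L with
  | nil => simp [cfQ]
  | cons a L ih => simp only [cfQ]; positivity

/-- Continued fractions with a fixed initial part are Möbius transforms of the rest. -/
lemma exists_moebius (M : List ℕ) (hne : M ≠ []) (hpos : ∀ x ∈ M, 0 < x) :
    ∃ A B C D : ℤ, 1 ≤ A ∧ 0 ≤ B ∧ A ≤ C ∧ B ≤ D ∧ 1 ≤ D ∧ A + B < C + D ∧
      A * D - B * C = (-1) ^ (M.length + 1) ∧
      ∀ L, cfQ (M ++ L) = (A + B * cfQ L) / (C + D * cfQ L) := by
  induction M with
  | nil => exact absurd rfl hne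
  | cons a M ih =>
    have ha : (1 : ℤ) ≤ a := by exact_mod_cast hpos a (by simp)
    rcases eq_or_ne M [] with rfl | hM
    · refine ⟨1, 0, a, 1, le_rfl, le_rfl, ha, by norm_num, le_rfl, by linarith, by norm_num,
        fun L => ?_⟩
      simp [cfQ]
    · obtain ⟨A, B, C, D, h1, h2, h3, h4, h5, h6, h7, h8⟩ :=
        ih hM fun x hx => hpos x (by simp [hx])
      refine ⟨C, D, a * C + A, a * D + B, by linarith, by linarith, by nlinarith, by nlinarith,
        by nlinarith, by nlinarith, ?_, fun L => ?_⟩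
      · rw [List.length_cons, pow_succ, ← h7]; ring
      · have hL := cfQ_nonneg L
        have hC : (1 : ℚ) ≤ C := by exact_mod_cast h1.trans h3
        have hD : (1 : ℚ) ≤ D := by exact_mod_cast h5
        have hpos : (0 : ℚ) < C + D * cfQ L := by positivity
        rw [List.cons_append, cfQ, h8]
        push_cast
        have h9 : (a : ℚ) + (A + B * cfQ L) / (C + D * cfQ L) =
            ((a * C + A) + (a * D + B) * cfQ L) / (C + D * cfQ L) := by
          field_simp
          ring
        rw [h9, one_div_div]

/-- The estimates on slopes in the gap around `q / p`. -/
structure Gap (n p μ q X Y e : ℤ) : Prop where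
  hp : 2 ≤ p
  hμ0 : 0 < μ
  hμp : μ < p
  hq0 : 0 < q
  hqp : q < p
  hμq : p ∣ μ * q + 1
  he0 : 0 ≤ e
  he1 : e ≤ 1
  hX : X + e ≤ (2 * n - 2) * p + μ
  hY : Y + (1 - e) ≤ (2 * n - 2) * p + (p - μ)
  hXY : X + Y = 2 * n * p

/-- Membership of the slope `u / v` in the gap. -/
def InGap (p q X Y e u v : ℤ) : Prop :=
  (0 < p * u - q * v ∧ v + (1 - e) ≤ X * (p * u - q * v)) ∨
    (p * u - q * v < 0 ∧ v + e ≤ Y * (q * v - p * u))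

lemma Gap.slopes {n p μ q X Y e : ℤ} (hG : Gap n p μ q X Y e) (hn : 2 ≤ n)
    (ps qs : Bool → ℤ) (hps : ∀ i, 0 < ps i)
    (hne : ps false * qs true ≠ ps true * qs false)
    (hgap : ∀ i, InGap p q X Y e (qs i) (ps i)) : Slopes n p μ q ps qs := by
  have he0 := hG.he0
  have he1 := hG.he1
  refine ⟨hn, hG.hp, hG.hμ0, hG.hμp, hG.hq0, hG.hqp, hG.hμq, hps, fun i => ?_, hne, fun i hi => ?_,
    fun i hi => ?_, fun h => ?_⟩
  · rcases hgap i with ⟨h, -⟩ | ⟨h, -⟩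
    · exact h.ne'
    · exact h.ne
  · rcases hgap i with ⟨-, h⟩ | ⟨h, -⟩
    · have := mul_le_mul_of_nonneg_right hG.hX hi.le
      nlinarith
    · linarith
  · rcases hgap i with ⟨h, -⟩ | ⟨-, h⟩
    · linarith
    · have := mul_le_mul_of_nonneg_right hG.hY (show 0 ≤ q * ps i - p * qs i by linarith)
      nlinarith
  · have hXY := hG.hXY
    rcases hgap false with ⟨a1, a2⟩ | ⟨a1, a2⟩ <;> rcases hgap true with ⟨b1, b2⟩ | ⟨b1, b2⟩
    · linarith
    · have e1 : q * ps true - p * qs true = p * qs false - q * ps false := by linarith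
      rw [abs_of_pos a1, ← hXY, add_mul]
      rw [e1] at b2
      linarith
    · have e1 : p * qs true - q * ps true = q * ps false - p * qs false := by linarith
      rw [abs_of_neg a1, ← hXY, add_mul, neg_sub]
      rw [e1] at b2
      linarith
    · linarith

lemma pos_of_le_mul {K b v : ℤ} (hv : 0 < v) (hK : 0 < K) (h : v ≤ K * b) : 0 < b := by
  by_contra hb
  nlinarith

lemma gap_strict {p C x b c v : ℤ} (hp : 1 ≤ p) (hid : v = p * c - C * b) (h : x * b + c < 0) :
    v + 1 ≤ (x * p + C) * -b := by
  have : p * (x * b + c) ≤ p * (-1) := mul_le_mul_of_nonneg_left (by omega) (by omega)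
  linarith

lemma gap_weak {p C b c v : ℤ} (hp : 1 ≤ p) (hid : v = p * c - C * b) (h : c ≤ 2 * b) :
    v ≤ (2 * p - C) * b := by
  have : p * c ≤ p * (2 * b) := mul_le_mul_of_nonneg_left h (by omega)
  linarith

lemma le_of_gap {p q u v : ℤ} (hq : 0 < q) (hqp : q < p) (hv : 0 < v)
    (h : 0 < q * v - p * u) : u ≤ v := by
  by_contra! hu
  nlinarith

lemma nonneg_of_gap {p q u v : ℤ} (hq : 0 < q) (hqp : q < p) (hv : 0 < v)
    (h : 0 < p * u - q * v) : 0 ≤ u := by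
  by_contra! hu
  nlinarith

lemma exists_gap (M : List ℕ) (n : ℕ) (hMlen : 2 ≤ M.length) (hMpos : ∀ x ∈ M, 0 < x)
    (hMlast : 2 ≤ M.getLast!) (hn : 2 ≤ n) :
    ∃ μ X Y e : ℤ, Gap n (cfQ M).den μ (cfQ M).num X Y e ∧
      ∀ s : ℚ, (memI1 M n s ∨ memI2 M n s) →
        0 ≤ s ∧ s ≤ 1 ∧ InGap (cfQ M).den (cfQ M).num X Y e s.num s.den := by
  obtain ⟨M', l, rfl⟩ : ∃ M' l, M = M' ++ [l] :=
    ⟨M.dropLast, M.getLast (by rintro rfl; simp at hMlen), (List.dropLast_append_getLast _).symm⟩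
  have hlast : (M' ++ [l]).getLast! = l := by simp
  rw [hlast] at hMlast
  have hM' : M' ≠ [] := by rintro rfl; simp at hMlen
  obtain ⟨A, B, C, D, h1, h2, h3, h4, h5, h6, h7, h8⟩ :=
    exists_moebius M' hM' fun x hx => hMpos x (by simp [hx])
  have hl : (2 : ℤ) ≤ l := by exact_mod_cast hMlast
  obtain ⟨q, hq⟩ : ∃ q, q = A * l + B := ⟨_, rfl⟩
  obtain ⟨p, hp⟩ : ∃ p, p = C * l + D := ⟨_, rfl⟩
  have hp2 : 2 ≤ p := by nlinarith
  have hCp : C < p := by nlinarith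
  have hq0 : 0 < q := by nlinarith
  have hqp : q < p := by nlinarith
  have hdet : q * C - p * A = (-1) ^ M'.length := by
    rw [pow_succ] at h7
    rw [hp, hq]; linarith
  have hn' : (2 : ℤ) ≤ n := by exact_mod_cast hn
  have hpQ : (0 : ℚ) < p := by exact_mod_cast (by linarith : (0 : ℤ) < p)
  have hCQ : (1 : ℚ) ≤ C := by exact_mod_cast h1.trans h3
  have hDQ : (1 : ℚ) ≤ D := by exact_mod_cast h5
  have hlQ : (2 : ℚ) ≤ l := by exact_mod_cast hl
  have hnQ : (2 : ℚ) ≤ n := by exact_mod_cast hn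
  have hqQ : (q : ℚ) = A * l + B := by exact_mod_cast hq
  have hpQ' : (p : ℚ) = C * l + D := by exact_mod_cast hp
  have r1 : cfQ (M' ++ [l]) = q / p := by
    rw [h8, hqQ, hpQ']
    simp only [cfQ, add_zero]
    field_simp
  have r2 : cfQ (M' ++ [l - 1, 2]) = (2 * q - A : ℤ) / (2 * p - C : ℤ) := by
    have e1 : ((l - 1 : ℕ) : ℚ) = l - 1 := by rw [Nat.cast_sub (by omega)]; simp
    have e3 : cfQ [l - 1, 2] = 2 / (2 * l - 1) := by
      simp only [cfQ, e1, add_zero]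
      rw [div_eq_div_iff (by norm_num; linarith) (by linarith)]
      push_cast; ring
    have h9 : (0 : ℚ) < 2 * l - 1 := by linarith
    rw [h8, e3]
    push_cast
    rw [hqQ, hpQ', div_eq_div_iff (by positivity) (by nlinarith)]
    field_simp
    ring
  have r3 : cfQ (M' ++ [l] ++ [2 * n - 2]) =
      ((2 * n - 2) * q + A : ℤ) / ((2 * n - 2) * p + C : ℤ) := by
    have e1 : ((2 * n - 2 : ℕ) : ℚ) = 2 * n - 2 := by rw [Nat.cast_sub (by omega)]; simp
    have h9 : (0 : ℚ) < 2 * n - 2 := by linarith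
    push_cast
    rw [List.append_assoc, h8, List.singleton_append, cfQ, cfQ, cfQ, e1, add_zero]
    generalize (2 * n - 2 : ℚ) = x at h9 ⊢
    have e3 : 1 / (l + 1 / x) = x / (l * x + 1) := by field_simp
    rw [e3, hqQ, hpQ', div_eq_div_iff (by positivity) (by positivity)]
    field_simp
    ring
  have hcop : Nat.Coprime q.natAbs p.natAbs := by
    rw [← Int.isCoprime_iff_nat_coprime]
    rcases neg_one_pow_eq_or ℤ M'.length with h | h <;> rw [h] at hdet
    · exact ⟨C, -A, by linarith⟩
    · exact ⟨-C, A, by linarith⟩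
  have hden : ((cfQ (M' ++ [l])).den : ℤ) = p := by
    rw [r1]; exact Rat.den_div_eq_of_coprime (by linarith) hcop
  have hnum : (cfQ (M' ++ [l])).num = q := by
    rw [r1]; exact Rat.num_div_eq_of_coprime (by linarith) hcop
  rw [hden, hnum]
  have hx : (2 : ℤ) ≤ 2 * n - 2 := by linarith
  have hx2 : (0 : ℤ) < (2 * n - 2) * p + C := by nlinarith
  have hle : ∀ (s : ℚ) (a b : ℤ), 0 < b → (s ≤ a / b ↔ s.num * b ≤ a * s.den) := by
    intro s a b hb
    have hbQ : (0 : ℚ) < b := by exact_mod_cast hb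
    have hsd : (0 : ℚ) < s.den := by exact_mod_cast s.den_pos
    conv_lhs => rw [← Rat.num_div_den s, div_le_div_iff₀ hsd hbQ]
    exact_mod_cast Iff.rfl
  have hge : ∀ (s : ℚ) (a b : ℤ), 0 < b → (a / b ≤ s ↔ a * s.den ≤ s.num * b) := by
    intro s a b hb
    have hbQ : (0 : ℚ) < b := by exact_mod_cast hb
    have hsd : (0 : ℚ) < s.den := by exact_mod_cast s.den_pos
    conv_lhs => rw [← Rat.num_div_den s, div_le_div_iff₀ hbQ hsd]
    exact_mod_cast Iff.rfl
  have hpar : Even (M' ++ [l]).length ↔ ¬ Even M'.length := by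
    simp [Nat.even_add_one]
  have hdl : (M' ++ [l]).dropLast = M' := by simp
  by_cases heven : Even M'.length
  · rw [heven.neg_one_pow] at hdet
    refine ⟨p - C, 2 * p - C, (2 * n - 2) * p + C, 1, ⟨hp2, by linarith, by linarith, hq0, hqp,
      ⟨q - A, by linarith⟩, by norm_num, by norm_num, by nlinarith, by linarith, by ring⟩,
      fun s hs => ?_⟩
    have hv : (0 : ℤ) < s.den := by exact_mod_cast s.den_pos
    have hid : (s.den : ℤ) = p * (s.num * C - s.den * A) - C * (p * s.num - q * s.den) := by
      linear_combination -s.den * hdet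
    simp only [memI1, memI2, hpar, heven, not_true_eq_false, if_false, hlast, hdl, r2, r3] at hs
    rcases hs with ⟨hs0, hs1⟩ | ⟨hs0, hs1⟩
    · rw [← not_le, hge _ _ _ hx2, not_le] at hs1
      have hb := gap_strict (x := 2 * n - 2) (by omega) hid (by linarith)
      rw [neg_sub] at hb
      have hb0 := pos_of_le_mul (by omega) hx2 hb
      exact ⟨hs0, Rat.num_le_denom_iff.1 (le_of_gap hq0 hqp hv hb0), Or.inr ⟨by linarith, hb⟩⟩
    · rw [hge _ _ _ (by linarith)] at hs0
      have hb := gap_weak (by omega) hid (by linarith)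
      have hb0 := pos_of_le_mul hv (by omega) hb
      exact ⟨Rat.num_nonneg.1 (nonneg_of_gap hq0 hqp hv hb0), hs1, Or.inl ⟨hb0, by linarith⟩⟩
  · rw [(Nat.not_even_iff_odd.1 heven).neg_one_pow] at hdet
    refine ⟨C, (2 * n - 2) * p + C, 2 * p - C, 0, ⟨hp2, by linarith, by linarith, hq0, hqp,
      ⟨A, by linarith⟩, by norm_num, by norm_num, by linarith, by nlinarith, by ring⟩,
      fun s hs => ?_⟩
    have hv : (0 : ℤ) < s.den := by exact_mod_cast s.den_pos
    have hid : (s.den : ℤ) = p * (s.den * A - s.num * C) - C * (q * s.den - p * s.num) := by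
      linear_combination s.den * hdet
    simp only [memI1, memI2, hpar, heven, not_false_eq_true, if_true, hlast, hdl, r2, r3] at hs
    rcases hs with ⟨hs0, hs1⟩ | ⟨hs0, hs1⟩
    · rw [hle _ _ _ (by linarith)] at hs1
      have hb := gap_weak (by omega) hid (by linarith)
      have hb0 := pos_of_le_mul hv (by omega) hb
      exact ⟨hs0, Rat.num_le_denom_iff.1 (le_of_gap hq0 hqp hv hb0),
        Or.inr ⟨by linarith, by linarith⟩⟩
    · rw [← not_le, hle _ _ _ hx2, not_le] at hs0
      have hb := gap_strict (x := 2 * n - 2) (by omega) hid (by linarith)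
      rw [neg_sub] at hb
      have hb0 := pos_of_le_mul (by omega) hx2 hb
      exact ⟨Rat.num_nonneg.1 (nonneg_of_gap hq0 hqp hv hb0), hs1, Or.inl ⟨hb0, by linarith⟩⟩

/-- The word of `u_s ^ n` or of its inverse. -/
def orientedWord (s : ℚ) (n : ℕ) (b : Bool) : List (Fin 2 × Bool) :=
  if b then lineWord s n else FreeGroup.invRev (lineWord s n)

lemma isLine_orientedWord (s : ℚ) (h0 : 0 ≤ s) (h1 : s ≤ 1) (n : ℕ) (b : Bool) :
    IsLine s.den s.num (orientedWord s n b) := by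
  cases b
  · exact isLine_invRev_lineWord s h0 h1 n
  · exact isLine_lineWord s h0 h1 n

lemma length_orientedWord (s : ℚ) (n : ℕ) (b : Bool) :
    (orientedWord s n b).length = 2 * s.den * n := by
  cases b
  · simp [orientedWord, length_lineWord]
  · simp [orientedWord, length_lineWord]

lemma mk_orientedWord_true (s : ℚ) (h0 : 0 ≤ s) (n : ℕ) :
    FreeGroup.mk (orientedWord s n true) = uWord s ^ n := by
  rw [uWord_eq s h0, ← mk_lineWord]; rfl

lemma mk_orientedWord_false (s : ℚ) (h0 : 0 ≤ s) (n : ℕ) :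
    FreeGroup.mk (orientedWord s n false) = (uWord s ^ n)⁻¹ := by
  rw [uWord_eq s h0, ← mk_lineWord, FreeGroup.inv_mk]; rfl

lemma exists_list_of_mem_heckN {r : ℚ} (h0 : 0 ≤ r) {n : ℕ} {h : F} (hh : h ∈ heckN r n) :
    ∃ L : List (F × Bool),
      h = (L.map fun c => c.1 * FreeGroup.mk (orientedWord r n c.2) * c.1⁻¹).prod := by
  have hh' : h ∈ (Subgroup.closure (Group.conjugatesOfSet {uWord r ^ n})).toSubmonoid := hh
  rw [Subgroup.closure_toSubmonoid] at hh'
  obtain ⟨l, hl, rfl⟩ := Submonoid.exists_list_of_mem_closure hh'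
  clear hh hh'
  induction l with
  | nil => exact ⟨[], rfl⟩
  | cons x l ih =>
    obtain ⟨L, hL⟩ := ih fun y hy => hl y (by simp [hy])
    have hx : ∃ c : F × Bool, x = c.1 * FreeGroup.mk (orientedWord r n c.2) * c.1⁻¹ := by
      rcases hl x (by simp) with hx | hx
      · obtain ⟨y, hy, hc⟩ := Group.mem_conjugatesOfSet_iff.1 hx
        rw [Set.mem_singleton_iff] at hy
        obtain ⟨c, hc⟩ := isConj_iff.1 hc
        exact ⟨(c, true), by rw [mk_orientedWord_true r h0, ← hc, hy]⟩
      · obtain ⟨y, hy, hc⟩ := Group.mem_conjugatesOfSet_iff.1 hx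
        rw [Set.mem_singleton_iff] at hy
        obtain ⟨c, hc⟩ := isConj_iff.1 hc
        refine ⟨(c, false), ?_⟩
        rw [mk_orientedWord_false r h0, ← inv_inv x, ← hc, hy]
        group
    obtain ⟨c, hc⟩ := hx
    exact ⟨c :: L, by rw [List.prod_cons, List.map_cons, List.prod_cons, ← hc, hL]⟩

/-- A product of conjugates of relators which equals a product of two conjugates gives a
relation. -/
lemma exists_isRep (W : Bool ⊕ Bool → List (Fin 2 × Bool)) (L : List (F × Bool)) (g : F)
    (h : g * FreeGroup.mk (W (Sum.inr false)) * g⁻¹ * FreeGroup.mk (W (Sum.inr true)) *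
      (L.map fun c => c.1 * FreeGroup.mk (W (Sum.inl c.2)) * c.1⁻¹).prod = 1) :
    ∃ m, IsRep W m := by
  set T : List (F × (Bool ⊕ Bool)) := (g, Sum.inr false) :: (1, Sum.inr true) ::
    L.map fun c => (c.1, Sum.inl c.2) with hT
  refine ⟨T.length, fun i => (T.get i).1, fun i => (T.get i).2, ?_, ?_⟩
  · have h1 : ((List.finRange T.length).map fun i => (T.get i).1 *
        FreeGroup.mk (W (T.get i).2) * ((T.get i).1)⁻¹) =
        T.map fun c => c.1 * FreeGroup.mk (W c.2) * c.1⁻¹ := by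
      conv_rhs => rw [← List.map_get_finRange T, List.map_map]
      rfl
    refine Eq.trans ?_ h
    rw [h1, hT, List.map_cons, List.map_cons, List.map_map, List.prod_cons, List.prod_cons]
    change g * FreeGroup.mk (W (Sum.inr false)) * g⁻¹ *
      (1 * FreeGroup.mk (W (Sum.inr true)) * 1⁻¹ *
        (L.map fun c => c.1 * FreeGroup.mk (W (Sum.inl c.2)) * c.1⁻¹).prod) = _
    rw [one_mul, inv_one, mul_one, ← mul_assoc]
  · have hrest : ∀ (i : ℕ) (hi : i + 2 < T.length) (b : Bool),
        (T.get ⟨i + 2, hi⟩).2 ≠ Sum.inr b := by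
      intro i hi b
      have : T.get ⟨i + 2, hi⟩ ∈ L.map fun c => ((c.1, Sum.inl c.2) : F × (Bool ⊕ Bool)) :=
        List.get_mem _ ⟨i, by simpa [hT] using hi⟩
      obtain ⟨c, -, hc⟩ := List.mem_map.1 this
      rw [← hc]
      simp
    intro b
    cases b
    · refine ⟨⟨0, by simp [hT]⟩, rfl, ?_⟩
      rintro ⟨_ | _ | i, hi⟩ h
      · rfl
      · exact absurd h (by simp [hT])
      · exact absurd h (hrest i hi _)
    · refine ⟨⟨1, by simp [hT]⟩, rfl, ?_⟩
      rintro ⟨_ | _ | i, hi⟩ h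
      · exact absurd h (by simp [hT])
      · rfl
      · exact absurd h (hrest i hi _)

/-- Distinct slopes in the gap give non-conjugate elements; `o` is the orientation of the
second loop. -/
lemma not_isConj_of_gap {r : ℚ} {n : ℕ} {μ X Y e : ℤ} (hn : 2 ≤ n)
    (hG : Gap n r.den μ r.num X Y e) {s s' : ℚ} (hss' : s ≠ s')
    (hs : 0 ≤ s ∧ s ≤ 1 ∧ InGap r.den r.num X Y e s.num s.den)
    (hs' : 0 ≤ s' ∧ s' ≤ 1 ∧ InGap r.den r.num X Y e s'.num s'.den) (o : Bool) :
    ¬ IsConj (heckQ r n (uWord s))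
      (heckQ r n (FreeGroup.mk (orientedWord s' 1 o))⁻¹) := by
  intro hconj
  obtain ⟨c, hc⟩ := isConj_iff.1 hconj
  obtain ⟨g, rfl⟩ := QuotientGroup.mk'_surjective (heckN r n) c
  have hr0 : 0 ≤ r := Rat.num_nonneg.1 hG.hq0.le
  have hr1 : r ≤ 1 := Rat.num_le_denom_iff.1 hG.hqp.le
  set v := FreeGroup.mk (orientedWord s' 1 o) with hv
  have hmem : (g * uWord s * g⁻¹ * v)⁻¹ ∈ heckN r n := by
    rw [inv_mem_iff, ← (QuotientGroup.eq_one_iff (N := heckN r n) _)]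
    change heckQ r n (g * uWord s * g⁻¹ * v) = 1
    rw [map_inv] at hc
    rw [map_mul, ← inv_inv (heckQ r n v), ← hc, map_mul, map_mul, map_inv]
    exact mul_inv_cancel _
  obtain ⟨L, hL⟩ := exists_list_of_mem_heckN hr0 hmem
  set W : Bool ⊕ Bool → List (Fin 2 × Bool) := Sum.elim (orientedWord r n)
    (fun b => if b then orientedWord s' 1 o else orientedWord s 1 true) with hW
  obtain ⟨m, hm⟩ := exists_isRep W L g (by
    change g * FreeGroup.mk (orientedWord s 1 true) * g⁻¹ * v *
      (L.map fun c => c.1 * FreeGroup.mk (orientedWord r n c.2) * c.1⁻¹).prod = 1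
    rw [← hL, mk_orientedWord_true s hs.1, pow_one, mul_inv_cancel])
  refine no_rep (hG.slopes (by exact_mod_cast hn) (fun b => if b then s'.den else s.den)
    (fun b => if b then s'.num else s.num) ?_ ?_ ?_) W ?_ ?_ ?_ ?_ m hm
  · intro i
    cases i
    · simpa using s.den_pos
    · simpa using s'.den_pos
  · intro h
    refine hss' (Rat.eq_iff_mul_eq_mul.2 ?_)
    simp only [Bool.false_eq_true, if_false, if_true] at h
    linarith
  · intro i
    cases i
    · exact hs.2.2
    · exact hs'.2.2
  · exact fun b => isLine_orientedWord r hr0 hr1 n b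
  · intro b
    cases b
    · exact isLine_orientedWord s hs.1 hs.2.1 1 true
    · exact isLine_orientedWord s' hs'.1 hs'.2.1 1 o
  · intro b
    change ((orientedWord r n b).length : ℤ) = _
    rw [length_orientedWord]
    push_cast; ring
  · intro b
    cases b
    · change ((orientedWord s 1 true).length : ℤ) = 2 * (s.den : ℤ)
      rw [length_orientedWord]
      push_cast; ring
    · change ((orientedWord s' 1 o).length : ℤ) = 2 * (s'.den : ℤ)
      rw [length_orientedWord]
      push_cast; ring

/-- Main Theorem (1): simple loops `α_s`, `s ∈ I₁(r;n) ∪ I₂(r;n)`, represent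
mutually distinct (unoriented) conjugacy classes in `Heck(r;n)`. -/
theorem statement0
    (M : List ℕ) (m n : ℕ) (r : ℚ)
    (hMlen : 2 ≤ M.length) (hMpos : ∀ x ∈ M, 0 < x) (hMlast : 2 ≤ M.getLast!)
    (hm : M.head? = some m) (hn : 2 ≤ n) (hr : r = cfQ M)
    (s s' : ℚ) (hss' : s ≠ s')
    (hs : memI1 M n s ∨ memI2 M n s) (hs' : memI1 M n s' ∨ memI2 M n s') :
    ¬ IsConj (heckQ r n (uWord s)) (heckQ r n (uWord s')) ∧
    ¬ IsConj (heckQ r n (uWord s)) ((heckQ r n (uWord s'))⁻¹) := by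
  subst hr
  obtain ⟨μ, X, Y, e, hG, hgap⟩ := exists_gap M n hMlen hMpos hMlast hn
  have h := not_isConj_of_gap hn hG hss' (hgap s hs) (hgap s' hs')
  have h0 := (hgap s' hs').1
  constructor
  · simpa only [mk_orientedWord_false s' h0, pow_one, inv_inv] using h false
  · simpa only [mk_orientedWord_true s' h0, pow_one, map_inv] using h true

end Heckoid
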